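/- arXiv:1905.11504 — 3 statements merged into one kernel-verified Lean document; each statement's English description precedes it below -/
import Mathlib

section
/- Assume there exist constants c₀ ∈ (0,1), c₁ > 1 and t₀ > 0 such that for all t₂ > t₁ > t₀, the inequality f(t₂) ≥ c₁ f(t₁) implies (1 − c₀) f′(t₂) ≥ f′(t₁). Then there exist constants c, c′ > 0 and α₀ such that for every α ≥ α₀, every semistable solution u of problem (P_{α,λ*(α)}) satisfies u(0) ≤ c·A_α whenever A_α > 0 satisfies f′(A_α) = c′ log α. Moreover, for every p ∈ [1,∞), if for each large α, u_α is a semistable solution of (P_{α,λ*(α)}), then ∫₀¹ u_α(r)^p r dr → 0 as α → ∞. -/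
open Set MeasureTheory Filter

/-- The standing data and assumptions of the Gelfand-type problem for
auto-ignition of a free round turbulent jet:
`f : [0,∞) → (0,∞)` is `C¹`, convex, non-decreasing with `K = ∫₀^∞ ds / f s < ∞`;
`φ, ψ : [0,1] → [0,∞)` are non-increasing Lipschitz with `φ 0 = ψ 0 = 1`,
`φ > 0` on `[0,1)`, and `M s = max_{r ∈ [0,s]} ψ r / φ r` is integrable on `(0,1)`. -/
structure GelfandData where
  f : ℝ → ℝ
  phi : ℝ → ℝ
  psi : ℝ → ℝ
  M : ℝ → ℝ
  K : ℝ
  f_pos : ∀ s, 0 ≤ s → 0 < f s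
  f_smooth : ContDiffOn ℝ 1 f (Ici 0)
  f_convex : ConvexOn ℝ (Ici 0) f
  f_mono : MonotoneOn f (Ici 0)
  f_int : IntegrableOn (fun s => 1 / f s) (Ioi 0)
  K_def : K = ∫ s in Ioi (0:ℝ), 1 / f s
  phi_nonneg : ∀ r ∈ Icc (0:ℝ) 1, 0 ≤ phi r
  psi_nonneg : ∀ r ∈ Icc (0:ℝ) 1, 0 ≤ psi r
  phi_anti : AntitoneOn phi (Icc 0 1)
  psi_anti : AntitoneOn psi (Icc 0 1)
  phi_lip : ∃ L, LipschitzOnWith L phi (Icc 0 1)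
  psi_lip : ∃ L, LipschitzOnWith L psi (Icc 0 1)
  phi_zero : phi 0 = 1
  psi_zero : psi 0 = 1
  phi_pos : ∀ r ∈ Ico (0:ℝ) 1, 0 < phi r
  M_def : ∀ s ∈ Ico (0:ℝ) 1, IsGreatest ((fun r => psi r / phi r) '' Icc 0 s) (M s)
  M_int : IntegrableOn M (Ioo 0 1)

/-- `u` is a (classical, radial) solution of problem `(P_{α,λ})`:
`u ∈ C²((0,1)) ∩ C¹([0,1])`, `u > 0` on `[0,1)`, `u'(0) = 0`, `u 1 = 0`, and
`-u'' - (1/r + α r φ(r)) u' = λ ψ(r) f(u(r))` on `(0,1)`. -/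
def IsSolution (D : GelfandData) (α lam : ℝ) (u : ℝ → ℝ) : Prop :=
  ContDiffOn ℝ 1 u (Icc 0 1) ∧ ContDiffOn ℝ 2 u (Ioo 0 1) ∧
  (∀ r ∈ Ico (0:ℝ) 1, 0 < u r) ∧
  derivWithin u (Icc 0 1) 0 = 0 ∧ u 1 = 0 ∧
  ∀ r ∈ Ioo (0:ℝ) 1,
    -(derivWithin (derivWithin u (Icc 0 1)) (Ioo 0 1) r)
      - (1 / r + α * r * D.phi r) * derivWithin u (Icc 0 1) r
      = lam * D.psi r * D.f (u r)

/-- The set of `λ > 0` for which problem `(P_{α,λ})` admits a solution. -/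
def solvableSet (D : GelfandData) (α : ℝ) : Set ℝ :=
  {lam | 0 < lam ∧ ∃ u, IsSolution D α lam u}

/-- The extremal Frank-Kamenetskii parameter `λ*(α)`. -/
noncomputable def lamStar (D : GelfandData) (α : ℝ) : ℝ := sSup (solvableSet D α)

/-- The weight `μ(r) = exp(α ∫₀^r s φ(s) ds)`. -/
noncomputable def muW (D : GelfandData) (α r : ℝ) : ℝ :=
  Real.exp (α * ∫ s in (0:ℝ)..r, s * D.phi s)

/-- `u` is a semistable solution: for every `C¹` test function `η` with `η 1 = 0`,
`∫₀¹ η'^2 μ r dr ≥ λ ∫₀¹ ψ f'(u) η² μ r dr`. -/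
def IsSemistable (D : GelfandData) (α lam : ℝ) (u : ℝ → ℝ) : Prop :=
  ∀ η : ℝ → ℝ, ContDiff ℝ 1 η → η 1 = 0 →
    lam * ∫ r in Ioo (0:ℝ) 1,
        D.psi r * derivWithin D.f (Ici 0) (u r) * (η r) ^ 2 * muW D α r * r
      ≤ ∫ r in Ioo (0:ℝ) 1, (deriv η r) ^ 2 * muW D α r * r

set_option linter.unusedVariables false
noncomputable section GBsec

namespace GB

def cl (r : ℝ) : ℝ := max 0 (min 1 r)

lemma cl_mem (r : ℝ) : cl r ∈ Icc (0:ℝ) 1 :=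
  ⟨le_max_left _ _, max_le zero_le_one (min_le_left _ _)⟩

lemma cl_eq {r : ℝ} (h : r ∈ Icc (0:ℝ) 1) : cl r = r := by
  unfold cl; rw [min_eq_right h.2, max_eq_right h.1]

lemma cl_cont : Continuous cl := by unfold cl; fun_prop

lemma cl_mono : Monotone cl := fun a b h => max_le_max le_rfl (min_le_min le_rfl h)

def Pe (D : GelfandData) (r : ℝ) : ℝ := D.phi (cl r)
def Se (D : GelfandData) (r : ℝ) : ℝ := D.psi (cl r)
def fd (D : GelfandData) (t : ℝ) : ℝ := derivWithin D.f (Ici 0) (max t 0)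
def fe (D : GelfandData) (t : ℝ) : ℝ := D.f (max t 0)
def mE (D : GelfandData) (α r : ℝ) : ℝ := Real.exp (α * ∫ s in (0:ℝ)..r, s * Pe D s)

lemma mx0 (t : ℝ) : max t 0 ∈ Ici (0:ℝ) := le_max_right t 0

variable (D : GelfandData)

lemma Pe_eq {r : ℝ} (h : r ∈ Icc (0:ℝ) 1) : Pe D r = D.phi r := by unfold Pe; rw [cl_eq h]
lemma Se_eq {r : ℝ} (h : r ∈ Icc (0:ℝ) 1) : Se D r = D.psi r := by unfold Se; rw [cl_eq h]

lemma Pe_cont : Continuous (Pe D) := by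
  obtain ⟨L, hL⟩ := D.phi_lip
  exact hL.continuousOn.comp_continuous cl_cont cl_mem
lemma Se_cont : Continuous (Se D) := by
  obtain ⟨L, hL⟩ := D.psi_lip
  exact hL.continuousOn.comp_continuous cl_cont cl_mem

lemma Pe_anti : Antitone (Pe D) := fun _ _ h => D.phi_anti (cl_mem _) (cl_mem _) (cl_mono h)
lemma Se_anti : Antitone (Se D) := fun _ _ h => D.psi_anti (cl_mem _) (cl_mem _) (cl_mono h)
lemma Pe_nonneg (r : ℝ) : 0 ≤ Pe D r := D.phi_nonneg _ (cl_mem _)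
lemma Se_nonneg (r : ℝ) : 0 ≤ Se D r := D.psi_nonneg _ (cl_mem _)
lemma Pe_zero : Pe D 0 = 1 := by rw [Pe_eq D (by simp)]; exact D.phi_zero
lemma Se_zero : Se D 0 = 1 := by rw [Se_eq D (by simp)]; exact D.psi_zero
lemma Pe_le (r : ℝ) : Pe D r ≤ 1 := by
  rw [← D.phi_zero]; exact D.phi_anti (by simp) (cl_mem _) (cl_mem r).1
lemma Se_le (r : ℝ) : Se D r ≤ 1 := by
  rw [← D.psi_zero]; exact D.psi_anti (by simp) (cl_mem _) (cl_mem r).1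

lemma fd_cont : Continuous (fd D) := by
  have := D.f_smooth.continuousOn_derivWithin (uniqueDiffOn_Ici 0) le_rfl
  exact this.comp_continuous (by fun_prop) mx0
lemma fe_cont : Continuous (fe D) :=
  D.f_smooth.continuousOn.comp_continuous (by fun_prop) mx0
lemma fe_mono : Monotone (fe D) := fun _ _ h =>
  D.f_mono (mx0 _) (mx0 _) (max_le_max h le_rfl)
lemma fe_pos (t : ℝ) : 0 < fe D t := D.f_pos _ (le_max_right _ _)
lemma fe_eq {t : ℝ} (h : 0 ≤ t) : fe D t = D.f t := by unfold fe; rw [max_eq_left h]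
lemma fd_eq {t : ℝ} (h : 0 ≤ t) : fd D t = derivWithin D.f (Ici 0) t := by
  unfold fd; rw [max_eq_left h]

lemma fd_mono : Monotone (fd D) := by
  intro a b h
  have := D.f_convex.monotoneOn_derivWithin (D.f_smooth.differentiableOn one_ne_zero)
  exact this (mx0 _) (mx0 _) (max_le_max h le_rfl)

lemma fd_nonneg (t : ℝ) : 0 ≤ fd D t := by
  exact D.f_mono.derivWithin_nonneg 

lemma f_hasDeriv {t : ℝ} (h : 0 < t) : HasDerivAt (fe D) (fd D t) t := by
  have h1 : DifferentiableWithinAt ℝ D.f (Ici 0) t :=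
    (D.f_smooth.differentiableOn one_ne_zero) t h.le
  have h2 := h1.hasDerivWithinAt.hasDerivAt (Ici_mem_nhds h)
  rw [← fd_eq D h.le] at h2
  refine h2.congr_of_eventuallyEq ?_
  filter_upwards [Ioi_mem_nhds h] with x hx
  exact fe_eq D (le_of_lt hx)

/-- convexity: `f t ≤ f 0 + t f' t`. -/
lemma f_le {t : ℝ} (h : 0 ≤ t) : fe D t ≤ fe D 0 + t * fd D t := by
  rcases h.eq_or_lt with rfl | h
  · simp
  obtain ⟨c, hc, hc'⟩ := exists_hasDerivAt_eq_slope (fe D) (fd D) h (fe_cont D).continuousOn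
    (fun x hx => f_hasDeriv D hx.1)
  have := fd_mono D hc.2.le
  rw [hc', sub_zero, div_le_iff₀ h] at this
  linarith

lemma kP_cont : Continuous (fun s => s * Pe D s) := continuous_id.mul (Pe_cont D)

lemma mE_pos (α r : ℝ) : 0 < mE D α r := Real.exp_pos _
lemma mE_zero (α : ℝ) : mE D α 0 = 1 := by simp [mE]
lemma mE_deriv (α r : ℝ) : HasDerivAt (mE D α) (α * r * Pe D r * mE D α r) r := by
  have h := (kP_cont D).integral_hasStrictDerivAt 0 r
  have := (h.hasDerivAt.const_mul α).exp
  refine HasDerivAt.congr_deriv (f := mE D α) this ?_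
  change mE D α r * _ = _
  ring
lemma mE_cont (α : ℝ) : Continuous (mE D α) :=
  continuous_iff_continuousAt.2 fun r => (mE_deriv D α r).continuousAt
lemma muW_eq (α : ℝ) {r : ℝ} (h : r ∈ Icc (0:ℝ) 1) : muW D α r = mE D α r := by
  unfold muW mE
  congr 2
  apply intervalIntegral.integral_congr
  intro s hs
  rw [uIcc_of_le h.1] at hs
  simp only
  rw [Pe_eq D ⟨hs.1, hs.2.trans h.2⟩]

lemma mE_mono {α : ℝ} (hα : 0 ≤ α) : MonotoneOn (mE D α) (Ici 0) := by
  apply monotoneOn_of_deriv_nonneg (convex_Ici 0) (mE_cont D α).continuousOn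
  · intro x _; exact (mE_deriv D α x).differentiableAt.differentiableWithinAt
  · intro x hx
    rw [interior_Ici] at hx
    rw [(mE_deriv D α x).deriv]
    have := Pe_nonneg D x; have := mE_pos D α x; have : 0 < x := hx
    positivity

lemma one_le_mE {α r : ℝ} (hα : 0 ≤ α) (hr : 0 ≤ r) : 1 ≤ mE D α r := by
  rw [← mE_zero D α]; exact mE_mono D hα (by simp) hr hr

/-- lower bound of ratios. -/
lemma mE_ratio {α a b p : ℝ} (hα : 0 ≤ α) (ha : 0 ≤ a) (hab : a ≤ b) (hp : p ≤ Pe D b) :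
    mE D α a * Real.exp (α * p * (b ^ 2 - a ^ 2) / 2) ≤ mE D α b := by
  unfold mE
  rw [← Real.exp_add]
  apply Real.exp_le_exp.2
  have hi : ∀ x y : ℝ, IntervalIntegrable (fun s => s * Pe D s) volume x y :=
    fun x y => (kP_cont D).intervalIntegrable x y
  rw [← intervalIntegral.integral_add_adjacent_intervals (hi 0 a) (hi a b)]
  have : p * (b ^ 2 - a ^ 2) / 2 ≤ ∫ s in a..b, s * Pe D s := by
    have h1 : ∫ s in a..b, s * p = p * (b ^ 2 - a ^ 2) / 2 := by
      rw [intervalIntegral.integral_mul_const, integral_id]; ring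
    rw [← h1]
    apply intervalIntegral.integral_mono_on hab (Continuous.intervalIntegrable (by fun_prop) _ _) (hi a b)
    intro x hx
    exact mul_le_mul_of_nonneg_left (hp.trans (Pe_anti D hx.2)) (ha.trans hx.1)
  nlinarith [mul_le_mul_of_nonneg_left this hα]

lemma mE_le {α r : ℝ} (hα : 0 ≤ α) (hr : 0 ≤ r) : mE D α r ≤ Real.exp (α * r ^ 2 / 2) := by
  unfold mE
  apply Real.exp_le_exp.2
  have : ∫ s in (0:ℝ)..r, s * Pe D s ≤ r ^ 2 / 2 := by
    have h1 : ∫ s in (0:ℝ)..r, s = r ^ 2 / 2 := by rw [integral_id]; ring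
    rw [← h1]
    apply intervalIntegral.integral_mono_on hr ((kP_cont D).intervalIntegrable _ _)
      (Continuous.intervalIntegrable (by fun_prop) _ _)
    intro x hx
    exact mul_le_of_le_one_right hx.1 (Pe_le D x)
  nlinarith [mul_le_mul_of_nonneg_left this hα]

lemma int_Pm {α : ℝ} (hα : 0 < α) (s : ℝ) :
    ∫ t in (0:ℝ)..s, Pe D t * (t * mE D α t) = (mE D α s - 1) / α := by
  have hc : Continuous (fun t => Pe D t * (t * mE D α t)) :=
    (Pe_cont D).mul (continuous_id.mul (mE_cont D α))
  have := intervalIntegral.integral_eq_sub_of_hasDerivAt (a := 0) (b := s)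
    (f := fun t => mE D α t / α) (f' := fun t => Pe D t * (t * mE D α t))
    (fun x _ => by
      have h := (mE_deriv D α x).div_const α
      exact h.congr_deriv (by rw [div_eq_iff hα.ne']; ring)) (hc.intervalIntegrable _ _)
  rw [this, mE_zero]; ring

lemma Sm_cont (α : ℝ) : Continuous (fun t => Se D t * (t * mE D α t)) :=
  (Se_cont D).mul (continuous_id.mul (mE_cont D α))

/-- `I(s) = ∫₀ˢ ψ t μ`. -/
def IS (α s : ℝ) : ℝ := ∫ t in (0:ℝ)..s, Se D t * (t * mE D α t)

lemma IS_le {α s : ℝ} (hα : 0 < α) (hs : s ∈ Ico (0:ℝ) 1) :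
    IS D α s ≤ D.M s * (mE D α s - 1) / α := by
  rw [mul_div_assoc, ← int_Pm D hα, ← intervalIntegral.integral_const_mul]
  have hc : Continuous (fun t => D.M s * (Pe D t * (t * mE D α t))) :=
    continuous_const.mul ((Pe_cont D).mul (continuous_id.mul (mE_cont D α)))
  apply intervalIntegral.integral_mono_on hs.1 ((Sm_cont D α).intervalIntegrable _ _)
    (hc.intervalIntegrable _ _)
  intro x hx
  have hx1 : x ∈ Icc (0:ℝ) 1 := ⟨hx.1, hx.2.trans hs.2.le⟩
  have h1 : D.psi x / D.phi x ≤ D.M s := (D.M_def s hs).2 ⟨x, hx, rfl⟩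
  have h2 := D.phi_pos x ⟨hx.1, hx.2.trans_lt hs.2⟩
  rw [div_le_iff₀ h2] at h1
  rw [← Pe_eq D hx1, ← Se_eq D hx1] at h1
  rw [← mul_assoc (D.M s)]
  exact mul_le_mul_of_nonneg_right h1 (mul_nonneg hx.1 (mE_pos D α x).le)

lemma IS_le2 {α s : ℝ} (hα : 0 ≤ α) (hs : 0 ≤ s) : IS D α s ≤ mE D α s * (s ^ 2 / 2) := by
  have h1 : ∫ t in (0:ℝ)..s, mE D α s * t = mE D α s * (s ^ 2 / 2) := by
    rw [intervalIntegral.integral_const_mul, integral_id]; ring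
  rw [← h1]
  apply intervalIntegral.integral_mono_on hs ((Sm_cont D α).intervalIntegrable _ _)
    (Continuous.intervalIntegrable (by fun_prop) _ _)
  intro x hx
  have h2 := mE_mono D hα hx.1 hs hx.2
  have h3 : x * mE D α x ≤ mE D α s * x := by nlinarith [hx.1]
  have h4 := Se_le D x
  have h5 := mul_nonneg hx.1 (mE_pos D α x).le
  nlinarith

lemma IS_ge {α s : ℝ} (hα : 0 < α) (hs : 0 ≤ s) :
    Se D s * (mE D α s - 1) / α ≤ IS D α s := by
  rw [mul_div_assoc, ← int_Pm D hα, ← intervalIntegral.integral_const_mul]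
  have hc : Continuous (fun t => Se D s * (Pe D t * (t * mE D α t))) :=
    continuous_const.mul ((Pe_cont D).mul (continuous_id.mul (mE_cont D α)))
  apply intervalIntegral.integral_mono_on hs (hc.intervalIntegrable _ _)
    ((Sm_cont D α).intervalIntegrable _ _)
  intro x hx
  have h5 := mul_nonneg hx.1 (mE_pos D α x).le
  have h1 := Se_anti D hx.2
  have h2 := Pe_le D x
  have h3 := Pe_nonneg D x
  have h4 := Se_nonneg D s
  have : Se D s * Pe D x ≤ Se D x := by nlinarith
  rw [← mul_assoc (Se D s)]
  exact mul_le_mul_of_nonneg_right this h5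

lemma IS_pos {α s : ℝ} (hs : 0 < s) : 0 < IS D α s := by
  have hev : ∀ᶠ x in nhds (0:ℝ), 0 < Se D x := by
    apply (Se_cont D).continuousAt.eventually (lt_mem_nhds _)
    rw [Se_zero]; norm_num
  apply intervalIntegral.integral_pos hs (Sm_cont D α).continuousOn
  · intro x hx
    exact mul_nonneg (Se_nonneg D x) (mul_nonneg hx.1.le (mE_pos D α x).le)
  · obtain ⟨e, he, h⟩ := Metric.eventually_nhds_iff.1 hev
    refine ⟨min (e / 2) s, ⟨by positivity, min_le_right _ _⟩, ?_⟩
    have hp : 0 < min (e / 2) s := by positivity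
    refine mul_pos (h ?_) (mul_pos hp (mE_pos D α _))
    rw [Real.dist_0_eq_abs, abs_of_pos hp]
    linarith [min_le_left (e / 2) s]

section Pbsec
variable (D : GelfandData)
structure Sol (α lam : ℝ) (u w : ℝ → ℝ) : Prop where
  uc : ContinuousOn u (Icc 0 1)
  wc : ContinuousOn w (Icc 0 1)
  ud : ∀ r ∈ Ioo (0:ℝ) 1, HasDerivAt u (-(w r)) r
  Fd : ∀ r ∈ Ioo (0:ℝ) 1, HasDerivAt (fun r => r * mE D α r * w r)
    (lam * fe D (u r) * (Se D r * (r * mE D α r))) r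
  up : ∀ r ∈ Ico (0:ℝ) 1, 0 < u r
  u1 : u 1 = 0

variable {D}

lemma sol_of {α lam : ℝ} {u : ℝ → ℝ} (h : IsSolution D α lam u) :
    Sol D α lam u (fun r => -derivWithin u (Icc 0 1) r) := by
  obtain ⟨h1, h2, h3, h4, h5, h6⟩ := h
  have hd : ∀ r ∈ Ioo (0:ℝ) 1, HasDerivAt u (derivWithin u (Icc 0 1) r) r := fun r hr =>
    ((h1.differentiableOn one_ne_zero) r ⟨hr.1.le, hr.2.le⟩).hasDerivWithinAt.hasDerivAt
      (Icc_mem_nhds hr.1 hr.2)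
  have hdd : ∀ r ∈ Ioo (0:ℝ) 1, HasDerivAt (derivWithin u (Icc 0 1))
      (derivWithin (derivWithin u (Icc 0 1)) (Ioo 0 1) r) r := by
    have e : EqOn (derivWithin u (Icc 0 1)) (derivWithin u (Ioo 0 1)) (Ioo 0 1) := by
      intro r hr
      rw [← (hd r hr).deriv, derivWithin_of_isOpen isOpen_Ioo hr]
    have h2' : ContDiffOn ℝ 1 (derivWithin u (Ioo 0 1)) (Ioo 0 1) :=
      h2.derivWithin (uniqueDiffOn_Ioo 0 1) (by norm_num)
    have h2'' := (h2'.congr e).differentiableOn one_ne_zero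
    intro r hr
    exact (h2'' r hr).hasDerivWithinAt.hasDerivAt (Ioo_mem_nhds hr.1 hr.2)
  refine ⟨h1.continuousOn, ?_, ?_, ?_, h3, h5⟩
  · exact (h1.continuousOn_derivWithin (uniqueDiffOn_Icc zero_lt_one) le_rfl).neg
  · intro r hr; simpa using hd r hr
  · intro r hr
    have hr' : r ∈ Icc (0:ℝ) 1 := ⟨hr.1.le, hr.2.le⟩
    have := ((hasDerivAt_id r).mul (mE_deriv D α r)).mul (hdd r hr).neg
    refine this.congr_deriv ?_
    have e := h6 r hr
    rw [← Pe_eq D hr', ← Se_eq D hr', ← fe_eq D (h3 r ⟨hr.1.le, hr.2⟩).le] at e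
    have hr0 : r ≠ 0 := hr.1.ne'
    simp only [id, Pi.mul_apply, Pi.neg_apply]
    have e2 : lam * fe D (u r) * (Se D r * (r * mE D α r))
      = (lam * Se D r * fe D (u r)) * (r * mE D α r) := by ring
    rw [e2, ← e]
    field_simp
    ring

section
variable {α lam : ℝ} {u w : ℝ → ℝ} (S : Sol D α lam u w)
include S

lemma Fc : ContinuousOn (fun r => r * mE D α r * w r) (Icc 0 1) :=
  (continuousOn_id.mul (mE_cont D α).continuousOn).mul S.wc

lemma rhs_c : ContinuousOn (fun r => lam * fe D (u r) * (Se D r * (r * mE D α r))) (Icc 0 1) :=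
  (continuousOn_const.mul ((fe_cont D).comp_continuousOn S.uc)).mul (Sm_cont D α).continuousOn

lemma F_sub {a b : ℝ} (ha : 0 ≤ a) (hab : a ≤ b) (hb : b ≤ 1) :
    b * mE D α b * w b - a * mE D α a * w a
      = ∫ t in a..b, lam * fe D (u t) * (Se D t * (t * mE D α t)) := by
  have hs : Icc a b ⊆ Icc 0 1 := Icc_subset_Icc ha hb
  symm
  refine intervalIntegral.integral_eq_sub_of_hasDerivAt_of_le (f := fun r => r * mE D α r * w r)
    hab ((Fc S).mono hs)
    (fun x hx => S.Fd x ⟨ha.trans_lt hx.1, hx.2.trans_le hb⟩) ?_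
  exact ((rhs_c S).mono hs).intervalIntegrable_of_Icc hab

lemma F_eq {b : ℝ} (h0 : 0 ≤ b) (hb : b ≤ 1) :
    b * mE D α b * w b = ∫ t in (0:ℝ)..b, lam * fe D (u t) * (Se D t * (t * mE D α t)) := by
  rw [← F_sub S le_rfl h0 hb]; ring

lemma u_sub {a b : ℝ} (ha : 0 ≤ a) (hab : a ≤ b) (hb : b ≤ 1) :
    u a - u b = ∫ t in a..b, w t := by
  have hs : Icc a b ⊆ Icc 0 1 := Icc_subset_Icc ha hb
  have := intervalIntegral.integral_eq_sub_of_hasDerivAt_of_le (f := fun r => - u r) (f' := w)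
    hab (S.uc.mono hs).neg
    (fun x hx => (S.ud x ⟨ha.trans_lt hx.1, hx.2.trans_le hb⟩).neg.congr_deriv (neg_neg _))
    ((S.wc.mono hs).intervalIntegrable_of_Icc hab)
  rw [this]; ring

lemma F_mono (hl : 0 ≤ lam) {a b : ℝ} (ha : 0 ≤ a) (hab : a ≤ b) (hb : b ≤ 1) :
    a * mE D α a * w a ≤ b * mE D α b * w b := by
  have := F_sub S ha hab hb
  have h2 : 0 ≤ ∫ t in a..b, lam * fe D (u t) * (Se D t * (t * mE D α t)) := by
    apply intervalIntegral.integral_nonneg hab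
    intro x hx
    exact mul_nonneg (mul_nonneg hl (fe_pos D _).le)
      (mul_nonneg (Se_nonneg D x) (mul_nonneg (ha.trans hx.1) (mE_pos D α x).le))
  linarith

lemma w_nonneg (hl : 0 ≤ lam) {r : ℝ} (h0 : 0 < r) (h1 : r ≤ 1) : 0 ≤ w r := by
  have := F_mono S hl le_rfl h0.le h1
  simp only [zero_mul] at this
  have h2 : 0 < r * mE D α r := mul_pos h0 (mE_pos D α r)
  exact nonneg_of_mul_nonneg_right this h2

lemma u_anti (hl : 0 ≤ lam) : AntitoneOn u (Icc 0 1) := by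
  intro a ha b hb hab
  have := u_sub S ha.1 hab hb.2
  have h2 : 0 ≤ ∫ t in a..b, w t := by
    rw [intervalIntegral.integral_of_le hab]
    apply setIntegral_nonneg measurableSet_Ioc
    intro x hx
    exact w_nonneg S hl (ha.1.trans_lt hx.1) (hx.2.trans hb.2)
  linarith

lemma u_nonneg {r : ℝ} (hr : r ∈ Icc (0:ℝ) 1) : 0 ≤ u r := by
  rcases hr.2.eq_or_lt with h | h
  · rw [h, S.u1]
  · exact (S.up r ⟨hr.1, h⟩).le

end

lemma no_zero {α : ℝ} {u : ℝ → ℝ} (h : IsSolution D α 0 u) : False := by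
  have S := sol_of h
  set w := fun r => -derivWithin u (Icc 0 1) r
  have h0 : ∀ r ∈ Ioc (0:ℝ) 1, w r = 0 := by
    intro r hr
    have := F_eq S hr.1.le hr.2
    simp only [zero_mul, intervalIntegral.integral_zero] at this
    have h2 : 0 < r * mE D α r := mul_pos hr.1 (mE_pos D α r)
    exact (mul_eq_zero.1 this).resolve_left h2.ne'
  have h1 := u_sub S le_rfl zero_le_one le_rfl
  rw [intervalIntegral.integral_of_le zero_le_one, setIntegral_congr_fun measurableSet_Ioc h0,
    S.u1] at h1
  simp only [integral_zero] at h1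
  have := S.up 0 (by simp)
  linarith

lemma stab {α lam : ℝ} {u w : ℝ → ℝ} (S : Sol D α lam u w) (hst : IsSemistable D α lam u)
    {η k : ℝ → ℝ} (hη : ContinuousOn η (Icc 0 1)) (hk : ContinuousOn k (Icc 0 1))
    (hd : ∀ r ∈ Ioo (0:ℝ) 1, HasDerivAt η (k r) r) (h1 : η 1 = 0) :
    lam * ∫ r in (0:ℝ)..1, fd D (u r) * (η r) ^ 2 * (Se D r * (r * mE D α r))
      ≤ ∫ r in (0:ℝ)..1, (k r) ^ 2 * (r * mE D α r) := by
  have hK : Continuous (fun r => k (cl r)) := hk.comp_continuous cl_cont cl_mem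
  set H : ℝ → ℝ := fun r => ∫ s in (1:ℝ)..r, k (cl s) with hH
  have hHd : ∀ r, HasDerivAt H (k (cl r)) r := fun r =>
    (hK.integral_hasStrictDerivAt 1 r).hasDerivAt
  have hHd' : deriv H = fun r => k (cl r) := funext fun r => (hHd r).deriv
  have hHη : ∀ r ∈ Icc (0:ℝ) 1, H r = η r := by
    intro r hr
    have hs : Icc r 1 ⊆ Icc 0 1 := Icc_subset_Icc hr.1 le_rfl
    have := intervalIntegral.integral_eq_sub_of_hasDerivAt_of_le (f := η) (f' := k)
      hr.2 (hη.mono hs) (fun x hx => hd x ⟨hr.1.trans_lt hx.1, hx.2⟩)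
      ((hk.mono hs).intervalIntegrable_of_Icc hr.2)
    have h2 : H r = - ∫ s in r..1, k s := by
      rw [hH]; simp only
      rw [intervalIntegral.integral_symm]
      congr 1
      apply intervalIntegral.integral_congr
      intro s hs'
      rw [uIcc_of_le hr.2] at hs'
      simp only [cl_eq (hs hs')]
    rw [h2, this, h1]; ring
  have hC : ContDiff ℝ 1 H := by
    rw [contDiff_one_iff_deriv, hHd']
    exact ⟨fun r => (hHd r).differentiableAt, hK⟩
  have key := hst H hC (by rw [hHη 1 (by simp), h1])
  rw [hHd'] at key
  rw [intervalIntegral.integral_of_le zero_le_one, intervalIntegral.integral_of_le zero_le_one,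
    integral_Ioc_eq_integral_Ioo, integral_Ioc_eq_integral_Ioo]
  have e1 : ∫ r in Ioo (0:ℝ) 1, fd D (u r) * (η r) ^ 2 * (Se D r * (r * mE D α r))
      = ∫ r in Ioo (0:ℝ) 1,
        D.psi r * derivWithin D.f (Ici 0) (u r) * (H r) ^ 2 * muW D α r * r := by
    apply setIntegral_congr_fun measurableSet_Ioo
    intro r hr
    have hr' : r ∈ Icc (0:ℝ) 1 := ⟨hr.1.le, hr.2.le⟩
    simp only
    rw [hHη r hr', muW_eq D α hr', Se_eq D hr', fd_eq D (u_nonneg S hr')]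
    ring
  have e2 : ∫ r in Ioo (0:ℝ) 1, (k r) ^ 2 * (r * mE D α r)
      = ∫ r in Ioo (0:ℝ) 1, (k (cl r)) ^ 2 * muW D α r * r := by
    apply setIntegral_congr_fun measurableSet_Ioo
    intro r hr
    have hr' : r ∈ Icc (0:ℝ) 1 := ⟨hr.1.le, hr.2.le⟩
    simp only
    rw [cl_eq hr', muW_eq D α hr']
    ring
  rw [e1, e2]
  exact key
end Pbsec

section Pcsec
variable (D : GelfandData)
def Jg (α : ℝ) (g : ℝ → ℝ) (s : ℝ) : ℝ := ∫ t in (0:ℝ)..s, g t * (t * mE D α t)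
def Ng (α : ℝ) (g : ℝ → ℝ) (s : ℝ) : ℝ := Jg D α g s / (s * mE D α s)

variable {D}

lemma gm_cont (α : ℝ) {g : ℝ → ℝ} (hg : Continuous g) :
    Continuous (fun t => g t * (t * mE D α t)) := hg.mul (continuous_id.mul (mE_cont D α))

lemma Jg_deriv (α : ℝ) {g : ℝ → ℝ} (hg : Continuous g) (s : ℝ) :
    HasDerivAt (Jg D α g) (g s * (s * mE D α s)) s :=
  ((gm_cont α hg).integral_hasStrictDerivAt 0 s).hasDerivAt

lemma Ng_cont (α : ℝ) {g : ℝ → ℝ} (hg : Continuous g) : Continuous (Ng D α g) := by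
  have h1 : Ng D α g = fun s => dslope (Jg D α g) 0 s / mE D α s := by
    funext s
    by_cases hs : s = 0
    · subst hs
      rw [dslope_same, (Jg_deriv α hg 0).deriv]; simp [Ng]
    · rw [dslope_of_ne _ hs, slope_def_field, Ng, div_div]
      simp [Jg]
  rw [h1]
  refine Continuous.div ?_ (mE_cont D α) (fun s => (mE_pos D α s).ne')
  rw [continuous_iff_continuousAt]
  intro s
  by_cases hs : s = 0
  · subst hs
    exact continuousAt_dslope_same.2 (Jg_deriv α hg 0).differentiableAt
  · exact (continuousAt_dslope_of_ne hs).2 (Jg_deriv α hg s).continuousAt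

lemma Ng_smooth (α : ℝ) {g : ℝ → ℝ} (hg : Continuous g) :
    ContDiffOn ℝ 1 (Ng D α g) (Ioo 0 1) := by
  have h1 : ContDiff ℝ 1 (Jg D α g) := by
    rw [contDiff_one_iff_deriv]
    refine ⟨fun s => (Jg_deriv α hg s).differentiableAt, ?_⟩
    rw [show deriv (Jg D α g) = _ from funext fun s => (Jg_deriv α hg s).deriv]
    exact gm_cont α hg
  have h2 : ContDiff ℝ 1 (mE D α) := by
    rw [contDiff_one_iff_deriv]
    refine ⟨fun s => (mE_deriv D α s).differentiableAt, ?_⟩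
    rw [show deriv (mE D α) = _ from funext fun s => (mE_deriv D α s).deriv]
    exact ((continuous_const.mul continuous_id).mul (Pe_cont D)).mul (mE_cont D α)
  apply h1.contDiffOn.div (contDiff_id.mul h2).contDiffOn
  intro s hs
  exact (mul_pos hs.1 (mE_pos D α s)).ne'

lemma Ng_deriv (α : ℝ) {g : ℝ → ℝ} (hg : Continuous g) {s : ℝ} (hs : 0 < s) :
    HasDerivAt (Ng D α g) (g s - (1 / s + α * s * Pe D s) * Ng D α g s) s := by
  have h0 := (mE_pos D α s)
  have := (Jg_deriv (D := D) α hg s).div ((hasDerivAt_id s).mul (mE_deriv D α s)) (mul_pos hs h0).ne'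
  refine HasDerivAt.congr_deriv (f := Ng D α g) this ?_
  simp only [id, Ng, Pi.mul_apply]
  field_simp

lemma Ng_bound {α : ℝ} (hα : 0 < α) {g : ℝ → ℝ} (hg : Continuous g) {B s : ℝ} (hs : 0 ≤ s)
    (hB : ∀ t, |g t| ≤ B * Se D t) : |Ng D α g s| ≤ B * Ng D α (Se D) s := by
  have h0 : 0 ≤ s * mE D α s := mul_nonneg hs (mE_pos D α s).le
  unfold Ng
  rw [abs_div, abs_of_nonneg h0, ← mul_div_assoc]
  apply div_le_div_of_nonneg_right _ h0
  unfold Jg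
  rw [← intervalIntegral.integral_const_mul]
  refine (intervalIntegral.abs_integral_le_integral_abs hs).trans ?_
  apply intervalIntegral.integral_mono_on hs ((gm_cont α hg).abs.intervalIntegrable _ _)
    ((continuous_const.mul (Sm_cont D α)).intervalIntegrable _ _)
  intro t ht
  have h1 : 0 ≤ t * mE D α t := mul_nonneg ht.1 (mE_pos D α t).le
  change _ ≤ B * (Se D t * (t * mE D α t))
  rw [abs_mul, abs_of_nonneg h1, ← mul_assoc B]
  exact mul_le_mul_of_nonneg_right (hB t) h1

lemma NS_nonneg {α s : ℝ} (hs : 0 ≤ s) : 0 ≤ Ng D α (Se D) s := by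
  unfold Ng
  apply div_nonneg _ (mul_nonneg hs (mE_pos D α s).le)
  rcases hs.eq_or_lt with rfl | hs
  · simp [Jg]
  · exact (IS_pos D hs).le

lemma M_int' : IntervalIntegrable D.M volume 0 1 := by
  rw [intervalIntegrable_iff_integrableOn_Ioo_of_le zero_le_one]; exact D.M_int

lemma M_pos {s : ℝ} (hs : s ∈ Ico (0:ℝ) 1) : 1 ≤ D.M s := by
  have : D.psi 0 / D.phi 0 ≤ D.M s := (D.M_def s hs).2 ⟨0, ⟨le_rfl, hs.1⟩, rfl⟩
  rwa [D.psi_zero, D.phi_zero, div_one] at this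

lemma M_mono {s t : ℝ} (hs : 0 ≤ s) (hst : s ≤ t) (ht : t < 1) : D.M s ≤ D.M t := by
  obtain ⟨x, hx, e⟩ := (D.M_def s ⟨hs, hst.trans_lt ht⟩).1
  rw [← e]
  exact (D.M_def t ⟨hs.trans hst, ht⟩).2 ⟨x, ⟨hx.1, hx.2.trans hst⟩, rfl⟩

/-- pointwise upper bound. -/
lemma NS_le {α s : ℝ} (hα : 0 < α) (hs : s ∈ Ioo (0:ℝ) 1) :
    Ng D α (Se D) s ≤ D.M s / (α * s) := by
  have h0 := mE_pos D α s
  have h1 := IS_le D hα ⟨hs.1.le, hs.2⟩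
  have h2 := M_pos (D := D) ⟨hs.1.le, hs.2⟩
  unfold Ng
  rw [div_le_div_iff₀ (mul_pos hs.1 h0) (mul_pos hα hs.1)]
  rw [le_div_iff₀ hα] at h1
  change IS D α s * _ ≤ _
  have h3 : IS D α s * α ≤ D.M s * mE D α s := by nlinarith
  nlinarith [mul_le_mul_of_nonneg_right h3 hs.1.le]

lemma NS_le2 {α s : ℝ} (hα : 0 < α) (hs : 0 < s) : Ng D α (Se D) s ≤ s := by
  have h0 := mE_pos D α s
  have h1 := IS_le2 D hα.le hs.le
  unfold Ng
  rw [div_le_iff₀ (mul_pos hs h0)]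
  change IS D α s ≤ _
  nlinarith [mul_pos hs (mul_pos hs h0)]

lemma E_bound (D : GelfandData) : ∃ C > 0, ∀ α : ℝ, 3 ≤ α →
    ∫ s in (0:ℝ)..1, Ng D α (Se D) s ≤ C * (Real.log α / α) := by
  set m := ∫ s in (0:ℝ)..1, D.M s with hm
  have hm0 : 0 ≤ m := by
    rw [hm, intervalIntegral.integral_of_le zero_le_one, integral_Ioc_eq_integral_Ioo]
    apply setIntegral_nonneg measurableSet_Ioo
    intro x hx
    linarith [M_pos (D := D) ⟨hx.1.le, hx.2⟩]
  have hM := M_pos (D := D) (s := 1 / 2) (by norm_num)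
  refine ⟨1 + D.M (1 / 2) + 2 * m, by positivity, ?_⟩
  intro α hα3
  have hα : 0 < α := by linarith
  have hl : 1 ≤ Real.log α := by
    rw [Real.le_log_iff_exp_le hα]
    linarith [Real.exp_one_lt_d9]
  set δ : ℝ := (Real.sqrt α)⁻¹ with hδ
  have hsq : 0 < Real.sqrt α := Real.sqrt_pos.2 hα
  have hδ0 : 0 < δ := by positivity
  have hδ1 : δ ≤ 1 := by
    rw [hδ]; apply inv_le_one_of_one_le₀
    rw [Real.one_le_sqrt]; linarith
  have hδ2 : δ ^ 2 = 1 / α := by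
    rw [hδ, inv_pow, Real.sq_sqrt hα.le, one_div]
  have hc := Ng_cont (D := D) α (Se_cont D)
  rw [← intervalIntegral.integral_add_adjacent_intervals (hc.intervalIntegrable 0 δ)
    (hc.intervalIntegrable δ 1)]
  have h1 : ∫ s in (0:ℝ)..δ, Ng D α (Se D) s ≤ 1 / α := by
    have : ∫ s in (0:ℝ)..δ, Ng D α (Se D) s ≤ ∫ s in (0:ℝ)..δ, s := by
      apply intervalIntegral.integral_mono_on_of_le_Ioo hδ0.le (hc.intervalIntegrable 0 δ)
        (Continuous.intervalIntegrable (by fun_prop) _ _)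
      intro x hx
      exact NS_le2 hα hx.1
    rw [integral_id] at this
    have h3 : 0 < 1 / α := by positivity
    rw [hδ2] at this
    linarith
  have h2 : ∫ s in δ..1, Ng D α (Se D) s ≤ D.M (1 / 2) / α * (Real.log α / 2) + 2 / α * m := by
    have hMi : IntervalIntegrable D.M volume δ 1 := M_int'.mono_set (by
      rw [uIcc_of_le hδ1, uIcc_of_le zero_le_one]; exact Icc_subset_Icc hδ0.le le_rfl)
    have hMi0 : IntervalIntegrable D.M volume 0 δ := M_int'.mono_set (by
      rw [uIcc_of_le hδ0.le, uIcc_of_le zero_le_one]; exact Icc_subset_Icc le_rfl hδ1)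
    have hii : IntervalIntegrable (fun s : ℝ => s⁻¹) volume δ 1 := by
      apply ContinuousOn.intervalIntegrable_of_Icc hδ1
      exact continuousOn_inv₀.mono (fun x hx => (hδ0.trans_le hx.1).ne')
    have : ∫ s in δ..1, Ng D α (Se D) s
        ≤ ∫ s in δ..1, (D.M (1 / 2) / α * s⁻¹ + 2 / α * D.M s) := by
      apply intervalIntegral.integral_mono_on_of_le_Ioo hδ1 (hc.intervalIntegrable δ 1)
        ((hii.const_mul _).add (hMi.const_mul _))
      intro x hx
      have hx0 : 0 < x := hδ0.trans hx.1
      refine (NS_le hα ⟨hx0, hx.2⟩).trans ?_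
      have hMx := M_pos (D := D) (s := x) ⟨hx0.le, hx.2⟩
      have e : D.M x / (α * x) = D.M x / α * x⁻¹ := by field_simp
      rw [e]
      rcases le_total x (1 / 2) with h | h
      · have h5 := M_mono (D := D) hx0.le h (by norm_num)
        have h6 : D.M x / α * x⁻¹ ≤ D.M (1 / 2) / α * x⁻¹ := by gcongr
        have h7 : 0 ≤ 2 / α * D.M x := by positivity
        linarith
      · have h5 : x⁻¹ ≤ 2 := by
          rw [inv_le_comm₀ hx0 two_pos]; linarith
        have h6 : D.M x / α * x⁻¹ ≤ D.M x / α * 2 := by gcongr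
        have h7 : 0 ≤ D.M (1 / 2) / α * x⁻¹ := by positivity
        have h8 : D.M x / α * 2 = 2 / α * D.M x := by ring
        linarith
    refine this.trans ?_
    rw [intervalIntegral.integral_add (hii.const_mul _) (hMi.const_mul _),
      intervalIntegral.integral_const_mul, intervalIntegral.integral_const_mul,
      integral_inv_of_pos hδ0 one_pos]
    have h4 : Real.log (1 / δ) = Real.log α / 2 := by
      rw [hδ, one_div, inv_inv, Real.log_sqrt hα.le]
    have h5 : ∫ s in δ..1, D.M s ≤ m := by
      rw [hm, ← intervalIntegral.integral_add_adjacent_intervals hMi0 hMi]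
      have : 0 ≤ ∫ s in (0:ℝ)..δ, D.M s := by
        rw [intervalIntegral.integral_of_le hδ0.le, integral_Ioc_eq_integral_Ioo]
        apply setIntegral_nonneg measurableSet_Ioo
        intro x hx
        linarith [M_pos (D := D) ⟨hx.1.le, hx.2.trans_le hδ1⟩]
      linarith
    rw [h4]
    gcongr
  have h6 : 1 / α + (D.M (1 / 2) / α * (Real.log α / 2) + 2 / α * m)
      = (1 + D.M (1 / 2) * (Real.log α / 2) + 2 * m) / α := by field_simp; ring
  have h7 : (1 + D.M (1 / 2) + 2 * m) * (Real.log α / α)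
      = ((1 + D.M (1 / 2) + 2 * m) * Real.log α) / α := by ring
  have h8 : (1 + D.M (1 / 2) * (Real.log α / 2) + 2 * m) / α ≤
      ((1 + D.M (1 / 2) + 2 * m) * Real.log α) / α := by
    apply div_le_div_of_nonneg_right _ hα.le
    nlinarith
  linarith
end Pcsec

section Pddsec
variable (D : GelfandData)
variable {D}

def Ug (D : GelfandData) (α lam : ℝ) (g : ℝ → ℝ) (r : ℝ) : ℝ := lam * ∫ s in r..1, Ng D α g s

lemma Ug_deriv (α lam : ℝ) {g : ℝ → ℝ} (hg : Continuous g) (r : ℝ) :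
    HasDerivAt (Ug D α lam g) (-(lam * Ng D α g r)) r := by
  have hc := Ng_cont (D := D) α hg
  have h := ((hc.integral_hasStrictDerivAt 1 r).hasDerivAt.const_mul (-lam))
  have e : Ug D α lam g = fun r => -lam * ∫ s in (1:ℝ)..r, Ng D α g s := by
    funext r; unfold Ug; rw [intervalIntegral.integral_symm]; ring
  rw [e]
  exact h.congr_deriv (by ring)

lemma Ug_sol {α lam : ℝ} (hα : 0 < α) (hl : 0 < lam) {v : ℝ → ℝ} (hv : Continuous v)
    (hfix : ∀ r ∈ Icc (0:ℝ) 1, Ug D α lam (fun t => Se D t * fe D (v t)) r = v r) :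
    IsSolution D α lam (Ug D α lam (fun t => Se D t * fe D (v t))) := by
  set g : ℝ → ℝ := fun t => Se D t * fe D (v t) with hgdef
  have hg : Continuous g := (Se_cont D).mul ((fe_cont D).comp hv)
  have hd := Ug_deriv (D := D) α lam hg
  have hN := Ng_cont (D := D) α hg
  have hdw : ∀ r ∈ Icc (0:ℝ) 1, derivWithin (Ug D α lam g) (Icc 0 1) r = -(lam * Ng D α g r) :=
    fun r hr => (hd r).hasDerivWithinAt.derivWithin (uniqueDiffOn_Icc zero_lt_one r hr)
  have hNpos : ∀ s, 0 < s → 0 < Ng D α g s := by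
    intro s hs
    apply div_pos _ (mul_pos hs (mE_pos D α s))
    have h1 : fe D 0 * IS D α s ≤ Jg D α g s := by
      unfold IS Jg
      rw [← intervalIntegral.integral_const_mul]
      apply intervalIntegral.integral_mono_on hs.le
        ((continuous_const.mul (Sm_cont D α)).intervalIntegrable _ _)
        ((gm_cont α hg).intervalIntegrable _ _)
      intro t ht
      have h1 : 0 ≤ Se D t * (t * mE D α t) :=
        mul_nonneg (Se_nonneg D t) (mul_nonneg ht.1 (mE_pos D α t).le)
      have h2 : fe D 0 ≤ fe D (v t) := by
        unfold fe; exact D.f_mono (mx0 _) (mx0 _) (by simp)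
      change fe D 0 * (Se D t * (t * mE D α t)) ≤ Se D t * fe D (v t) * (t * mE D α t)
      have h3 : Se D t * fe D (v t) * (t * mE D α t) = fe D (v t) * (Se D t * (t * mE D α t)) := by
        ring
      rw [h3]
      exact mul_le_mul_of_nonneg_right h2 h1
    exact (mul_pos (fe_pos D 0) (IS_pos D hs)).trans_le h1
  have hC1 : ContDiff ℝ 1 (Ug D α lam g) := by
    rw [contDiff_one_iff_deriv]
    refine ⟨fun s => (hd s).differentiableAt, ?_⟩
    rw [show deriv (Ug D α lam g) = _ from funext fun s => (hd s).deriv]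
    exact (continuous_const.mul hN).neg
  have hpos : ∀ r ∈ Ico (0:ℝ) 1, 0 < Ug D α lam g r := by
    intro r hr
    refine mul_pos hl ?_
    apply intervalIntegral.integral_pos hr.2 hN.continuousOn
    · intro x hx; exact (hNpos x (hr.1.trans_lt hx.1)).le
    · exact ⟨1, ⟨hr.2.le, le_rfl⟩, hNpos 1 one_pos⟩
  refine ⟨hC1.contDiffOn, ?_, hpos, ?_, by simp [Ug], ?_⟩
  · rw [show (2 : WithTop ℕ∞) = 1 + 1 by norm_num, contDiffOn_succ_iff_deriv_of_isOpen isOpen_Ioo]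
    refine ⟨fun s _ => (hd s).differentiableAt.differentiableWithinAt, by simp, ?_⟩
    rw [show deriv (Ug D α lam g) = _ from funext fun s => (hd s).deriv]
    exact (contDiffOn_const.mul (Ng_smooth α hg)).neg
  · rw [hdw 0 (by simp)]; simp [Ng]
  · intro r hr
    have hr' : r ∈ Icc (0:ℝ) 1 := ⟨hr.1.le, hr.2.le⟩
    have h1 : derivWithin (derivWithin (Ug D α lam g) (Icc 0 1)) (Ioo 0 1) r
        = -(lam * (g r - (1 / r + α * r * Pe D r) * Ng D α g r)) := by
      rw [derivWithin_congr (f := fun r => -(lam * Ng D α g r))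
        (fun x hx => hdw x ⟨hx.1.le, hx.2.le⟩) (hdw r hr')]
      exact ((Ng_deriv α hg hr.1).const_mul lam).neg.hasDerivWithinAt.derivWithin
        (uniqueDiffOn_Ioo 0 1 r hr)
    rw [h1, hdw r hr', hfix r hr', Pe_eq D hr', hgdef]
    simp only
    rw [Se_eq D hr', fe_eq D (by rw [← hfix r hr']; exact (hpos r ⟨hr.1.le, hr.2⟩).le)]
    ring

lemma fcl_lip (D : GelfandData) : ∃ L > 0, ∀ a b : ℝ, |D.f (cl a) - D.f (cl b)| ≤ L * |a - b| := by
  refine ⟨fd D 1 + 1, by linarith [fd_nonneg D 1], ?_⟩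
  have hcl : ∀ a b : ℝ, a ≤ b → cl b - cl a ≤ b - a := by
    intro a b hab
    unfold cl
    rcases le_total a 0 with h1 | h1 <;> rcases le_total b 0 with h2 | h2 <;>
    rcases le_total 1 a with h3 | h3 <;> rcases le_total 1 b with h4 | h4 <;>
    simp [*] <;> grind
  have key : ∀ a b : ℝ, a ≤ b → |D.f (cl a) - D.f (cl b)| ≤ (fd D 1 + 1) * |a - b| := by
    intro a b hab
    have h0 := cl_mono hab
    have h1 := hcl a b hab
    have ha := cl_mem a
    have hb := cl_mem b
    rw [abs_sub_comm, abs_sub_comm a b, abs_of_nonneg (sub_nonneg.2 hab),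
      abs_of_nonneg (sub_nonneg.2 (D.f_mono ha.1 hb.1 h0)), ← fe_eq D ha.1, ← fe_eq D hb.1]
    have h3 : fe D (cl b) - fe D (cl a) ≤ fd D 1 * (cl b - cl a) := by
      rcases h0.eq_or_lt with h | h
      · rw [h]; simp
      obtain ⟨c, hc, hc'⟩ := exists_hasDerivAt_eq_slope (fe D) (fd D) h (fe_cont D).continuousOn
        (fun x hx => f_hasDeriv D (ha.1.trans_lt hx.1))
      have h4 := fd_mono D (hc.2.le.trans hb.2)
      rw [hc', div_le_iff₀ (sub_pos.2 h)] at h4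
      exact h4
    have h5 := fd_nonneg D 1
    nlinarith [sub_nonneg.2 hab]
  intro a b
  rcases le_total a b with h | h
  · exact key a b h
  · rw [abs_sub_comm, abs_sub_comm a b]; exact key b a h

lemma exist_sol {α lam L : ℝ} (hα : 0 < α) (hl : 0 < lam)
    (hL : ∀ a b : ℝ, |D.f (cl a) - D.f (cl b)| ≤ L * |a - b|)
    (h1 : lam * (D.f 1 * ∫ s in (0:ℝ)..1, Ng D α (Se D) s) ≤ 1)
    (h2 : lam * (L * ∫ s in (0:ℝ)..1, Ng D α (Se D) s) ≤ 1 / 2) (hL0 : 0 < L) :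
    ∃ u, IsSolution D α lam u := by
  have hS := Ng_cont (D := D) α (Se_cont D)
  have hfc : Continuous (fun t => D.f (cl t)) :=
    D.f_smooth.continuousOn.comp_continuous cl_cont (fun t => (cl_mem t).1)
  -- tail integral
  have htail : ∀ r ∈ Icc (0:ℝ) 1, ∫ s in r..1, Ng D α (Se D) s
      ≤ ∫ s in (0:ℝ)..1, Ng D α (Se D) s := by
    intro r hr
    rw [← intervalIntegral.integral_add_adjacent_intervals (hS.intervalIntegrable 0 r)
      (hS.intervalIntegrable r 1)]
    have : 0 ≤ ∫ s in (0:ℝ)..r, Ng D α (Se D) s :=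
      intervalIntegral.integral_nonneg hr.1 (fun x hx => NS_nonneg hx.1)
    linarith
  have hbd : ∀ (g : ℝ → ℝ), Continuous g → ∀ B : ℝ, 0 ≤ B → (∀ t, |g t| ≤ B * Se D t) →
      ∀ r ∈ Icc (0:ℝ) 1, |Ug D α lam g r| ≤ lam * (B * ∫ s in (0:ℝ)..1, Ng D α (Se D) s) := by
    intro g hg B hB0 hB r hr
    unfold Ug
    rw [abs_mul, abs_of_pos hl]
    apply mul_le_mul_of_nonneg_left _ hl.le
    refine (intervalIntegral.abs_integral_le_integral_abs hr.2).trans ?_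
    refine le_trans ?_ (mul_le_mul_of_nonneg_left (htail r hr) hB0)
    rw [← intervalIntegral.integral_const_mul]
    apply intervalIntegral.integral_mono_on hr.2 ((Ng_cont α hg).abs.intervalIntegrable _ _)
      ((continuous_const.mul hS).intervalIntegrable _ _)
    intro t ht
    exact Ng_bound hα hg (hr.1.trans ht.1) hB
  let X := C(Icc (0:ℝ) 1, ℝ)
  let ex : X → ℝ → ℝ := fun v t => v ⟨cl t, cl_mem t⟩
  have hex : ∀ v : X, Continuous (ex v) := fun v =>
    v.continuous.comp (cl_cont.subtype_mk _)
  let g : X → ℝ → ℝ := fun v t => Se D t * D.f (cl (ex v t))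
  have hg : ∀ v, Continuous (g v) := fun v => (Se_cont D).mul (hfc.comp (hex v))
  have hUc : ∀ v, Continuous (Ug D α lam (g v)) := fun v =>
    continuous_iff_continuousAt.2 fun r => (Ug_deriv α lam (hg v) r).continuousAt
  let T : X → X := fun v => ⟨fun r => Ug D α lam (g v) r, (hUc v).comp continuous_subtype_val⟩
  have hlin : ∀ v1 v2 r, Ug D α lam (g v1) r - Ug D α lam (g v2) r
      = Ug D α lam (fun t => g v1 t - g v2 t) r := by
    intro v1 v2 r
    unfold Ug
    rw [← mul_sub, ← intervalIntegral.integral_sub ((Ng_cont α (hg v1)).intervalIntegrable _ _)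
      ((Ng_cont α (hg v2)).intervalIntegrable _ _)]
    congr 1
    apply intervalIntegral.integral_congr
    intro s _
    simp only [Ng, Jg]
    rw [← sub_div, ← intervalIntegral.integral_sub ((gm_cont α (hg v1)).intervalIntegrable _ _)
      ((gm_cont α (hg v2)).intervalIntegrable _ _)]
    congr 1
    apply intervalIntegral.integral_congr
    intro t _
    simp only
    ring
  have hT : ContractingWith (1 / 2) T := by
    refine ⟨by rw [div_lt_one] <;> norm_num, ?_⟩
    apply LipschitzWith.of_dist_le_mul
    intro v1 v2
    rw [ContinuousMap.dist_le (by positivity)]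
    intro r
    rw [Real.dist_eq]
    change |Ug D α lam (g v1) r - Ug D α lam (g v2) r| ≤ _
    rw [hlin]
    refine (hbd _ ((hg v1).sub (hg v2)) (L * dist v1 v2) (by positivity) ?_ r r.2).trans ?_
    · intro t
      change |Se D t * D.f (cl (ex v1 t)) - Se D t * D.f (cl (ex v2 t))| ≤ _
      rw [← mul_sub, abs_mul, abs_of_nonneg (Se_nonneg D t), mul_comm]
      apply mul_le_mul_of_nonneg_right _ (Se_nonneg D t)
      refine (hL _ _).trans ?_
      apply mul_le_mul_of_nonneg_left _ hL0.le
      rw [← Real.dist_eq]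
      exact ContinuousMap.dist_apply_le_dist _
    · have : 0 ≤ dist v1 v2 := dist_nonneg
      push_cast
      nlinarith
  let v := ContractingWith.fixedPoint T hT
  have hv : T v = v := hT.fixedPoint_isFixedPt
  have hvr : ∀ r ∈ Icc (0:ℝ) 1, Ug D α lam (g v) r = ex v r := by
    intro r hr
    have : (T v) ⟨r, hr⟩ = v ⟨r, hr⟩ := by rw [hv]
    simp only [ex, cl_eq hr]
    exact this
  have hv0 : ∀ r ∈ Icc (0:ℝ) 1, 0 ≤ ex v r := by
    intro r hr
    rw [← hvr r hr]
    refine mul_nonneg hl.le (intervalIntegral.integral_nonneg hr.2 ?_)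
    intro s hs
    have hs0 := hr.1.trans hs.1
    refine div_nonneg (intervalIntegral.integral_nonneg hs0 ?_) (mul_nonneg hs0 (mE_pos D α s).le)
    intro t ht
    exact mul_nonneg (mul_nonneg (Se_nonneg D t) (D.f_pos _ (cl_mem _).1).le)
      (mul_nonneg ht.1 (mE_pos D α t).le)
  have hv1 : ∀ r ∈ Icc (0:ℝ) 1, ex v r ≤ 1 := by
    intro r hr
    rw [← hvr r hr]
    refine (le_abs_self _).trans ((hbd _ (hg v) (D.f 1) (D.f_pos 1 zero_le_one).le ?_ r hr).trans h1)
    intro t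
    have h3 := D.f_mono (cl_mem (ex v t)).1 (mem_Ici.2 zero_le_one) (cl_mem (ex v t)).2
    simp only [g]
    rw [abs_mul, abs_of_nonneg (Se_nonneg D t), abs_of_pos (D.f_pos _ (cl_mem _).1), mul_comm]
    exact mul_le_mul_of_nonneg_right h3 (Se_nonneg D t)
  have hge : g v = fun t => Se D t * fe D (ex v t) := by
    funext t
    have hm : ex v t = ex v (cl t) := by simp only [ex, cl_eq (cl_mem t)]
    have h3 : ex v t ∈ Icc (0:ℝ) 1 := by
      rw [hm]; exact ⟨hv0 _ (cl_mem t), hv1 _ (cl_mem t)⟩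
    simp only [g]
    rw [cl_eq h3, fe_eq D h3.1]
  refine ⟨_, Ug_sol hα hl (hex v) ?_⟩
  rw [← hge]
  exact hvr

/-- Lower bound on `λ*`. -/
lemma lam_lower (D : GelfandData) : ∃ κ > 0, ∀ α : ℝ, 3 ≤ α → ∀ u,
    IsSolution D α (lamStar D α) u → κ * α / Real.log α ≤ lamStar D α := by
  obtain ⟨C, hC, hE⟩ := E_bound D
  obtain ⟨L, hL0, hL⟩ := fcl_lip D
  have hf1 := D.f_pos 1 zero_le_one
  set B := D.f 1 + 2 * L with hB
  have hB0 : 0 < B := by positivity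
  refine ⟨1 / (C * B), by positivity, ?_⟩
  intro α hα3 u hu
  have hα : 0 < α := by linarith
  have hlog : 0 < Real.log α := Real.log_pos (by linarith)
  set lam := 1 / (C * B) * α / Real.log α with hlam
  have hl : 0 < lam := by positivity
  have hb : BddAbove (solvableSet D α) := by
    by_contra h
    have : lamStar D α = 0 := Real.sSup_of_not_bddAbove h
    rw [this] at hu
    exact no_zero hu
  apply le_csSup hb
  have hE1 := hE α hα3
  set E := ∫ s in (0:ℝ)..1, Ng D α (Se D) s
  have hlE : lam * E ≤ 1 / B := by
    calc lam * E ≤ lam * (C * (Real.log α / α)) := by gcongr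
      _ = 1 / B := by rw [hlam]; field_simp
  refine ⟨hl, exist_sol hα hl hL ?_ ?_ hL0⟩
  · have : D.f 1 * (lam * E) ≤ D.f 1 * (1 / B) := by gcongr
    have h3 : D.f 1 * (1 / B) ≤ 1 := by
      rw [mul_one_div, div_le_one hB0]; linarith
    linarith
  · have : L * (lam * E) ≤ L * (1 / B) := by gcongr
    have h3 : L * (1 / B) ≤ 1 / 2 := by
      rw [mul_one_div, div_le_div_iff₀ hB0 two_pos]; linarith
    linarith
end Pddsec

section Pesec
variable (D : GelfandData)
variable {D}

lemma maxsq_deriv (x : ℝ) : HasDerivAt (fun x : ℝ => (max 0 x) ^ 2) (2 * max 0 x) x := by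
  rcases lt_trichotomy x 0 with h | h | h
  · rw [max_eq_left h.le, mul_zero]
    refine (hasDerivAt_const x (0:ℝ)).congr_of_eventuallyEq ?_
    filter_upwards [Iio_mem_nhds h] with y hy
    rw [max_eq_left (le_of_lt hy)]; norm_num
  · subst h
    rw [hasDerivAt_iff_tendsto_slope]
    have hc : Tendsto (fun y : ℝ => max 0 y) (nhdsWithin 0 {0}ᶜ) (nhds (2 * max 0 0)) := by
      have : Continuous (fun y : ℝ => max 0 y) := by fun_prop
      have := this.tendsto 0
      simp only [max_self, mul_zero] at this ⊢
      exact this.mono_left nhdsWithin_le_nhds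
    refine hc.congr' ?_
    filter_upwards [self_mem_nhdsWithin] with y hy
    have hy0 : y ≠ 0 := hy
    rw [slope_def_field]
    rcases le_total y 0 with h | h
    · simp [max_eq_left h]
    · simp only [max_eq_right h, max_self]
      field_simp
      ring
  · rw [max_eq_right h.le]
    have := hasDerivAt_pow 2 x
    refine (this.congr_deriv (by norm_num)).congr_of_eventuallyEq ?_
    filter_upwards [Ioi_mem_nhds h] with y hy
    rw [max_eq_right (le_of_lt hy)]

section
variable {α lam : ℝ} {u w : ℝ → ℝ}

lemma fdS_c (S : Sol D α lam u w) : ContinuousOn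
    (fun r => fd D (u r) * (Se D r * (r * mE D α r))) (Icc 0 1) :=
  ((fd_cont D).comp_continuousOn S.uc).mul (Sm_cont D α).continuousOn

lemma S_nonneg {r : ℝ} (hr : 0 ≤ r) : 0 ≤ Se D r * (r * mE D α r) :=
  mul_nonneg (Se_nonneg D r) (mul_nonneg hr (mE_pos D α r).le)

lemma stabR (S : Sol D α lam u w) (hst : IsSemistable D α lam u) (hα : 0 < α) (hl : 0 < lam)
    {R : ℝ} (hR : 0 < R) (hR1 : R ≤ 1) (hRα : α * R ^ 2 ≤ 4) :
    lam * ∫ r in (0:ℝ)..(R / 2), fd D (u r) * (Se D r * (r * mE D α r)) ≤ 64 * Real.exp 2 := by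
  set η : ℝ → ℝ := fun r => (max 0 (1 - r ^ 2 / R ^ 2)) ^ 2 with hη
  set k : ℝ → ℝ := fun r => 2 * max 0 (1 - r ^ 2 / R ^ 2) * (-(2 * r / R ^ 2)) with hk
  have hηc : Continuous η := by rw [hη]; fun_prop
  have hkc : Continuous k := by rw [hk]; fun_prop
  have hd : ∀ r, HasDerivAt η (k r) r := by
    intro r
    have h1 : HasDerivAt (fun r : ℝ => 1 - r ^ 2 / R ^ 2) (-(2 * r / R ^ 2)) r := by
      have := ((hasDerivAt_pow 2 r).div_const (R ^ 2)).const_sub 1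
      exact this.congr_deriv (by norm_num)
    exact (maxsq_deriv (1 - r ^ 2 / R ^ 2)).comp r h1
  have hη1 : η 1 = 0 := by
    have : 1 - (1:ℝ) ^ 2 / R ^ 2 ≤ 0 := by
      rw [one_pow, sub_nonpos, le_div_iff₀ (by positivity)]; nlinarith
    simp only [hη, max_eq_left this]; norm_num
  have key := stab S hst hηc.continuousOn hkc.continuousOn (fun r _ => hd r) hη1
  have hkm : Continuous (fun r => k r ^ 2 * (r * mE D α r)) := gm_cont α (hkc.pow 2)
  have hup : ∫ r in (0:ℝ)..1, k r ^ 2 * (r * mE D α r) ≤ 16 * Real.exp 2 := by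
    rw [← intervalIntegral.integral_add_adjacent_intervals (hkm.intervalIntegrable 0 R)
      (hkm.intervalIntegrable R 1)]
    have h2 : ∫ r in R..1, k r ^ 2 * (r * mE D α r) = 0 := by
      rw [intervalIntegral.integral_congr (g := fun _ => 0), intervalIntegral.integral_zero]
      intro r hr
      rw [uIcc_of_le hR1] at hr
      have : 1 - r ^ 2 / R ^ 2 ≤ 0 := by
        rw [sub_nonpos, le_div_iff₀ (by positivity)]; nlinarith [hr.1]
      simp only [hk, max_eq_left this]; ring
    have h1 : ∫ r in (0:ℝ)..R, k r ^ 2 * (r * mE D α r)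
        ≤ ∫ r in (0:ℝ)..R, 16 * Real.exp 2 / R := by
      apply intervalIntegral.integral_mono_on hR.le (hkm.intervalIntegrable 0 R)
        (continuous_const.intervalIntegrable _ _)
      intro r hr
      have hm : mE D α r ≤ Real.exp 2 := by
        refine (mE_le D hα.le hr.1).trans (Real.exp_le_exp.2 ?_)
        have : α * r ^ 2 ≤ α * R ^ 2 :=
          mul_le_mul_of_nonneg_left (pow_le_pow_left₀ hr.1 hr.2 2) hα.le
        linarith
      have hx1 : max 0 (1 - r ^ 2 / R ^ 2) ≤ 1 := by
        apply max_le zero_le_one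
        have : 0 ≤ r ^ 2 / R ^ 2 := by positivity
        linarith
      have hx0 : 0 ≤ max 0 (1 - r ^ 2 / R ^ 2) := le_max_left _ _
      have e1 : k r ^ 2 * r ≤ 16 / R := by
        have : k r ^ 2 * r = (max 0 (1 - r ^ 2 / R ^ 2)) ^ 2 * (16 * (r ^ 3 / R ^ 4)) := by
          simp only [hk]; field_simp; ring
        rw [this]
        have h5 : r ^ 3 / R ^ 4 ≤ 1 / R := by
          rw [div_le_div_iff₀ (by positivity) hR]
          have := pow_le_pow_left₀ hr.1 hr.2 3
          nlinarith
        have h6 : (max 0 (1 - r ^ 2 / R ^ 2)) ^ 2 ≤ 1 := pow_le_one₀ hx0 hx1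
        have h7 : 0 ≤ 16 * (r ^ 3 / R ^ 4) := by have := hr.1; positivity
        calc _ ≤ 1 * (16 * (r ^ 3 / R ^ 4)) := mul_le_mul_of_nonneg_right h6 h7
          _ ≤ 16 / R := by rw [one_mul, show 16 / R = 16 * (1 / R) by ring]; linarith
      have h8 : 0 ≤ 16 / R := by positivity
      calc k r ^ 2 * (r * mE D α r) = (k r ^ 2 * r) * mE D α r := by ring
        _ ≤ 16 / R * Real.exp 2 := mul_le_mul e1 hm (mE_pos D α r).le h8
        _ = _ := by ring
    rw [intervalIntegral.integral_const] at h1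
    rw [h2, add_zero]
    refine h1.trans (le_of_eq ?_)
    simp only [smul_eq_mul]; field_simp; ring
  have hηS : ContinuousOn (fun r => fd D (u r) * (η r) ^ 2 * (Se D r * (r * mE D α r)))
      (Icc 0 1) := (((fd_cont D).comp_continuousOn S.uc).mul (hηc.pow 2).continuousOn).mul
        (Sm_cont D α).continuousOn
  have hR2 : R / 2 ≤ 1 := by linarith
  have hR20 : 0 ≤ R / 2 := by linarith
  have i1 : IntervalIntegrable (fun r => fd D (u r) * (η r) ^ 2 * (Se D r * (r * mE D α r)))
      volume 0 (R / 2) :=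
    (hηS.mono (Icc_subset_Icc le_rfl hR2)).intervalIntegrable_of_Icc hR20
  have i2 : IntervalIntegrable (fun r => fd D (u r) * (η r) ^ 2 * (Se D r * (r * mE D α r)))
      volume (R / 2) 1 :=
    (hηS.mono (Icc_subset_Icc hR20 le_rfl)).intervalIntegrable_of_Icc hR2
  have hlo : (1 / 4) * ∫ r in (0:ℝ)..(R / 2), fd D (u r) * (Se D r * (r * mE D α r))
      ≤ ∫ r in (0:ℝ)..1, fd D (u r) * (η r) ^ 2 * (Se D r * (r * mE D α r)) := by
    rw [← intervalIntegral.integral_add_adjacent_intervals i1 i2,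
      ← intervalIntegral.integral_const_mul]
    have h3 : 0 ≤ ∫ r in (R / 2)..1, fd D (u r) * (η r) ^ 2 * (Se D r * (r * mE D α r)) := by
      apply intervalIntegral.integral_nonneg hR2
      intro r hr
      exact mul_nonneg (mul_nonneg (fd_nonneg D _) (sq_nonneg _)) (S_nonneg (hR20.trans hr.1))
    refine le_trans ?_ (le_add_of_nonneg_right h3)
    refine intervalIntegral.integral_mono_on hR20 ?_ i1 ?_
    · exact (((fdS_c S).mono (Icc_subset_Icc le_rfl hR2)).intervalIntegrable_of_Icc hR20).const_mul _
    intro r hr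
    have h4 : (3:ℝ) / 4 ≤ 1 - r ^ 2 / R ^ 2 := by
      have : r ^ 2 / R ^ 2 ≤ 1 / 4 := by
        rw [div_le_iff₀ (by positivity)]
        have := pow_le_pow_left₀ hr.1 hr.2 2
        linarith
      linarith
    have h5 : (1:ℝ) / 4 ≤ η r ^ 2 := by
      have h6 : (3:ℝ) / 4 ≤ max 0 (1 - r ^ 2 / R ^ 2) := h4.trans (le_max_right _ _)
      have h7 : ((3:ℝ) / 4) ^ 2 ≤ η r := pow_le_pow_left₀ (by norm_num) h6 2
      have h8 := pow_le_pow_left₀ (by norm_num) h7 2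
      linarith
    have h9 : 0 ≤ fd D (u r) * (Se D r * (r * mE D α r)) :=
      mul_nonneg (fd_nonneg D _) (S_nonneg hr.1)
    have e : fd D (u r) * (η r) ^ 2 * (Se D r * (r * mE D α r))
      = η r ^ 2 * (fd D (u r) * (Se D r * (r * mE D α r))) := by ring
    rw [e]
    exact mul_le_mul_of_nonneg_right h5 h9
  have := mul_le_mul_of_nonneg_left hlo hl.le
  linarith

end

/-! Nedev-type functions -/
def qf (D : GelfandData) (A s : ℝ) : ℝ := (1 - (fe D A) ^ 2 / (max (fe D s) (fe D A)) ^ 2) * fd D s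
def Qf (D : GelfandData) (A t : ℝ) : ℝ := ∫ s in A..t, qf D A s
def Gf (D : GelfandData) (A t : ℝ) : ℝ := ∫ s in A..t, (qf D A s) ^ 2

lemma qf_cont (A : ℝ) : Continuous (qf D A) := by
  have h1 := fe_cont D
  have h2 := fd_cont D
  have h3 : ∀ s, (max (fe D s) (fe D A)) ^ 2 ≠ 0 := fun s =>
    (pow_pos ((fe_pos D s).trans_le (le_max_left _ _)) 2).ne'
  unfold qf
  exact (continuous_const.sub (continuous_const.div ((h1.max continuous_const).pow 2) h3)).mul h2

lemma qf_zero {A s : ℝ} (h : s ≤ A) : qf D A s = 0 := by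
  unfold qf
  rw [max_eq_right (fe_mono D h), div_self (pow_pos (fe_pos D A) 2).ne']; ring

lemma qf_nonneg (A s : ℝ) : 0 ≤ qf D A s := by
  apply mul_nonneg _ (fd_nonneg D s)
  have h0 := fe_pos D A
  have h1 : fe D A ≤ max (fe D s) (fe D A) := le_max_right _ _
  rw [sub_nonneg, div_le_one (by positivity)]
  exact pow_le_pow_left₀ h0.le h1 2

lemma qf_le (A s : ℝ) : qf D A s ≤ fd D s := by
  unfold qf
  have : 0 ≤ (fe D A) ^ 2 / (max (fe D s) (fe D A)) ^ 2 := by positivity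
  nlinarith [fd_nonneg D s]

lemma Qf_zero {A t : ℝ} (h : t ≤ A) : Qf D A t = 0 := by
  unfold Qf
  rw [intervalIntegral.integral_congr (g := fun _ => 0), intervalIntegral.integral_zero]
  intro s hs
  rw [uIcc_of_ge h] at hs
  exact qf_zero hs.2

lemma Gf_zero {A t : ℝ} (h : t ≤ A) : Gf D A t = 0 := by
  unfold Gf
  rw [intervalIntegral.integral_congr (g := fun _ => 0), intervalIntegral.integral_zero]
  intro s hs
  rw [uIcc_of_ge h] at hs
  simp only [qf_zero hs.2]; norm_num

lemma Qf_deriv (A t : ℝ) : HasDerivAt (Qf D A) (qf D A t) t :=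
  ((qf_cont A).integral_hasStrictDerivAt A t).hasDerivAt
lemma Gf_deriv (A t : ℝ) : HasDerivAt (Gf D A) ((qf D A t) ^ 2) t :=
  (((qf_cont A).pow 2).integral_hasStrictDerivAt A t).hasDerivAt

lemma Qf_ge {A t : ℝ} (hA : 0 < A) (h : A ≤ t) : fe D t ≤ Qf D A t + 2 * fe D A := by
  have hQ : Qf D A t = (fe D t + fe D A ^ 2 / fe D t) - (fe D A + fe D A ^ 2 / fe D A) := by
    unfold Qf
    refine intervalIntegral.integral_eq_sub_of_hasDerivAt
      (f := fun s => fe D s + fe D A ^ 2 / fe D s) ?_ ((qf_cont A).intervalIntegrable _ _)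
    intro s hs
    rw [uIcc_of_le h] at hs
    have hfs := fe_pos D s
    have h1 := f_hasDeriv D (hA.trans_le hs.1)
    refine (h1.add ((hasDerivAt_const s (fe D A ^ 2)).div h1 hfs.ne')).congr_deriv ?_
    unfold qf
    rw [max_eq_left (fe_mono D hs.1)]
    field_simp
    ring
  have h0 := fe_pos D A
  have h1 := fe_pos D t
  have h2 : fe D A ^ 2 / fe D A = fe D A := by field_simp
  have h3 : 0 ≤ fe D A ^ 2 / fe D t := by positivity
  rw [hQ, h2]; linarith

lemma Gf_le {c0 c1 t0 A t : ℝ} (hc0 : c0 ∈ Ioo (0:ℝ) 1) (hc1 : 1 < c1)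
    (hf : ∀ t1 t2, t0 < t1 → t1 < t2 → c1 * fe D t1 ≤ fe D t2 →
      fd D t1 ≤ (1 - c0) * fd D t2) (hA0 : 0 < A) (hA : t0 ≤ A) (h : A ≤ t) :
    Gf D A t ≤ (1 - c0 / c1) * (fd D t * fe D t) := by
  have hq2 : Continuous (fun s => qf D A s ^ 2) := (qf_cont A).pow 2
  have hfi : ∀ x y : ℝ, 0 < x → x ≤ y → ∫ s in x..y, fd D s = fe D y - fe D x := by
    intro x y hx hxy
    refine intervalIntegral.integral_eq_sub_of_hasDerivAt ?_ ((fd_cont D).intervalIntegrable _ _)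
    intro s hs
    rw [uIcc_of_le hxy] at hs
    exact f_hasDeriv D (hx.trans_le hs.1)
  have hgen : ∀ x y B : ℝ, 0 < x → x ≤ y → (∀ s ∈ Ioo x y, fd D s ≤ B) →
      ∫ s in x..y, qf D A s ^ 2 ≤ B * (fe D y - fe D x) := by
    intro x y B hx hxy hB
    rw [← hfi x y hx hxy, ← intervalIntegral.integral_const_mul]
    apply intervalIntegral.integral_mono_on_of_le_Ioo hxy (hq2.intervalIntegrable _ _)
      ((continuous_const.mul (fd_cont D)).intervalIntegrable _ _)
    intro s hs
    have h1 := qf_le (D := D) A s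
    have h2 := qf_nonneg (D := D) A s
    have h3 := hB s hs
    have h4 := fd_nonneg D s
    change _ ≤ B * fd D s
    nlinarith
  have hy := fe_pos D t
  have ha := fe_pos D A
  have hm := fd_nonneg D t
  have hc1' : 0 < c1 := by linarith
  have hle : ∀ s ≤ t, fd D s ≤ fd D t := fun s hs => fd_mono D hs
  rcases le_total (fe D t) (c1 * fe D A) with hcase | hcase
  · have h1 := hgen A t (fd D t) hA0 h (fun s hs => hle s hs.2.le)
    have h2 : fe D t / c1 ≤ fe D A := by rw [div_le_iff₀ hc1']; linarith
    have h3 : c0 / c1 * fe D t ≤ fe D t / c1 := by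
      rw [div_mul_eq_mul_div]; gcongr; nlinarith [hc0.2]
    have h4 : fd D t * (fe D t - fe D A) ≤ fd D t * (fe D t - c0 / c1 * fe D t) := by
      apply mul_le_mul_of_nonneg_left _ hm; linarith
    calc Gf D A t ≤ _ := h1
      _ ≤ _ := h4
      _ = _ := by ring
  · have hmem : fe D t / c1 ∈ Icc (fe D A) (fe D t) :=
      ⟨by rw [le_div_iff₀ hc1']; linarith, div_le_self hy.le hc1.le⟩
    obtain ⟨s0, hs0, e⟩ := intermediate_value_Icc h (fe_cont D).continuousOn hmem
    have hs0t : s0 < t := by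
      rcases hs0.2.eq_or_lt with h5 | h5
      · exfalso
        rw [h5, eq_div_iff hc1'.ne'] at e
        nlinarith
      · exact h5
    have h1 := hgen A s0 ((1 - c0) * fd D t) hA0 hs0.1 (fun s hs => by
      apply hf s t (hA.trans_lt hs.1) (hs.2.trans hs0t)
      have := fe_mono D hs.2.le
      rw [e, le_div_iff₀ hc1'] at this
      linarith)
    have h2 := hgen s0 t (fd D t) (hA0.trans_le hs0.1) hs0.2 (fun s hs => hle s hs.2.le)
    have h3 : Gf D A t = (∫ s in A..s0, qf D A s ^ 2) + ∫ s in s0..t, qf D A s ^ 2 :=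
      (intervalIntegral.integral_add_adjacent_intervals (hq2.intervalIntegrable _ _)
        (hq2.intervalIntegrable _ _)).symm
    rw [e] at h1 h2
    have h4 : (1 - c0) * fd D t * (fe D t / c1 - fe D A) + fd D t * (fe D t - fe D t / c1)
        = (1 - c0 / c1) * (fd D t * fe D t) - (1 - c0) * fd D t * fe D A := by
      field_simp; ring
    have h5 : 0 ≤ (1 - c0) * fd D t * fe D A := by
      have : 0 < 1 - c0 := by linarith [hc0.2]
      positivity
    linarith

lemma nedev {α lam : ℝ} {u w : ℝ → ℝ} (S : Sol D α lam u w) (hst : IsSemistable D α lam u)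
    {A : ℝ} (hA : 0 < A) :
    lam * ∫ r in (0:ℝ)..1, fd D (u r) * (Qf D A (u r)) ^ 2 * (Se D r * (r * mE D α r))
      ≤ lam * ∫ r in (0:ℝ)..1, Gf D A (u r) * fe D (u r) * (Se D r * (r * mE D α r)) := by
  have hQc : Continuous (Qf D A) :=
    continuous_iff_continuousAt.2 fun t => (Qf_deriv A t).continuousAt
  have hGc : Continuous (Gf D A) :=
    continuous_iff_continuousAt.2 fun t => (Gf_deriv A t).continuousAt
  have hqu := (qf_cont (D := D) A).comp_continuousOn S.uc
  have hGu := hGc.comp_continuousOn S.uc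
  have h0 := stab S hst (η := fun r => Qf D A (u r)) (k := fun r => qf D A (u r) * (-(w r)))
    (hQc.comp_continuousOn S.uc) (hqu.mul S.wc.neg)
    (fun r hr => (Qf_deriv A (u r)).comp r (S.ud r hr)) (by
      simp only [S.u1]; exact Qf_zero hA.le)
  refine h0.trans (le_of_eq ?_)
  have c1 : ContinuousOn (fun r => (qf D A (u r) * -w r) ^ 2 * (r * mE D α r)) (Icc 0 1) :=
    ((hqu.mul S.wc.neg).pow 2).mul (continuousOn_id.mul (mE_cont D α).continuousOn)
  have c2 : ContinuousOn (fun r => lam * (Gf D A (u r) * fe D (u r) * (Se D r * (r * mE D α r))))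
      (Icc 0 1) := continuousOn_const.mul
        ((hGu.mul ((fe_cont D).comp_continuousOn S.uc)).mul (Sm_cont D α).continuousOn)
  have ftc := intervalIntegral.integral_eq_sub_of_hasDerivAt_of_le (a := 0) (b := 1)
    (f := fun r => Gf D A (u r) * (r * mE D α r * w r))
    (f' := fun r => lam * (Gf D A (u r) * fe D (u r) * (Se D r * (r * mE D α r)))
      - (qf D A (u r) * -w r) ^ 2 * (r * mE D α r)) zero_le_one
    (hGu.mul (Fc S))
    (fun r hr => by
      have := ((Gf_deriv (D := D) A (u r)).comp r (S.ud r hr)).mul (S.Fd r hr)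
      refine this.congr_deriv ?_
      simp only [Function.comp]
      ring)
    ((c2.sub c1).intervalIntegrable_of_Icc zero_le_one)
  rw [intervalIntegral.integral_sub (c2.intervalIntegrable_of_Icc zero_le_one)
    (c1.intervalIntegrable_of_Icc zero_le_one), S.u1, Gf_zero hA.le,
    intervalIntegral.integral_const_mul] at ftc
  simp only [zero_mul, mul_zero, sub_zero] at ftc
  linarith
end Pesec

section Pfsec
variable (D : GelfandData)
variable {D}

lemma core1 {α lam : ℝ} {u w : ℝ → ℝ} (S : Sol D α lam u w) (hst : IsSemistable D α lam u)
    (hα : 0 < α) (hl : 0 < lam) {c0 c1 t0 A ρ C1 : ℝ} (hc0 : c0 ∈ Ioo (0:ℝ) 1) (hc1 : 1 < c1)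
    (hf : ∀ t1 t2, t0 < t1 → t1 < t2 → c1 * fe D t1 ≤ fe D t2 →
      fd D t1 ≤ (1 - c0) * fd D t2) (hA0 : 0 < A) (hA : t0 ≤ A)
    (hρ0 : 0 < ρ) (hρ1 : ρ < 1) (hu : u ρ = A) (hm : 0 < fd D A)
    (hY : lam * ∫ r in (0:ℝ)..ρ, fd D (u r) * (Se D r * (r * mE D α r)) ≤ C1)
    (hL : lam * fd D A * ρ ^ 2 ≤ 4 * C1) :
    u 0 - A ≤ (2 * (4 * (1 + 2 / (c0 / c1))) / (c0 / c1) * C1 + 2 * C1) / 2 * (fe D A / fd D A) := by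
  set ν := c0 / c1 with hν
  set m := fd D A with hmdef
  set a := fe D A with hadef
  have ha : 0 < a := fe_pos D A
  have hν0 : 0 < ν := div_pos hc0.1 (by linarith)
  have hν1 : ν < 1 := by
    rw [hν, div_lt_one (by linarith)]; linarith [hc0.2]
  have hanti := u_anti S hl.le
  have hsub : Icc 0 ρ ⊆ Icc (0:ℝ) 1 := Icc_subset_Icc le_rfl hρ1.le
  have huA : ∀ r ∈ Icc 0 ρ, A ≤ u r := fun r hr => by
    rw [← hu]; exact hanti (hsub hr) ⟨hρ0.le, hρ1.le⟩ hr.2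
  have hQc : Continuous (Qf D A) :=
    continuous_iff_continuousAt.2 fun t => (Qf_deriv A t).continuousAt
  have hGc : Continuous (Gf D A) :=
    continuous_iff_continuousAt.2 fun t => (Gf_deriv A t).continuousAt
  have hSc := (Sm_cont D α).continuousOn (s := Icc 0 1)
  have hfdc := (fd_cont D).comp_continuousOn S.uc
  have hfec := (fe_cont D).comp_continuousOn S.uc
  have hQuc := hQc.comp_continuousOn S.uc
  have hGuc := hGc.comp_continuousOn S.uc
  have ii : ∀ (g : ℝ → ℝ), ContinuousOn g (Icc 0 1) → ∀ a b : ℝ, 0 ≤ a → a ≤ b → b ≤ 1 →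
      IntervalIntegrable g volume a b := fun g hg a b h1 h2 h3 =>
    (hg.mono (Icc_subset_Icc h1 h3)).intervalIntegrable_of_Icc h2
  have c1' : ContinuousOn (fun r => fd D (u r) * (Qf D A (u r)) ^ 2 * (Se D r * (r * mE D α r)))
    (Icc 0 1) := (hfdc.mul (hQuc.pow 2)).mul hSc
  have c2' : ContinuousOn (fun r => Gf D A (u r) * fe D (u r) * (Se D r * (r * mE D α r)))
    (Icc 0 1) := (hGuc.mul hfec).mul hSc
  have c3' : ContinuousOn (fun r => fd D (u r) * (fe D (u r)) ^ 2 * (Se D r * (r * mE D α r)))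
    (Icc 0 1) := (hfdc.mul (hfec.pow 2)).mul hSc
  have c4' : ContinuousOn (fun r => fd D (u r) * (Se D r * (r * mE D α r)))
    (Icc 0 1) := hfdc.mul hSc
  have hne := nedev S hst hA0
  have hz1 : ∫ r in (0:ℝ)..1, fd D (u r) * (Qf D A (u r)) ^ 2 * (Se D r * (r * mE D α r))
      = ∫ r in (0:ℝ)..ρ, fd D (u r) * (Qf D A (u r)) ^ 2 * (Se D r * (r * mE D α r)) := by
    rw [← intervalIntegral.integral_add_adjacent_intervals (ii _ c1' 0 ρ le_rfl hρ0.le hρ1.le)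
      (ii _ c1' ρ 1 hρ0.le hρ1.le le_rfl), add_eq_left,
      intervalIntegral.integral_congr (g := fun _ => 0), intervalIntegral.integral_zero]
    intro r hr
    rw [uIcc_of_le hρ1.le] at hr
    have : u r ≤ A := by
      rw [← hu]; exact hanti ⟨hρ0.le, hρ1.le⟩ ⟨hρ0.le.trans hr.1, hr.2⟩ hr.1
    simp only [Qf_zero this]; ring
  have hz2 : ∫ r in (0:ℝ)..1, Gf D A (u r) * fe D (u r) * (Se D r * (r * mE D α r))
      = ∫ r in (0:ℝ)..ρ, Gf D A (u r) * fe D (u r) * (Se D r * (r * mE D α r)) := by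
    rw [← intervalIntegral.integral_add_adjacent_intervals (ii _ c2' 0 ρ le_rfl hρ0.le hρ1.le)
      (ii _ c2' ρ 1 hρ0.le hρ1.le le_rfl), add_eq_left,
      intervalIntegral.integral_congr (g := fun _ => 0), intervalIntegral.integral_zero]
    intro r hr
    rw [uIcc_of_le hρ1.le] at hr
    have : u r ≤ A := by
      rw [← hu]; exact hanti ⟨hρ0.le, hρ1.le⟩ ⟨hρ0.le.trans hr.1, hr.2⟩ hr.1
    simp only [Gf_zero this]; ring
  rw [hz1, hz2] at hne
  set I1 := ∫ r in (0:ℝ)..ρ, fd D (u r) * (Qf D A (u r)) ^ 2 * (Se D r * (r * mE D α r))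
  set I2 := ∫ r in (0:ℝ)..ρ, Gf D A (u r) * fe D (u r) * (Se D r * (r * mE D α r))
  set I3 := ∫ r in (0:ℝ)..ρ, fd D (u r) * (fe D (u r)) ^ 2 * (Se D r * (r * mE D α r)) with hI3
  set I4 := ∫ r in (0:ℝ)..ρ, fd D (u r) * (Se D r * (r * mE D α r))
  set K := 4 * (1 + 2 / ν) with hK
  have hK0 : 0 < K := by positivity
  have e1 : I2 ≤ (1 - ν) * I3 := by
    rw [← intervalIntegral.integral_const_mul]
    refine intervalIntegral.integral_mono_on hρ0.le (ii _ c2' 0 ρ le_rfl hρ0.le hρ1.le)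
      (ii _ (continuousOn_const.mul c3') 0 ρ le_rfl hρ0.le hρ1.le) ?_
    intro r hr
    have h1 := Gf_le (D := D) hc0 hc1 hf hA0 hA (huA r hr)
    have h2 := mul_le_mul_of_nonneg_right h1
      (mul_nonneg (fe_pos D (u r)).le (S_nonneg (D := D) (α := α) hr.1))
    calc _ = Gf D A (u r) * (fe D (u r) * (Se D r * (r * mE D α r))) := by ring
      _ ≤ _ := h2
      _ = _ := by ring
  have e2 : I3 ≤ (1 + ν / 2) * I1 + K * a ^ 2 * I4 := by
    rw [← intervalIntegral.integral_const_mul, ← intervalIntegral.integral_const_mul,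
      ← intervalIntegral.integral_add ((ii _ c1' 0 ρ le_rfl hρ0.le hρ1.le).const_mul _)
      ((ii _ c4' 0 ρ le_rfl hρ0.le hρ1.le).const_mul _)]
    refine intervalIntegral.integral_mono_on hρ0.le (ii _ c3' 0 ρ le_rfl hρ0.le hρ1.le)
      (ii _ ((continuousOn_const.mul c1').add (continuousOn_const.mul c4')) 0 ρ le_rfl hρ0.le hρ1.le) ?_
    intro r hr
    have h1 := Qf_ge (D := D) hA0 (huA r hr)
    have h0 := fe_pos D (u r)
    have h2 : (fe D (u r)) ^ 2 ≤ (1 + ν / 2) * (Qf D A (u r)) ^ 2 + K * a ^ 2 := by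
      have h3 : (fe D (u r)) ^ 2 ≤ (Qf D A (u r) + 2 * a) ^ 2 := pow_le_pow_left₀ h0.le h1 2
      have h4 : (1 + ν / 2) * (Qf D A (u r)) ^ 2 + K * a ^ 2 - (Qf D A (u r) + 2 * a) ^ 2
          = ν / 2 * (Qf D A (u r) - 4 * a / ν) ^ 2 := by
        rw [hK]; field_simp; ring
      have h5 : 0 ≤ ν / 2 * (Qf D A (u r) - 4 * a / ν) ^ 2 := by positivity
      linarith
    have h6 := mul_le_mul_of_nonneg_right h2
      (mul_nonneg (fd_nonneg D (u r)) (S_nonneg (D := D) (α := α) hr.1))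
    calc _ = fe D (u r) ^ 2 * (fd D (u r) * (Se D r * (r * mE D α r))) := by ring
      _ ≤ _ := h6
      _ = _ := by ring
  have hI3n : 0 ≤ I3 := by
    apply intervalIntegral.integral_nonneg hρ0.le
    intro r hr
    exact mul_nonneg (mul_nonneg (fd_nonneg D _) (sq_nonneg _)) (S_nonneg hr.1)
  have hX : lam * I3 ≤ 2 * K / ν * C1 * a ^ 2 := by
    have q1 : lam * I3 ≤ (1 + ν / 2) * (lam * I1) + K * a ^ 2 * (lam * I4) := by
      nlinarith [mul_le_mul_of_nonneg_left e2 hl.le]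
    have q2 : lam * I1 ≤ (1 - ν) * (lam * I3) := by
      nlinarith [mul_le_mul_of_nonneg_left e1 hl.le]
    have q3 : K * a ^ 2 * (lam * I4) ≤ K * a ^ 2 * C1 :=
      mul_le_mul_of_nonneg_left hY (by positivity)
    have q4 : (1 + ν / 2) * (lam * I1) ≤ (1 + ν / 2) * ((1 - ν) * (lam * I3)) :=
      mul_le_mul_of_nonneg_left q2 (by positivity)
    have q5 : 0 ≤ ν ^ 2 * (lam * I3) := by positivity
    have q6 : ν / 2 * (lam * I3) ≤ K * a ^ 2 * C1 := by nlinarith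
    have : 2 * K / ν * C1 * a ^ 2 = (2 / ν) * (K * a ^ 2 * C1) := by ring
    rw [this]
    calc lam * I3 = (2 / ν) * (ν / 2 * (lam * I3)) := by field_simp
      _ ≤ _ := mul_le_mul_of_nonneg_left q6 (by positivity)
  set C2 := 2 * K / ν * C1 with hC2
  have hw : ∀ r ∈ Ioc 0 ρ, w r ≤ (C2 + 2 * C1) / 2 * (a / (ρ * m)) := by
    intro r hr
    have hr1 : r ≤ 1 := hr.2.trans hρ1.le
    have hFe := F_eq S hr.1.le hr1
    set τ := r / (a * ρ * m) with hτ
    have hr0 := hr.1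
    have hτ0 : 0 < τ := by positivity
    have hmE := one_le_mE D hα.le hr0.le
    have g1 : ∫ t in (0:ℝ)..r, lam * fe D (u t) * (Se D t * (t * mE D α t))
        ≤ ∫ t in (0:ℝ)..r, ((lam * τ / 2) * (fd D (u t) * (fe D (u t)) ^ 2 * (Se D t * (t * mE D α t)))
          + lam / (2 * τ * m) * (Se D t * (t * mE D α t))) := by
      refine intervalIntegral.integral_mono_on hr0.le (ii _ (rhs_c S) 0 r le_rfl hr0.le hr1)
        (ii _ ((continuousOn_const.mul c3').add (continuousOn_const.mul hSc)) 0 r le_rfl hr0.le hr1) ?_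
      intro t ht
      have htm : m ≤ fd D (u t) := fd_mono D (huA t ⟨ht.1, ht.2.trans hr.2⟩)
      have h1 : fe D (u t) ≤ τ / 2 * (fd D (u t) * fe D (u t) ^ 2) + 1 / (2 * τ * m) := by
        have h2 : τ / 2 * (m * fe D (u t) ^ 2) ≤ τ / 2 * (fd D (u t) * fe D (u t) ^ 2) := by
          gcongr
        have h3 : τ / 2 * (m * fe D (u t) ^ 2) + 1 / (2 * τ * m) - fe D (u t)
          = (τ * m * fe D (u t) - 1) ^ 2 / (2 * τ * m) := by field_simp; ring
        have h4 : 0 ≤ (τ * m * fe D (u t) - 1) ^ 2 / (2 * τ * m) := by positivity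
        linarith
      have h5 := mul_le_mul_of_nonneg_right h1 (mul_nonneg hl.le (S_nonneg (D := D) (α := α) ht.1))
      calc _ = fe D (u t) * (lam * (Se D t * (t * mE D α t))) := by ring
        _ ≤ _ := h5
        _ = _ := by ring
    rw [intervalIntegral.integral_add ((ii _ c3' 0 r le_rfl hr0.le hr1).const_mul _)
      ((ii _ hSc 0 r le_rfl hr0.le hr1).const_mul _),
      intervalIntegral.integral_const_mul, intervalIntegral.integral_const_mul] at g1
    have g2 : ∫ t in (0:ℝ)..r, fd D (u t) * (fe D (u t)) ^ 2 * (Se D t * (t * mE D α t)) ≤ I3 := by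
      rw [hI3, ← intervalIntegral.integral_add_adjacent_intervals (ii _ c3' 0 r le_rfl hr0.le hr1)
        (ii _ c3' r ρ hr0.le hr.2 hρ1.le)]
      have : 0 ≤ ∫ r in r..ρ, fd D (u r) * (fe D (u r)) ^ 2 * (Se D r * (r * mE D α r)) := by
        apply intervalIntegral.integral_nonneg hr.2
        intro x hx
        exact mul_nonneg (mul_nonneg (fd_nonneg D _) (sq_nonneg _)) (S_nonneg (hr0.le.trans hx.1))
      linarith
    have g3 := IS_le2 D (α := α) hα.le hr0.le
    unfold IS at g3
    have g4 : r * mE D α r * w r ≤ τ / 2 * (C2 * a ^ 2) + lam / (2 * τ * m) * (mE D α r * (r ^ 2 / 2)) := by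
      rw [hFe]
      refine g1.trans (add_le_add ?_ (mul_le_mul_of_nonneg_left g3 (by positivity)))
      calc _ ≤ lam * τ / 2 * I3 := mul_le_mul_of_nonneg_left g2 (by positivity)
        _ = τ / 2 * (lam * I3) := by ring
        _ ≤ _ := mul_le_mul_of_nonneg_left hX (by positivity)
    have hC2n : 0 ≤ C2 * a ^ 2 := le_trans (by positivity) hX
    have g5 : τ / 2 * (C2 * a ^ 2) ≤ r * mE D α r * (C2 / 2 * (a / (ρ * m))) := by
      calc τ / 2 * (C2 * a ^ 2) ≤ mE D α r * (τ / 2 * (C2 * a ^ 2)) :=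
            le_mul_of_one_le_left (by positivity) hmE
        _ = _ := by rw [hτ]; field_simp
    have g6 : lam / (2 * τ * m) * (mE D α r * (r ^ 2 / 2)) ≤ r * mE D α r * (C1 * (a / (ρ * m))) := by
      have : lam / (2 * τ * m) * (mE D α r * (r ^ 2 / 2))
        = r * mE D α r * (a / (ρ * m)) * (lam * m * ρ ^ 2 / 4) := by
        rw [hτ]; field_simp; ring
      rw [this]
      have h7 : lam * m * ρ ^ 2 / 4 ≤ C1 := by linarith
      have := mul_le_mul_of_nonneg_left h7 (show 0 ≤ r * mE D α r * (a / (ρ * m)) by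
        have := mE_pos D α r
        positivity)
      linarith
    have h8 : 0 < r * mE D α r := mul_pos hr0 (mE_pos D α r)
    refine le_of_mul_le_mul_left ?_ h8
    linarith
  have hus := u_sub S le_rfl hρ0.le hρ1.le
  rw [hu] at hus
  rw [hus]
  have := intervalIntegral.integral_mono_on_of_le_Ioo hρ0.le
    (ii _ S.wc 0 ρ le_rfl hρ0.le hρ1.le)
    (intervalIntegrable_const (c := (C2 + 2 * C1) / 2 * (a / (ρ * m))) (a := 0) (b := ρ) (μ := volume))
    (fun r hr => hw r ⟨hr.1, hr.2.le⟩)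
  refine this.trans (le_of_eq ?_)
  rw [intervalIntegral.integral_const]
  simp only [smul_eq_mul]
  field_simp
  ring

lemma core (D : GelfandData) {c0 c1 t0 : ℝ} (hc0 : c0 ∈ Ioo (0:ℝ) 1) (hc1 : 1 < c1)
    (hf : ∀ t1 t2, t0 < t1 → t1 < t2 → c1 * fe D t1 ≤ fe D t2 →
      fd D t1 ≤ (1 - c0) * fd D t2) :
    ∃ c > (0:ℝ), ∃ c' > (0:ℝ), ∃ α₀ : ℝ, ∀ α ≥ α₀, ∀ u : ℝ → ℝ,
      IsSolution D α (lamStar D α) u → IsSemistable D α (lamStar D α) u →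
      ∀ A, t0 ≤ A → 1 ≤ A → c' * Real.log α ≤ fd D A → u 0 ≤ c * A := by
  obtain ⟨κ, hκ, hlow⟩ := lam_lower D
  set C1 : ℝ := 64 * Real.exp 2 with hC1
  have hC1p : 0 < C1 := by positivity
  set ν := c0 / c1 with hν
  have hν0 : 0 < ν := div_pos hc0.1 (by linarith)
  set C3 := (2 * (4 * (1 + 2 / ν)) / ν * C1 + 2 * C1) / 2 with hC3
  have hC3p : 0 < C3 := by positivity
  set c' := (4 * C1 + 1) / κ with hc'
  have hc'p : 0 < c' := by positivity
  have hSe : ∀ᶠ x in nhds (0:ℝ), 1 / 2 < Se D x := by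
    apply (Se_cont D).continuousAt.eventually (lt_mem_nhds _)
    rw [Se_zero]; norm_num
  have hsq : Tendsto (fun α : ℝ => 1 / Real.sqrt α) atTop (nhds 0) :=
    tendsto_const_nhds.div_atTop Real.tendsto_sqrt_atTop
  have hlog : ∀ᶠ α : ℝ in atTop, fe D 0 / c' ≤ Real.log α :=
    Real.tendsto_log_atTop.eventually_ge_atTop _
  obtain ⟨α₀, hα₀⟩ := eventually_atTop.1 ((hsq.eventually hSe).and (hlog.and (eventually_ge_atTop 4)))
  refine ⟨1 + 2 * C3, by positivity, c', hc'p, α₀, ?_⟩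
  intro α hαα u hsol hst A hAt hA1 hAd
  obtain ⟨hS, hlg, h4⟩ := hα₀ α hαα
  have hα : 0 < α := by linarith
  have hlogp : 0 < Real.log α := Real.log_pos (by linarith)
  have hlam := hlow α (by linarith) u hsol
  set lam := lamStar D α with hlamdef
  have hl : 0 < lam := lt_of_lt_of_le (by positivity) hlam
  have S := sol_of hsol
  have hanti := u_anti S hl.le
  set w := fun r => -derivWithin u (Icc 0 1) r
  rcases le_or_gt (u 0) A with h | hA
  · nlinarith
  have hmpos : 0 < fd D A := lt_of_lt_of_le (by positivity) hAd
  have hmf : fe D 0 ≤ fd D A := by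
    refine le_trans ?_ hAd
    rw [div_le_iff₀ hc'p] at hlg; linarith
  obtain ⟨ρ, hρ, hρA⟩ : A ∈ u '' Icc 0 1 :=
    intermediate_value_Icc' zero_le_one S.uc ⟨by rw [S.u1]; linarith, hA.le⟩
  have hρ0 : 0 < ρ := lt_of_le_of_ne hρ.1 (by rintro rfl; linarith)
  have hρ1 : ρ < 1 := lt_of_le_of_ne hρ.2 (by rintro rfl; rw [S.u1] at hρA; linarith)
  set δ := 1 / Real.sqrt α with hδ
  have hsqp : 0 < Real.sqrt α := Real.sqrt_pos.2 hα
  have hδ0 : 0 < δ := by positivity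
  have hδ2 : α * δ ^ 2 = 1 := by
    rw [hδ, div_pow, Real.sq_sqrt hα.le]; field_simp
  have hδh : δ ≤ 1 / 2 := by
    nlinarith
  set b := min ρ δ with hb
  have hb0 : 0 < b := lt_min hρ0 hδ0
  have hbρ : b ≤ ρ := min_le_left _ _
  have hbδ : b ≤ δ := min_le_right _ _
  have hst1 := stabR S hst hα hl (R := 2 * b) (by linarith) (by linarith)
    (by nlinarith [mul_le_mul_of_nonneg_left (pow_le_pow_left₀ hb0.le hbδ 2) hα.le])
  rw [show 2 * b / 2 = b by ring] at hst1
  have hlm : lam * fd D A * b ^ 2 ≤ 4 * C1 := by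
    have : ∫ r in (0:ℝ)..b, fd D A / 2 * r ≤
        ∫ r in (0:ℝ)..b, fd D (u r) * (Se D r * (r * mE D α r)) := by
      refine intervalIntegral.integral_mono_on hb0.le ((continuous_const.mul continuous_id).intervalIntegrable 0 b)
        (((fdS_c S).mono (Icc_subset_Icc le_rfl (by linarith))).intervalIntegrable_of_Icc hb0.le) ?_
      intro r hr
      have h1 : fd D A ≤ fd D (u r) := by
        apply fd_mono D; rw [← hρA]
        exact hanti ⟨hr.1, by linarith [hr.2]⟩ hρ (hr.2.trans hbρ)
      have h2 : 1 / 2 ≤ Se D r := hS.le.trans (Se_anti D (hr.2.trans hbδ))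
      have h3 := one_le_mE D hα.le hr.1
      have h5 : r * 1 ≤ r * mE D α r := mul_le_mul_of_nonneg_left h3 hr.1
      have h6 : 1 / 2 * r ≤ Se D r * (r * mE D α r) :=
        mul_le_mul h2 (by linarith) hr.1 (Se_nonneg D r)
      calc fd D A / 2 * r = fd D A * (1 / 2 * r) := by ring
        _ ≤ _ := mul_le_mul h1 h6 (by linarith [hr.1]) (fd_nonneg D _)
    rw [intervalIntegral.integral_const_mul, integral_id] at this
    have := mul_le_mul_of_nonneg_left this hl.le
    linarith
  have hκm : κ * c' * α ≤ lam * fd D A := by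
    calc κ * c' * α = (κ * α / Real.log α) * (c' * Real.log α) := by field_simp
      _ ≤ _ := mul_le_mul hlam hAd (by positivity) hl.le
  have hκc : κ * c' = 4 * C1 + 1 := by rw [hc']; field_simp
  have hρδ : ρ < δ := by
    by_contra hcon
    have hbe : b = δ := min_eq_right (not_lt.1 hcon)
    rw [hbe] at hlm
    have : (κ * c' * α) * δ ^ 2 ≤ (lam * fd D A) * δ ^ 2 :=
      mul_le_mul_of_nonneg_right hκm (by positivity)
    rw [mul_assoc, hδ2, hκc] at this
    linarith
  have hbe : b = ρ := min_eq_left hρδ.le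
  rw [hbe] at hlm hst1
  have hfin := core1 S hst hα hl hc0 hc1 hf (by linarith) hAt hρ0 hρ1 hρA hmpos hst1 hlm
  have hr : fe D A / fd D A ≤ 2 * A := by
    rw [div_le_iff₀ hmpos]
    have := f_le D (t := A) (by linarith)
    nlinarith
  have := mul_le_mul_of_nonneg_left hr hC3p.le
  change u 0 - A ≤ C3 * (fe D A / fd D A) at hfin
  linarith
end Pfsec

section Pgsec
variable (D : GelfandData)
def Gg (D : GelfandData) (t : ℝ) : ℝ := ∫ s in (0:ℝ)..t, 1 / fe D s

lemma ife_cont : Continuous (fun s => 1 / fe D s) :=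
  continuous_const.div (fe_cont D) fun s => (fe_pos D s).ne'

lemma ife_int : IntegrableOn (fun s => 1 / fe D s) (Ioi 0) :=
  D.f_int.congr_fun (fun s hs => by simp only [fe_eq D (le_of_lt hs)]) measurableSet_Ioi

lemma Gg_deriv (t : ℝ) : HasDerivAt (Gg D) (1 / fe D t) t :=
  ((ife_cont D).integral_hasStrictDerivAt 0 t).hasDerivAt

lemma Gg_mono : StrictMono (Gg D) :=
  strictMono_of_deriv_pos fun t => by
    rw [(Gg_deriv D t).deriv]; exact one_div_pos.2 (fe_pos D t)

lemma Gg_lim : ∃ K, Tendsto (Gg D) atTop (nhds K) :=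
  ⟨_, intervalIntegral_tendsto_integral_Ioi 0 (ife_int D) tendsto_id⟩

lemma Gg_le {K : ℝ} (hK : Tendsto (Gg D) atTop (nhds K)) (t : ℝ) : Gg D t ≤ K :=
  (Gg_mono D).monotone.ge_of_tendsto hK t

lemma Gg_nonneg {t : ℝ} (ht : 0 ≤ t) : 0 ≤ Gg D t := by
  have := (Gg_mono D).monotone ht
  rwa [show Gg D 0 = 0 by simp [Gg]] at this

lemma fd_log (C : ℝ) : ∀ᶠ t : ℝ in atTop, C * Real.log t ≤ fd D t := by
  obtain ⟨K, hK⟩ := Gg_lim D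
  set ε : ℝ := 1 / (2 * (|C| + 1)) with hε
  have hεp : 0 < ε := by positivity
  have h1 : ∀ᶠ t : ℝ in atTop, K - ε < Gg D (Real.sqrt t) :=
    (hK.comp Real.tendsto_sqrt_atTop).eventually (lt_mem_nhds (by linarith))
  filter_upwards [h1, eventually_ge_atTop 1,
    Real.tendsto_log_atTop.eventually_ge_atTop (fe D 0)] with t h2 ht hlog
  have hsq1 : 1 ≤ Real.sqrt t := Real.one_le_sqrt.2 ht
  have hsqt : Real.sqrt t ≤ t := by
    have := Real.sq_sqrt (show 0 ≤ t by linarith)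
    nlinarith
  set d := fe D 0 + fd D t with hd
  have hdp : 0 < d := by linarith [fe_pos D 0, fd_nonneg D t]
  have h3 : ∫ s in (Real.sqrt t)..t, (1 / d) * (1 / s) ≤ ∫ s in (Real.sqrt t)..t, 1 / fe D s := by
    refine intervalIntegral.integral_mono_on hsqt ?_ ((ife_cont D).intervalIntegrable _ _) ?_
    · apply ContinuousOn.intervalIntegrable_of_Icc hsqt
      apply continuousOn_const.mul
      apply continuousOn_const.div continuousOn_id
      intro x hx
      simp only [id]
      linarith [hx.1]
    · intro s hs
      have hs1 : 1 ≤ s := hsq1.trans hs.1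
      rw [one_div_mul_one_div]
      apply one_div_le_one_div_of_le (fe_pos D s)
      have h4 := f_le D (t := s) (by linarith)
      have h5 := fd_mono D hs.2
      have h6 : s * fd D s ≤ s * fd D t := mul_le_mul_of_nonneg_left h5 (by linarith)
      nlinarith [fe_pos D 0]
  rw [intervalIntegral.integral_const_mul, integral_one_div_of_pos (by linarith) (by linarith),
    Real.log_div (by linarith) (by linarith), Real.log_sqrt (by linarith)] at h3
  have h7 : ∫ s in (Real.sqrt t)..t, 1 / fe D s = Gg D t - Gg D (Real.sqrt t) := by
    unfold Gg
    rw [intervalIntegral.integral_interval_sub_left] <;> exact (ife_cont D).intervalIntegrable _ _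
  rw [h7] at h3
  have h8 := Gg_le D hK t
  have h9 : 1 / d * (Real.log t / 2) ≤ ε := by
    have : Real.log t - Real.log t / 2 = Real.log t / 2 := by ring
    rw [this] at h3; linarith
  have h10 : Real.log t / 2 ≤ ε * d := by
    rw [one_div_mul_eq_div, div_le_iff₀ hdp] at h9; exact h9
  have h11 : (|C| + 1) * Real.log t ≤ d := by
    have : (2 * (|C| + 1)) * (Real.log t / 2) ≤ (2 * (|C| + 1)) * (ε * d) :=
      mul_le_mul_of_nonneg_left h10 (by positivity)
    have e : (2 * (|C| + 1)) * (ε * d) = d := by rw [hε]; field_simp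
    rw [e] at this; linarith
  have hl0 : 0 ≤ Real.log t := Real.log_nonneg ht
  have : C * Real.log t ≤ |C| * Real.log t := mul_le_mul_of_nonneg_right (le_abs_self C) hl0
  linarith

variable {D}

lemma Gu {α lam : ℝ} {u w : ℝ → ℝ} (S : Sol D α lam u w) (hα : 1 < α) (hl : 0 < lam)
    (hSr : 1 / 2 ≤ Se D (α ^ (-(1/4) : ℝ))) (hPr : 1 / 2 ≤ Pe D (α ^ (-(1/4) : ℝ))) :
    Gg D (u (α ^ (-(1/4) : ℝ))) + lam * ((1 - Real.exp (-(1/4))) / 2) / α * (Real.log α / 4)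
      ≤ Gg D (u (α ^ (-(1/2) : ℝ))) := by
  have hα0 : 0 < α := by linarith
  set r0 := α ^ (-(1/4) : ℝ) with hr0
  set δ := α ^ (-(1/2) : ℝ) with hδ
  set c := (1 - Real.exp (-(1/4))) / 2 with hc
  have hδ0 : 0 < δ := Real.rpow_pos_of_pos hα0 _
  have hδr : δ ≤ r0 := Real.rpow_le_rpow_of_exponent_le hα.le (by norm_num)
  have hr1 : r0 < 1 := Real.rpow_lt_one_of_one_lt_of_neg hα (by norm_num)
  have hδ2 : α * δ ^ 2 = 1 := by
    rw [hδ, ← Real.rpow_natCast, ← Real.rpow_mul hα0.le]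
    norm_num
    rw [Real.rpow_neg_one]; field_simp
  have hanti : AntitoneOn (fun r => Gg D (u r) + lam * c / α * Real.log r) (Icc δ r0) := by
    have hder : ∀ r ∈ Icc δ r0, HasDerivAt (fun r => Gg D (u r) + lam * c / α * Real.log r)
        (1 / fe D (u r) * (-(w r)) + lam * c / α * r⁻¹) r := by
      intro r hr
      have hrp : 0 < r := hδ0.trans_le hr.1
      exact ((Gg_deriv D (u r)).comp r (S.ud r ⟨hrp, hr.2.trans_lt hr1⟩)).add
        ((Real.hasDerivAt_log hrp.ne').const_mul _)
    apply antitoneOn_of_deriv_nonpos (convex_Icc _ _)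
    · intro r hr; exact (hder r hr).continuousAt.continuousWithinAt
    · intro r hr; exact (hder r (interior_subset hr)).differentiableAt.differentiableWithinAt
    · intro r hr
      have hr := interior_subset hr
      rw [(hder r hr).deriv]
      have hrp : 0 < r := hδ0.trans_le hr.1
      have hrle : r ≤ 1 := hr.2.trans hr1.le
      have hfp := fe_pos D (u r)
      have k1 : lam * fe D (u r) * IS D α r ≤ r * mE D α r * w r := by
        rw [F_eq S hrp.le hrle]
        unfold IS
        rw [← intervalIntegral.integral_const_mul]
        refine intervalIntegral.integral_mono_on hrp.le
          ((continuous_const.mul (Sm_cont D α)).intervalIntegrable _ _)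
          (((rhs_c S).mono (Icc_subset_Icc le_rfl hrle)).intervalIntegrable_of_Icc hrp.le) ?_
        intro t ht
        apply mul_le_mul_of_nonneg_right _ (S_nonneg ht.1)
        apply mul_le_mul_of_nonneg_left _ hl.le
        exact fe_mono D (u_anti S hl.le ⟨ht.1, ht.2.trans hrle⟩ ⟨hrp.le, hrle⟩ ht.2)
      have k2 := IS_ge D hα0 hrp.le
      have hSe : 1 / 2 ≤ Se D r := hSr.trans (Se_anti D hr.2)
      have hPe : 1 / 2 ≤ Pe D r := hPr.trans (Pe_anti D hr.2)
      have k3 := mE_ratio D hα0.le le_rfl hrp.le hPe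
      rw [mE_zero] at k3
      have k4 : Real.exp (1 / 4) ≤ mE D α r := by
        refine le_trans (Real.exp_le_exp.2 ?_) (by simpa using k3)
        nlinarith [mul_le_mul_of_nonneg_left (pow_le_pow_left₀ hδ0.le hr.1 2) hα0.le]
      have k5 : (1 - Real.exp (-(1/4))) * mE D α r ≤ mE D α r - 1 := by
        have : Real.exp (-(1/4)) * Real.exp (1/4) = 1 := by rw [← Real.exp_add]; simp
        nlinarith [Real.exp_pos (-(1/4)), mul_le_mul_of_nonneg_left k4 (Real.exp_pos (-(1/4))).le]
      have k6 : c * mE D α r / α ≤ IS D α r := by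
        refine le_trans ?_ k2
        apply div_le_div_of_nonneg_right _ hα0.le
        have h0 : 0 ≤ mE D α r - 1 := by linarith [one_le_mE D hα0.le hrp.le]
        have := mul_le_mul_of_nonneg_right hSe h0
        rw [hc]; linarith
      have k7 : lam * fe D (u r) * (c / α) ≤ r * w r := by
        have h1 : lam * fe D (u r) * (c * mE D α r / α) ≤ r * mE D α r * w r :=
          (mul_le_mul_of_nonneg_left k6 (by positivity)).trans k1
        refine le_of_mul_le_mul_right ?_ (mE_pos D α r)
        calc _ = lam * fe D (u r) * (c * mE D α r / α) := by ring
          _ ≤ _ := h1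
          _ = _ := by ring
      have k8 : 1 / fe D (u r) * (-(w r)) + lam * c / α * r⁻¹
          = (lam * fe D (u r) * (c / α) - r * w r) / (fe D (u r) * r) := by
        field_simp; ring
      rw [k8]
      exact div_nonpos_of_nonpos_of_nonneg (by linarith) (by positivity)
  have := hanti ⟨le_rfl, hδr⟩ ⟨hδr, le_rfl⟩ hδr
  simp only [hr0, hδ, Real.log_rpow hα0] at this
  rw [← hr0, ← hδ] at this
  linarith

lemma tend_rpow {y : ℝ} (hy : 0 < y) : Tendsto (fun α : ℝ => α ^ (-y)) atTop (nhds 0) :=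
  tendsto_rpow_neg_atTop hy

lemma H2 (D : GelfandData) : ∃ U0 > (0:ℝ), ∃ CL > (0:ℝ), ∀ᶠ α : ℝ in atTop, ∀ u,
    IsSolution D α (lamStar D α) u → 0 < lamStar D α ∧ lamStar D α / α ≤ CL / Real.log α ∧
      u (α ^ (-(1/4) : ℝ)) ≤ U0 := by
  obtain ⟨κ, hκ, hlow⟩ := lam_lower D
  obtain ⟨K, hK⟩ := Gg_lim D
  set c := (1 - Real.exp (-(1/4))) / 2 with hc
  have hcp : 0 < c := by
    have : Real.exp (-(1/4)) < 1 := by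
      rw [← Real.exp_zero]; exact Real.exp_lt_exp.2 (by norm_num)
    rw [hc]; linarith
  obtain ⟨U0, hU0, hU0p⟩ := ((hK.eventually (lt_mem_nhds (show K - c * κ / 4 < K by
    have : 0 < c * κ / 4 := by positivity
    linarith))).and (eventually_gt_atTop 0)).exists
  have hKp : 0 < K := lt_of_lt_of_le (by
    have := Gg_mono D (zero_lt_one); rwa [show Gg D 0 = 0 by simp [Gg]] at this) (Gg_le D hK 1)
  refine ⟨U0, hU0p, 4 * K / c, by positivity, ?_⟩
  have hSe : ∀ᶠ x in nhds (0:ℝ), 1 / 2 < Se D x := by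
    apply (Se_cont D).continuousAt.eventually (lt_mem_nhds _)
    rw [Se_zero]; norm_num
  have hPe : ∀ᶠ x in nhds (0:ℝ), 1 / 2 < Pe D x := by
    apply (Pe_cont D).continuousAt.eventually (lt_mem_nhds _)
    rw [Pe_zero]; norm_num
  have ht := tend_rpow (show (0:ℝ) < 1/4 by norm_num)
  filter_upwards [ht.eventually hSe, ht.eventually hPe, eventually_ge_atTop 3] with α h1 h2 h3 u hu
  have hlam := hlow α h3 u hu
  have hα : 0 < α := by linarith
  have hlogp : 0 < Real.log α := Real.log_pos (by linarith)
  set lam := lamStar D α with hlamdef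
  have hl : 0 < lam := lt_of_lt_of_le (by positivity) hlam
  have S := sol_of hu
  have hG := Gu S (by linarith) hl h1.le h2.le
  have hr1 : α ^ (-(1/4) : ℝ) ≤ 1 := Real.rpow_le_one_of_one_le_of_nonpos (by linarith) (by norm_num)
  have hr0 : 0 ≤ α ^ (-(1/4) : ℝ) := Real.rpow_nonneg hα.le _
  have hGK := Gg_le D hK (u (α ^ (-(1/2) : ℝ)))
  have hG0 := Gg_nonneg D (u_nonneg S ⟨hr0, hr1⟩)
  refine ⟨hl, ?_, ?_⟩
  · rw [div_le_div_iff₀ hα hlogp]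
    have : lam * c / α * (Real.log α / 4) ≤ K := by linarith
    have e : lam * Real.log α = (lam * c / α * (Real.log α / 4)) * (4 * α / c) := by field_simp
    rw [e]
    calc _ ≤ K * (4 * α / c) := mul_le_mul_of_nonneg_right this (by positivity)
      _ = _ := by ring
  · by_contra hcon
    have h5 := Gg_mono D (not_le.1 hcon)
    have h6 : c * κ / 4 ≤ lam * c / α * (Real.log α / 4) := by
      have e : c * κ / 4 = (κ * α / Real.log α) * (c / α * (Real.log α / 4)) := by field_simp
      rw [e]
      calc _ ≤ lam * (c / α * (Real.log α / 4)) := mul_le_mul_of_nonneg_right hlam (by positivity)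
        _ = _ := by ring
    linarith
end Pgsec

section Phsec
variable (D : GelfandData)
variable {D}

lemma H3a {α lam : ℝ} {u w : ℝ → ℝ} (S : Sol D α lam u w) (hα : 0 < α) (hl : 0 < lam)
    {ε U0 : ℝ} (hε : 0 < ε) (hε1 : ε ≤ 1 / 2) (hU : u (ε / 2) ≤ U0) :
    u ε ≤ (1 / ε) * ((4 * U0 / ε) * Real.exp (-(α * (Pe D ε * (7 * ε ^ 2 / 32))))
      + lam / α * fe D U0 * ∫ s in ε..1, D.M s) := by
  have hwn : ∀ r, 0 < r → r ≤ 1 → 0 ≤ w r := fun r h0 h1 => w_nonneg S hl.le h0 h1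
  set F0 := (ε / 2) * mE D α (ε / 2) * w (ε / 2) with hF0
  have hF0n : 0 ≤ F0 := mul_nonneg (mul_nonneg (by linarith) (mE_pos D α _).le)
    (hwn _ (by linarith) (by linarith))
  have iiw : ∀ a b : ℝ, 0 ≤ a → a ≤ b → b ≤ 1 → IntervalIntegrable w volume a b :=
    fun a b h1 h2 h3 => (S.wc.mono (Icc_subset_Icc h1 h3)).intervalIntegrable_of_Icc h2
  have hm1 := mE_pos D α (3 * ε / 4)
  have hm2 := mE_pos D α ε
  -- bound on F0
  have hF : F0 ≤ 4 * U0 / ε * mE D α (3 * ε / 4) := by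
    have h1 := u_sub S (a := ε / 2) (b := 3 * ε / 4) (by linarith) (by linarith) (by linarith)
    have h2 := u_nonneg S (r := 3 * ε / 4) ⟨by linarith, by linarith⟩
    have h3 : ∫ s in (ε / 2)..(3 * ε / 4), F0 / mE D α (3 * ε / 4) ≤
        ∫ s in (ε / 2)..(3 * ε / 4), w s := by
      refine intervalIntegral.integral_mono_on (by linarith) intervalIntegrable_const
        (iiw _ _ (by linarith) (by linarith) (by linarith)) ?_
      intro s hs
      have hs0 : 0 < s := by linarith [hs.1]
      have hs1 : s ≤ 1 := by linarith [hs.2]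
      rw [div_le_iff₀ hm1]
      have h4 := F_mono S hl.le (a := ε / 2) (b := s) (by linarith) hs.1 hs1
      have h5 : mE D α s ≤ mE D α (3 * ε / 4) := mE_mono D hα.le hs0.le (by
        simp only [mem_Ici]; linarith) hs.2
      have h6 := hwn s hs0 hs1
      calc F0 ≤ s * mE D α s * w s := h4
        _ ≤ 1 * mE D α (3 * ε / 4) * w s := by
          have := mE_pos D α s
          gcongr
        _ = _ := by ring
    rw [intervalIntegral.integral_const, smul_eq_mul] at h3
    have h7 : (3 * ε / 4 - ε / 2) * (F0 / mE D α (3 * ε / 4)) ≤ U0 := by linarith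
    have e : F0 = (4 / ε * mE D α (3 * ε / 4)) *
      ((3 * ε / 4 - ε / 2) * (F0 / mE D α (3 * ε / 4))) := by
      generalize mE D α (3 * ε / 4) = q at hm1
      field_simp; ring
    rw [e]
    calc _ ≤ (4 / ε * mE D α (3 * ε / 4)) * U0 := mul_le_mul_of_nonneg_left h7 (by positivity)
      _ = _ := by ring
  have hU0n : 0 ≤ U0 := (u_nonneg S (r := ε / 2) ⟨by linarith, by linarith⟩).trans hU
  have hrat := mE_ratio D (α := α) (a := 3 * ε / 4) (b := ε) (p := Pe D ε) hα.le (by linarith)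
    (by linarith) le_rfl
  have hF2 : F0 / mE D α ε ≤ 4 * U0 / ε * Real.exp (-(α * (Pe D ε * (7 * ε ^ 2 / 32)))) := by
    rw [div_le_iff₀ hm2]
    refine hF.trans ?_
    rw [mul_assoc]
    apply mul_le_mul_of_nonneg_left _ (by positivity)
    have h1 := mul_le_mul_of_nonneg_left hrat
      (Real.exp_pos (-(α * (Pe D ε * (7 * ε ^ 2 / 32))))).le
    refine le_trans (le_of_eq ?_) h1
    rw [mul_left_comm, ← Real.exp_add]
    rw [show -(α * (Pe D ε * (7 * ε ^ 2 / 32))) + α * Pe D ε * (ε ^ 2 - (3 * ε / 4) ^ 2) / 2 = 0 by ring]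
    simp
  have hMi : IntervalIntegrable D.M volume ε 1 := by
    apply (M_int' (D := D)).mono_set
    rw [uIcc_of_le (by linarith), uIcc_of_le zero_le_one]
    exact Icc_subset_Icc hε.le le_rfl
  have hw : ∀ s ∈ Ioo ε 1, w s ≤ 1 / ε * (F0 / mE D α ε + lam / α * fe D U0 * D.M s) := by
    intro s hs
    have hs0 : 0 < s := by linarith [hs.1]
    have h1 := F_sub S (a := ε / 2) (b := s) (by linarith) (by linarith [hs.1]) hs.2.le
    have h2 : ∫ t in (ε / 2)..s, lam * fe D (u t) * (Se D t * (t * mE D α t))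
        ≤ lam * fe D U0 * IS D α s := by
      have q1 : ∫ t in (ε / 2)..s, lam * fe D (u t) * (Se D t * (t * mE D α t)) ≤
          ∫ t in (ε / 2)..s, lam * fe D U0 * (Se D t * (t * mE D α t)) := by
        refine intervalIntegral.integral_mono_on (by linarith [hs.1])
          (((rhs_c S).mono (Icc_subset_Icc (by linarith) hs.2.le)).intervalIntegrable_of_Icc
            (by linarith [hs.1])) ((continuous_const.mul (Sm_cont D α)).intervalIntegrable _ _) ?_
        intro t ht
        apply mul_le_mul_of_nonneg_right _ (S_nonneg (by linarith [ht.1]))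
        apply mul_le_mul_of_nonneg_left _ hl.le
        apply fe_mono D
        refine le_trans (u_anti S hl.le ⟨by linarith, by linarith⟩ ⟨by linarith [ht.1], by linarith [ht.2, hs.2]⟩ ht.1) hU
      refine q1.trans ?_
      rw [intervalIntegral.integral_const_mul]
      apply mul_le_mul_of_nonneg_left _ (mul_nonneg hl.le (fe_pos D _).le)
      unfold IS
      rw [← intervalIntegral.integral_add_adjacent_intervals (a := 0) (b := ε / 2) (c := s)
        ((Sm_cont D α).intervalIntegrable _ _) ((Sm_cont D α).intervalIntegrable _ _)]
      have : 0 ≤ ∫ t in (0:ℝ)..(ε / 2), Se D t * (t * mE D α t) :=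
        intervalIntegral.integral_nonneg (by linarith) fun t ht => S_nonneg ht.1
      linarith
    have h3 := IS_le D hα (s := s) ⟨hs0.le, hs.2⟩
    have hMp := M_pos (D := D) (s := s) ⟨hs0.le, hs.2⟩
    have hms := mE_pos D α s
    have h4 : IS D α s ≤ D.M s * mE D α s / α := by
      refine h3.trans ?_
      apply div_le_div_of_nonneg_right _ hα.le
      apply mul_le_mul_of_nonneg_left _ (by linarith)
      linarith
    have hfU := fe_pos D U0
    have h5 : s * mE D α s * w s ≤ F0 + lam * fe D U0 * (D.M s * mE D α s / α) := by
      have := mul_le_mul_of_nonneg_left h4 (mul_nonneg hl.le hfU.le)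
      linarith
    have h6 : F0 ≤ F0 / mE D α ε * mE D α s := by
      have : mE D α ε ≤ mE D α s := mE_mono D hα.le hε.le hs0.le hs.1.le
      calc F0 = F0 / mE D α ε * mE D α ε := by field_simp
        _ ≤ _ := mul_le_mul_of_nonneg_left this (by positivity)
    have h7 : s * w s ≤ F0 / mE D α ε + lam / α * fe D U0 * D.M s := by
      refine le_of_mul_le_mul_right ?_ hms
      calc s * w s * mE D α s = s * mE D α s * w s := by ring
        _ ≤ _ := h5
        _ ≤ F0 / mE D α ε * mE D α s + lam * fe D U0 * (D.M s * mE D α s / α) := by linarith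
        _ = _ := by ring
    have h8 : ε * w s ≤ s * w s := mul_le_mul_of_nonneg_right hs.1.le (hwn s hs0 hs.2.le)
    rw [one_div_mul_eq_div, le_div_iff₀ hε]
    linarith
  have hu := u_sub S (a := ε) (b := 1) hε.le (by linarith) le_rfl
  rw [S.u1, sub_zero] at hu
  rw [hu]
  have hi : IntervalIntegrable (fun s => 1 / ε * (F0 / mE D α ε + lam / α * fe D U0 * D.M s))
      volume ε 1 := (intervalIntegrable_const.add (hMi.const_mul _)).const_mul _
  refine (intervalIntegral.integral_mono_on_of_le_Ioo (by linarith)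
    (iiw _ _ hε.le (by linarith) le_rfl) hi hw).trans ?_
  rw [intervalIntegral.integral_const_mul, intervalIntegral.integral_add intervalIntegrable_const
    (hMi.const_mul _), intervalIntegral.integral_const, intervalIntegral.integral_const_mul, smul_eq_mul]
  apply mul_le_mul_of_nonneg_left _ (by positivity)
  apply add_le_add _ le_rfl
  refine le_trans ?_ hF2
  have : 0 ≤ F0 / mE D α ε := by positivity
  nlinarith

lemma H3 {U0 CL : ℝ} (hev : ∀ᶠ α : ℝ in atTop, ∀ u,
    IsSolution D α (lamStar D α) u → 0 < lamStar D α ∧ lamStar D α / α ≤ CL / Real.log α ∧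
      u (α ^ (-(1/4) : ℝ)) ≤ U0) {ε η : ℝ} (hε : 0 < ε) (hε1 : ε ≤ 1 / 2) (hη : 0 < η) :
    ∀ᶠ α : ℝ in atTop, ∀ u, IsSolution D α (lamStar D α) u → u ε ≤ η := by
  set J := ∫ s in ε..1, D.M s with hJ
  have hP : 0 < Pe D ε := by
    rw [Pe_eq D ⟨hε.le, by linarith⟩]; exact D.phi_pos _ ⟨hε.le, by linarith⟩
  have hJn : 0 ≤ J := by
    rw [hJ, intervalIntegral.integral_of_le (by linarith), integral_Ioc_eq_integral_Ioo]
    apply setIntegral_nonneg measurableSet_Ioo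
    intro x hx
    have := M_pos (D := D) (s := x) ⟨by linarith [hx.1], hx.2⟩
    linarith
  have hB : Tendsto (fun α : ℝ => (1 / ε) * ((4 * U0 / ε) *
      Real.exp (-(α * (Pe D ε * (7 * ε ^ 2 / 32)))) + CL / Real.log α * fe D U0 * J)) atTop
      (nhds ((1 / ε) * ((4 * U0 / ε) * 0 + 0 * fe D U0 * J))) := by
    have h1 : Tendsto (fun α : ℝ => Real.exp (-(α * (Pe D ε * (7 * ε ^ 2 / 32))))) atTop (nhds 0) :=
      Real.tendsto_exp_neg_atTop_nhds_zero.comp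
        (tendsto_id.atTop_mul_const (show 0 < Pe D ε * (7 * ε ^ 2 / 32) by positivity))
    have h2 : Tendsto (fun α : ℝ => CL / Real.log α) atTop (nhds 0) :=
      tendsto_const_nhds.div_atTop Real.tendsto_log_atTop
    exact ((h1.const_mul _).add ((h2.mul_const _).mul_const _)).const_mul _
  have hB' := hB.eventually (gt_mem_nhds (show (1 / ε) * ((4 * U0 / ε) * 0 + 0 * fe D U0 * J) < η by
    simpa using hη))
  have hr := (tend_rpow (show (0:ℝ) < 1/4 by norm_num)).eventually
    (gt_mem_nhds (show 0 < ε / 2 by linarith))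
  filter_upwards [hev, hB', hr, eventually_gt_atTop 0] with α h1 h2 h3 hα u hu
  obtain ⟨hl, hlC, hU⟩ := h1 u hu
  have S := sol_of hu
  have hU2 : u (ε / 2) ≤ U0 :=
    (u_anti S hl.le ⟨Real.rpow_nonneg hα.le _, by linarith⟩ ⟨by linarith, by linarith⟩ h3.le).trans hU
  refine (H3a S hα hl hε hε1 hU2).trans (le_trans ?_ h2.le)
  have := fe_pos D U0
  gcongr

lemma final2 (D : GelfandData) {c0 c1 t0 : ℝ} (hc0 : c0 ∈ Ioo (0:ℝ) 1) (hc1 : 1 < c1)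
    (hf : ∀ t1 t2, t0 < t1 → t1 < t2 → c1 * fe D t1 ≤ fe D t2 →
      fd D t1 ≤ (1 - c0) * fd D t2) (p : ℝ) (hp : 1 ≤ p) (u : ℝ → ℝ → ℝ)
    (hu : ∀ᶠ α in atTop, IsSolution D α (lamStar D α) (u α) ∧
        IsSemistable D α (lamStar D α) (u α)) :
    Tendsto (fun α => ∫ r in Ioo (0:ℝ) 1, u α r ^ p * r) atTop (nhds 0) := by
  obtain ⟨c, hc, c', hc', α₀, hcore⟩ := core D hc0 hc1 hf
  obtain ⟨U0, hU0, CL, hCL, hev⟩ := H2 D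
  have hp0 : 0 < p := by linarith
  rw [Metric.tendsto_nhds]
  intro e he
  set ε := min (1 / 2) (e / (4 * U0 ^ p)) with hε
  have hUp : 0 < U0 ^ p := Real.rpow_pos_of_pos hU0 p
  have hε0 : 0 < ε := lt_min (by norm_num) (by positivity)
  have hε1 : ε ≤ 1 / 2 := min_le_left _ _
  have hε2 : U0 ^ p * ε ≤ e / 4 := by
    have : ε ≤ e / (4 * U0 ^ p) := min_le_right _ _
    rw [le_div_iff₀ (by positivity)] at this; linarith
  set η := min 1 (e / 4) with hη
  have hη0 : 0 < η := lt_min one_pos (by linarith)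
  have hη1 : η ^ p ≤ e / 4 := by
    calc η ^ p ≤ η ^ (1:ℝ) := Real.rpow_le_rpow_of_exponent_ge hη0 (min_le_left _ _) hp
      _ = η := Real.rpow_one _
      _ ≤ _ := min_le_right _ _
  have h3 := H3 hev hε0 hε1 hη0
  have hy : 0 < 1 / (8 * p) := by positivity
  have hAt : Tendsto (fun α : ℝ => α ^ (1 / (8 * p))) atTop atTop := tendsto_rpow_atTop hy
  have hlogA := hAt.eventually (fd_log D (c' * (8 * p)))
  have hsm : ∀ᶠ α : ℝ in atTop, c ^ p * α ^ (-(1/8) : ℝ) < e / 4 := by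
    have := (tend_rpow (show (0:ℝ) < 1/8 by norm_num)).const_mul (c ^ p)
    rw [mul_zero] at this
    exact this.eventually (gt_mem_nhds (by linarith))
  have hr := (tend_rpow (show (0:ℝ) < 1/4 by norm_num)).eventually (gt_mem_nhds hε0)
  filter_upwards [hu, hev, h3, hlogA, hsm, hr, hAt.eventually_ge_atTop t0,
    hAt.eventually_ge_atTop 1, eventually_ge_atTop α₀, eventually_gt_atTop 0] with
    α ⟨hsol, hst⟩ hev h3 hlogA hsm hr hA1 hA2 hα0 hα
  obtain ⟨hl, -, hUr⟩ := hev _ hsol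
  have h3 := h3 _ hsol
  have S := sol_of hsol
  have hanti := u_anti S hl.le
  set v := u α with hv
  rw [Real.log_rpow hα] at hlogA
  have hv0 : v 0 ≤ c * α ^ (1 / (8 * p)) := by
    refine hcore α hα0 v hsol hst _ hA1 hA2 (le_trans (le_of_eq ?_) hlogA)
    field_simp
  set r0 := α ^ (-(1/4) : ℝ) with hr0
  have hr0p : 0 < r0 := Real.rpow_pos_of_pos hα _
  have hcont : ContinuousOn (fun r => v r ^ p * r) (Icc 0 1) :=
    (S.uc.rpow_const (fun x _ => Or.inr hp0.le)).mul continuousOn_id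
  have ii : ∀ a b : ℝ, 0 ≤ a → a ≤ b → b ≤ 1 →
      IntervalIntegrable (fun r => v r ^ p * r) volume a b := fun a b h1 h2 h3 =>
    (hcont.mono (Icc_subset_Icc h1 h3)).intervalIntegrable_of_Icc h2
  have hbd : ∀ a b B : ℝ, 0 ≤ a → a ≤ b → b ≤ 1 → v a ≤ B →
      ∫ r in a..b, v r ^ p * r ≤ (b - a) * B ^ p := by
    intro a b B h1 h2 h3 h4
    rw [← smul_eq_mul, ← intervalIntegral.integral_const]
    refine intervalIntegral.integral_mono_on h2 (ii a b h1 h2 h3) intervalIntegrable_const ?_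
    intro r hr
    have hrm : r ∈ Icc (0:ℝ) 1 := ⟨h1.trans hr.1, hr.2.trans h3⟩
    have h5 : v r ≤ B := (hanti ⟨h1, h2.trans h3⟩ hrm hr.1).trans h4
    have h6 := u_nonneg S hrm
    have h7 : v r ^ p ≤ B ^ p := Real.rpow_le_rpow h6 h5 hp0.le
    have h8 : 0 ≤ v r ^ p := Real.rpow_nonneg h6 p
    nlinarith [hrm.1, hrm.2]
  have hI : ∫ r in Ioo (0:ℝ) 1, v r ^ p * r = ∫ r in (0:ℝ)..1, v r ^ p * r := by
    rw [intervalIntegral.integral_of_le zero_le_one, integral_Ioc_eq_integral_Ioo]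
  have hnn : 0 ≤ ∫ r in (0:ℝ)..1, v r ^ p * r :=
    intervalIntegral.integral_nonneg zero_le_one fun r hr =>
      mul_nonneg (Real.rpow_nonneg (u_nonneg S hr) p) hr.1
  rw [hI, Real.dist_eq, sub_zero, abs_of_nonneg hnn,
    ← intervalIntegral.integral_add_adjacent_intervals (ii 0 r0 le_rfl hr0p.le (by linarith))
      (ii r0 1 hr0p.le (by linarith) le_rfl),
    ← intervalIntegral.integral_add_adjacent_intervals (ii r0 ε hr0p.le hr.le (by linarith))
      (ii ε 1 hε0.le (by linarith) le_rfl)]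
  have b1 := hbd 0 r0 _ le_rfl hr0p.le (by linarith) hv0
  have b2 := hbd r0 ε U0 hr0p.le hr.le (by linarith) hUr
  have b3 := hbd ε 1 η hε0.le (by linarith) le_rfl h3
  have e1 : (r0 - 0) * (c * α ^ (1 / (8 * p))) ^ p = c ^ p * α ^ (-(1/8) : ℝ) := by
    rw [Real.mul_rpow hc.le (Real.rpow_nonneg hα.le _), ← Real.rpow_mul hα.le, sub_zero, hr0,
      mul_left_comm, ← Real.rpow_add hα]
    congr 2
    field_simp; norm_num
  rw [e1] at b1
  have b2' : (ε - r0) * U0 ^ p ≤ e / 4 := by nlinarith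
  have b3' : (1 - ε) * η ^ p ≤ e / 4 := by
    have := Real.rpow_nonneg hη0.le p
    nlinarith
  linarith

lemma final1 (D : GelfandData) {c0 c1 t0 : ℝ} (hc0 : c0 ∈ Ioo (0:ℝ) 1) (hc1 : 1 < c1)
    (hf : ∀ t1 t2, t0 < t1 → t1 < t2 → c1 * fe D t1 ≤ fe D t2 →
      fd D t1 ≤ (1 - c0) * fd D t2) :
    ∃ c > (0:ℝ), ∃ c' > (0:ℝ), ∃ α₀ : ℝ, ∀ α ≥ α₀, ∀ u : ℝ → ℝ,
      IsSolution D α (lamStar D α) u → IsSemistable D α (lamStar D α) u →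
      ∀ A > (0:ℝ), derivWithin D.f (Ici 0) A = c' * Real.log α → u 0 ≤ c * A := by
  obtain ⟨c, hc, c', hc', α₀, hcore⟩ := core D hc0 hc1 hf
  obtain ⟨α₁, hα₁⟩ := eventually_atTop.1
    (Real.tendsto_log_atTop.eventually_gt_atTop (fd D (max t0 1) / c'))
  refine ⟨c, hc, c', hc', max α₀ α₁, ?_⟩
  intro α hα u hsol hst A hA hAd
  rw [← fd_eq D hA.le] at hAd
  have h1 := hα₁ α ((le_max_right _ _).trans hα)
  rw [div_lt_iff₀ hc'] at h1
  have h2 : max t0 1 ≤ A := by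
    by_contra hcon
    have := fd_mono D (not_le.1 hcon).le
    linarith
  exact hcore α ((le_max_left _ _).trans hα) u hsol hst A ((le_max_left _ _).trans h2)
    ((le_max_right _ _).trans h2) hAd.ge

lemma hf_conv {c0 c1 t0 : ℝ} (ht0 : 0 < t0)
    (hf : ∀ t1 t2, t0 < t1 → t1 < t2 → c1 * D.f t1 ≤ D.f t2 →
      derivWithin D.f (Ici 0) t1 ≤ (1 - c0) * derivWithin D.f (Ici 0) t2) :
    ∀ t1 t2, t0 < t1 → t1 < t2 → c1 * fe D t1 ≤ fe D t2 →
      fd D t1 ≤ (1 - c0) * fd D t2 := by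
  intro t1 t2 h1 h2 h3
  rw [fe_eq D (by linarith), fe_eq D (by linarith)] at h3
  rw [fd_eq D (by linarith), fd_eq D (by linarith)]
  exact hf t1 t2 h1 h2 h3
end Phsec

end GB
end GBsec

/-- Under the regularity assumption on `f` (namely: `f(t₂) ≥ c₁ f(t₁)`
for `t₂ > t₁ > t₀` implies `(1 - c₀) f'(t₂) ≥ f'(t₁)`), there are `c, c' > 0` and `α₀`
such that for `α ≥ α₀` every semistable solution of `(P_{α, λ*(α)})` satisfies
`u(0) ≤ c · A` whenever `A > 0` solves `f'(A) = c' log α`; moreover for every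
`p ∈ [1,∞)`, semistable solutions `u_α` of `(P_{α, λ*(α)})` satisfy
`∫₀¹ u_α(r)^p r dr → 0` as `α → ∞`. -/
theorem extremal_bound_and_Lp (D : GelfandData) (c0 c1 t0 : ℝ)
    (hc0 : c0 ∈ Ioo (0:ℝ) 1) (hc1 : 1 < c1) (ht0 : 0 < t0)
    (hf : ∀ t1 t2, t0 < t1 → t1 < t2 → c1 * D.f t1 ≤ D.f t2 →
      derivWithin D.f (Ici 0) t1 ≤ (1 - c0) * derivWithin D.f (Ici 0) t2) :
    (∃ c > (0:ℝ), ∃ c' > (0:ℝ), ∃ α₀ : ℝ, ∀ α ≥ α₀, ∀ u : ℝ → ℝ,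
      IsSolution D α (lamStar D α) u → IsSemistable D α (lamStar D α) u →
      ∀ A > (0:ℝ), derivWithin D.f (Ici 0) A = c' * Real.log α → u 0 ≤ c * A) ∧
    (∀ p : ℝ, 1 ≤ p → ∀ u : ℝ → ℝ → ℝ,
      (∀ᶠ α in atTop, IsSolution D α (lamStar D α) (u α) ∧
        IsSemistable D α (lamStar D α) (u α)) →
      Tendsto (fun α => ∫ r in Ioo (0:ℝ) 1, u α r ^ p * r) atTop (nhds 0)) := by
  exact ⟨GB.final1 D hc0 hc1 (GB.hf_conv ht0 hf), GB.final2 D hc0 hc1 (GB.hf_conv ht0 hf)⟩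
end

section
/- Fix α > 0. If problem (P_{α,λ'}) admits a solution for some λ' > 0, then problem (P_{α,λ}) admits a solution for every λ ∈ (0, λ']. -/
open Set MeasureTheory Filter

open Set MeasureTheory Filter Topology

namespace GS

noncomputable def cl (r : ℝ) : ℝ := max 0 (min r 1)

lemma cl_mem (r : ℝ) : cl r ∈ Icc (0:ℝ) 1 :=
  ⟨le_max_left _ _, max_le zero_le_one (min_le_right _ _)⟩

lemma cl_eq {r : ℝ} (h : r ∈ Icc (0:ℝ) 1) : cl r = r := by
  unfold cl; rw [min_eq_left h.2, max_eq_right h.1]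

lemma cl_mono : Monotone cl := fun a b h => by
  unfold cl; gcongr

lemma cl_cont : Continuous cl := by unfold cl; fun_prop

noncomputable def mu (φ : ℝ → ℝ) (α r : ℝ) : ℝ := Real.exp (α * ∫ s in (0:ℝ)..r, s * φ s)

lemma mu_pos (φ : ℝ → ℝ) (α r : ℝ) : 0 < mu φ α r := Real.exp_pos _

lemma mu_deriv {φ : ℝ → ℝ} (hφ : Continuous φ) (α r : ℝ) :
    HasDerivAt (mu φ α) (mu φ α r * (α * (r * φ r))) r := by
  have hc : Continuous (fun s => s * φ s) := by fun_prop
  have := (intervalIntegral.integral_hasDerivAt_right (hc.intervalIntegrable 0 r)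
    (hc.stronglyMeasurableAtFilter _ _) hc.continuousAt)
  exact (this.const_mul α).exp

lemma mu_cont {φ : ℝ → ℝ} (hφ : Continuous φ) (α : ℝ) : Continuous (mu φ α) :=
  continuous_iff_continuousAt.2 fun r => (mu_deriv hφ α r).continuousAt

/-- integrand -/
noncomputable def ig (φ ψ f : ℝ → ℝ) (α : ℝ) (v : ℝ → ℝ) (s : ℝ) : ℝ :=
  s * mu φ α s * ψ s * f (v s)

noncomputable def G (φ ψ f : ℝ → ℝ) (α : ℝ) (v : ℝ → ℝ) (t : ℝ) : ℝ :=
  ∫ s in (0:ℝ)..t, ig φ ψ f α v s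

noncomputable def g (φ ψ f : ℝ → ℝ) (α : ℝ) (v : ℝ → ℝ) (t : ℝ) : ℝ :=
  G φ ψ f α v t / (t * mu φ α t)

section
variable {φ ψ f : ℝ → ℝ} {α : ℝ} {v : ℝ → ℝ}

lemma ig_int (hφ : Continuous φ) (hψ : Continuous ψ) (hf : Monotone f) (hv : Antitone v)
    (a b : ℝ) : IntervalIntegrable (ig φ ψ f α v) volume a b := by
  have h1 : Antitone (fun s => f (v s)) := fun x y h => hf (hv h)
  have h2 : Continuous (fun s => s * mu φ α s * ψ s) := by
    have := mu_cont hφ α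
    fun_prop
  exact h1.intervalIntegrable.continuousOn_mul h2.continuousOn

lemma ig_nonneg (hψ0 : ∀ s, 0 ≤ ψ s) (hf0 : ∀ s, 0 < f s) {s : ℝ} (hs : 0 ≤ s) :
    0 ≤ ig φ ψ f α v s := by
  have := mu_pos φ α s
  have := hψ0 s
  have := hf0 (v s)
  unfold ig; positivity

lemma G_nonneg (hψ0 : ∀ s, 0 ≤ ψ s) (hf0 : ∀ s, 0 < f s) {t : ℝ} (ht : 0 ≤ t) :
    0 ≤ G φ ψ f α v t :=
  intervalIntegral.integral_nonneg ht fun s hs => ig_nonneg hψ0 hf0 hs.1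

lemma g_nonneg (hψ0 : ∀ s, 0 ≤ ψ s) (hf0 : ∀ s, 0 < f s) {t : ℝ} (ht : 0 ≤ t) :
    0 ≤ g φ ψ f α v t :=
  div_nonneg (G_nonneg hψ0 hf0 ht) (mul_nonneg ht (mu_pos _ _ _).le)

lemma ig_mono (hψ0 : ∀ s, 0 ≤ ψ s) (hf : Monotone f) {w : ℝ → ℝ} {s : ℝ} (h : v s ≤ w s)
    (hs : 0 ≤ s) : ig φ ψ f α v s ≤ ig φ ψ f α w s := by
  have := mu_pos φ α s
  have := hψ0 s
  have := hf h
  unfold ig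
  gcongr

lemma G_mono (hφ : Continuous φ) (hψ : Continuous ψ) (hf : Monotone f) (hψ0 : ∀ s, 0 ≤ ψ s)
    (hv : Antitone v) {w : ℝ → ℝ} (hw : Antitone w) (h : ∀ s, v s ≤ w s) {t : ℝ} (ht : 0 ≤ t) :
    G φ ψ f α v t ≤ G φ ψ f α w t :=
  intervalIntegral.integral_mono_on ht (ig_int hφ hψ hf hv _ _) (ig_int hφ hψ hf hw _ _)
    fun s hs => ig_mono hψ0 hf (h s) hs.1

lemma g_mono (hφ : Continuous φ) (hψ : Continuous ψ) (hf : Monotone f) (hψ0 : ∀ s, 0 ≤ ψ s)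
    (hv : Antitone v) {w : ℝ → ℝ} (hw : Antitone w) (h : ∀ s, v s ≤ w s) {t : ℝ} (ht : 0 ≤ t) :
    g φ ψ f α v t ≤ g φ ψ f α w t :=
  div_le_div_of_nonneg_right (G_mono hφ hψ hf hψ0 hv hw h ht)
    (mul_nonneg ht (mu_pos _ _ _).le)

lemma G_cont (hφ : Continuous φ) (hψ : Continuous ψ) (hf : Monotone f) (hv : Antitone v) :
    Continuous (G φ ψ f α v) :=
  intervalIntegral.continuous_primitive (fun a b => ig_int hφ hψ hf hv a b) 0

lemma ig_cont0 (hφ : Continuous φ) (hψ : Continuous ψ) (hf : Monotone f) (hv : Antitone v)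
    (hf0 : ∀ s, 0 < f s) : ContinuousAt (ig φ ψ f α v) 0 := by
  have h2 : Continuous (fun s => s * mu φ α s * ψ s) := by
    have := mu_cont hφ α
    fun_prop
  have h3 : Tendsto (fun s => s * mu φ α s * ψ s) (𝓝 0) (𝓝 0) := by
    have := h2.tendsto 0
    simpa using this
  have h4 : ig φ ψ f α v 0 = 0 := by simp [ig]
  rw [ContinuousAt, h4]
  refine h3.zero_mul_isBoundedUnder_le ?_
  refine isBoundedUnder_of_eventually_le (a := f (v (-1))) ?_
  filter_upwards [Ioi_mem_nhds (show (-1:ℝ) < 0 by norm_num)] with s hs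
  simp only [Function.comp, Real.norm_eq_abs, abs_of_pos (hf0 _)]
  exact hf (hv (le_of_lt hs))

lemma G_deriv0 (hφ : Continuous φ) (hψ : Continuous ψ) (hf : Monotone f) (hv : Antitone v)
    (hf0 : ∀ s, 0 < f s) : HasDerivAt (G φ ψ f α v) 0 0 := by
  have hm : StronglyMeasurable (ig φ ψ f α v) := by
    have h1 : Antitone (fun s => f (v s)) := fun x y h => hf (hv h)
    have h2 : Continuous (fun s => s * mu φ α s * ψ s) := by
      have := mu_cont hφ α
      fun_prop
    exact (h2.measurable.mul h1.measurable).stronglyMeasurable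
  have := intervalIntegral.integral_hasDerivAt_right (ig_int (α := α) hφ hψ hf hv 0 0)
    (hm.stronglyMeasurableAtFilter) (ig_cont0 hφ hψ hf hv hf0)
  have h4 : ig φ ψ f α v 0 = 0 := by simp [ig]
  rw [h4] at this
  exact this

lemma g_cont (hφ : Continuous φ) (hψ : Continuous ψ) (hf : Monotone f) (hv : Antitone v)
    (hf0 : ∀ s, 0 < f s) : Continuous (g φ ψ f α v) := by
  rw [continuous_iff_continuousAt]
  intro t
  by_cases ht : t = 0
  · subst ht
    have h := (G_deriv0 (α := α) hφ hψ hf hv hf0)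
    rw [hasDerivAt_iff_tendsto_slope] at h
    have h0 : g φ ψ f α v 0 = 0 := by simp [g]
    rw [continuousAt_iff_punctured_nhds, h0]
    have h5 : Tendsto (fun t => (mu φ α t)⁻¹) (𝓝[≠] 0) (𝓝 (mu φ α 0)⁻¹) :=
      (((mu_cont hφ α).tendsto 0).inv₀ (mu_pos _ _ _).ne').mono_left nhdsWithin_le_nhds
    have h6 := h.mul h5
    rw [zero_mul] at h6
    refine h6.congr fun t => ?_
    have hG0 : G φ ψ f α v 0 = 0 := by simp [G]
    simp only [slope, g, hG0, sub_zero, vsub_eq_sub, smul_eq_mul]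
    rw [div_eq_mul_inv, mul_inv]; ring
  · exact (G_cont hφ hψ hf hv).continuousAt.div
      (continuousAt_id.mul (mu_cont hφ α).continuousAt) (mul_ne_zero ht (mu_pos _ _ _).ne')

noncomputable def T (φ ψ f : ℝ → ℝ) (α lam : ℝ) (v : ℝ → ℝ) (r : ℝ) : ℝ :=
  lam * ∫ t in (cl r)..1, g φ ψ f α v t

/-- Tarski fixed point -/
lemma exists_fix (hφ : Continuous φ) (hψ : Continuous ψ) (hf : Monotone f)
    (hf0 : ∀ s, 0 < f s) (hψ0 : ∀ s, 0 ≤ ψ s) {lam : ℝ} (hl : 0 < lam)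
    {b : ℝ → ℝ} (hb : Antitone b) (hb0 : ∀ r, 0 ≤ b r)
    (hTb : ∀ r, T φ ψ f α lam b r ≤ b r) :
    ∃ u : ℝ → ℝ, Antitone u ∧ ∀ r, u r = T φ ψ f α lam u r := by
  have hgi : ∀ {v : ℝ → ℝ}, Antitone v → ∀ a c, IntervalIntegrable (g φ ψ f α v) volume a c :=
    fun hv a c => (g_cont hφ hψ hf hv hf0).intervalIntegrable a c
  have Tnn : ∀ {v : ℝ → ℝ}, ∀ r, 0 ≤ T φ ψ f α lam v r := fun r =>
    mul_nonneg hl.le (intervalIntegral.integral_nonneg (cl_mem r).2 fun t ht =>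
      g_nonneg hψ0 hf0 ((cl_mem r).1.trans ht.1))
  have Tanti : ∀ {v : ℝ → ℝ}, Antitone v → Antitone (T φ ψ f α lam v) := by
    intro v hv x y h
    have h1 := intervalIntegral.integral_add_adjacent_intervals (hgi hv (cl x) (cl y))
      (hgi hv (cl y) 1)
    have h2 : 0 ≤ ∫ t in (cl x)..(cl y), g φ ψ f α v t :=
      intervalIntegral.integral_nonneg (cl_mono h) fun t ht =>
        g_nonneg hψ0 hf0 ((cl_mem x).1.trans ht.1)
    unfold T
    gcongr
    linarith
  have Tmono : ∀ {v w : ℝ → ℝ}, Antitone v → Antitone w → (∀ r, v r ≤ w r) →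
      ∀ r, T φ ψ f α lam v r ≤ T φ ψ f α lam w r := by
    intro v w hv hw h r
    refine mul_le_mul_of_nonneg_left ?_ hl.le
    exact intervalIntegral.integral_mono_on (cl_mem r).2 (hgi hv _ _) (hgi hw _ _)
      fun t ht => g_mono hφ hψ hf hψ0 hv hw h ((cl_mem r).1.trans ht.1)
  let S : Set (ℝ → ℝ) := {v | Antitone v ∧ (∀ r, v r ≤ b r) ∧ ∀ r, v r ≤ T φ ψ f α lam v r}
  have hS0 : (fun _ => (0:ℝ)) ∈ S := ⟨antitone_const, hb0, fun r => Tnn r⟩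
  have : Nonempty S := ⟨⟨_, hS0⟩⟩
  let u : ℝ → ℝ := fun r => ⨆ v : S, v.1 r
  have hbdd : ∀ r, BddAbove (range fun v : S => v.1 r) := fun r =>
    ⟨b r, by rintro _ ⟨v, rfl⟩; exact v.2.2.1 r⟩
  have hle : ∀ v ∈ S, ∀ r, v r ≤ u r := fun v hv r => le_ciSup (hbdd r) (⟨v, hv⟩ : S)
  have hua : Antitone u := fun x y h => ciSup_mono (hbdd x) fun v => v.2.1 h
  have hub : ∀ r, u r ≤ b r := fun r => ciSup_le fun v => v.2.2.1 r
  have huT : ∀ r, u r ≤ T φ ψ f α lam u r := fun r => ciSup_le fun v =>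
    (v.2.2.2 r).trans (Tmono v.2.1 hua (hle v.1 v.2) r)
  refine ⟨u, hua, fun r => le_antisymm (huT r) (hle _ ?_ r)⟩
  exact ⟨Tanti hua, fun r => (Tmono hua hb hub r).trans (hTb r), Tmono hua (Tanti hua) huT⟩

end

end GS

open GS
theorem solvable_below (D : GelfandData) (α : ℝ) (hα : 0 < α)
    (lam' : ℝ) (hlam' : 0 < lam') (h : ∃ u, IsSolution D α lam' u) :
    ∀ lam : ℝ, 0 < lam → lam ≤ lam' → ∃ u, IsSolution D α lam u := by
  intro lam hl hle
  obtain ⟨ub, hC1, hC2, hpos, hd0, h1, hode⟩ := h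
  obtain ⟨φ, hφd⟩ : ∃ φ : ℝ → ℝ, φ = fun r => D.phi (cl r) := ⟨_, rfl⟩
  obtain ⟨ψ, hψd⟩ : ∃ ψ : ℝ → ℝ, ψ = fun r => D.psi (cl r) := ⟨_, rfl⟩
  obtain ⟨f, hfd⟩ : ∃ f : ℝ → ℝ, f = fun r => D.f (max 0 r) := ⟨_, rfl⟩
  have hφe : ∀ r ∈ Icc (0:ℝ) 1, φ r = D.phi r := fun r hr => by simp [hφd, cl_eq hr]
  have hψe : ∀ r ∈ Icc (0:ℝ) 1, ψ r = D.psi r := fun r hr => by simp [hψd, cl_eq hr]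
  have hfe : ∀ r, 0 ≤ r → f r = D.f r := fun r hr => by simp [hfd, hr]
  have hφ : Continuous φ := by
    obtain ⟨L, hL⟩ := D.phi_lip
    rw [hφd]; exact hL.continuousOn.comp_continuous cl_cont cl_mem
  have hψ : Continuous ψ := by
    obtain ⟨L, hL⟩ := D.psi_lip
    rw [hψd]; exact hL.continuousOn.comp_continuous cl_cont cl_mem
  have hfc : Continuous f := by
    rw [hfd]; exact D.f_smooth.continuousOn.comp_continuous (by fun_prop) fun x => le_max_left 0 x
  have hf : Monotone f := fun x y h => by
    rw [hfd]; exact D.f_mono (le_max_left 0 x) (le_max_left 0 y) (max_le_max le_rfl h)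
  have hf0 : ∀ s, 0 < f s := fun s => by rw [hfd]; exact D.f_pos _ (le_max_left 0 s)
  have hψ0 : ∀ s, 0 ≤ ψ s := fun s => by rw [hψd]; exact D.psi_nonneg _ (cl_mem s)
  have hub0 : ∀ r ∈ Icc (0:ℝ) 1, 0 ≤ ub r := fun r hr => by
    rcases hr.2.lt_or_eq with h | h
    · exact (hpos r ⟨hr.1, h⟩).le
    · rw [h, h1]
  obtain ⟨b, hbd⟩ : ∃ b : ℝ → ℝ, b = fun r => ub (cl r) := ⟨_, rfl⟩
  have hbe : ∀ r ∈ Icc (0:ℝ) 1, b r = ub r := fun r hr => by simp [hbd, cl_eq hr]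
  have hb0 : ∀ r, 0 ≤ b r := fun r => by rw [hbd]; exact hub0 _ (cl_mem r)
  have hbc : Continuous b := by rw [hbd]; exact hC1.continuousOn.comp_continuous cl_cont cl_mem
  -- derivative of ub
  obtain ⟨p, hp⟩ : ∃ p, p = derivWithin ub (Icc 0 1) := ⟨_, rfl⟩
  rw [← hp] at hd0 hode
  have hpc : ContinuousOn p (Icc 0 1) := by
    rw [hp]; exact hC1.continuousOn_derivWithin (uniqueDiffOn_Icc zero_lt_one) le_rfl
  have hpd : ∀ r ∈ Ioo (0:ℝ) 1, HasDerivAt ub (p r) r := fun r hr => by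
    have hm : Icc (0:ℝ) 1 ∈ 𝓝 r := Icc_mem_nhds hr.1 hr.2
    rw [hp]
    exact ((hC1.differentiableOn one_ne_zero r (Ioo_subset_Icc_self hr)).hasDerivWithinAt).hasDerivAt hm
  have hpd2 : ∀ r ∈ Ioo (0:ℝ) 1, HasDerivAt p (derivWithin p (Ioo 0 1) r) r := fun r hr => by
    have hm : Ioo (0:ℝ) 1 ∈ 𝓝 r := Ioo_mem_nhds hr.1 hr.2
    have h2 : ContDiffOn ℝ (1+1) ub (Ioo 0 1) := by
      have : (1 + 1 : WithTop ℕ∞) = 2 := by norm_num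
      rw [this]; exact hC2
    rw [contDiffOn_succ_iff_deriv_of_isOpen isOpen_Ioo] at h2
    have h3 : DifferentiableOn ℝ p (Ioo 0 1) :=
      (h2.2.2.differentiableOn one_ne_zero).congr fun x hx => ((hpd x hx).deriv).symm
    exact (h3 r hr).hasDerivWithinAt.hasDerivAt hm
  have higc : Continuous (ig φ ψ f α b) := by
    have := mu_cont hφ α
    unfold ig; fun_prop
  have hpg : ∀ t ∈ Ioo (0:ℝ) 1, p t = - lam' * g φ ψ f α b t := by
    intro t ht
    have hμ := mu_cont hφ α
    have key : ∫ s in (0:ℝ)..t, (-lam' * ig φ ψ f α b s) =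
        t * mu φ α t * p t - 0 * mu φ α 0 * p 0 := by
      refine intervalIntegral.integral_eq_sub_of_hasDerivAt_of_le ht.1.le
        (f := fun r => r * mu φ α r * p r) ?_ ?_ ((higc.const_mul _).intervalIntegrable _ _)
      · exact (continuous_id.mul hμ).continuousOn.mul
          (hpc.mono (Icc_subset_Icc le_rfl ht.2.le))
      · intro r hr
        have hr' : r ∈ Ioo (0:ℝ) 1 := ⟨hr.1, hr.2.trans ht.2⟩
        have hrI := Ioo_subset_Icc_self hr'
        have hd := ((hasDerivAt_id r).mul (mu_deriv hφ α r)).mul (hpd2 r hr')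
        refine hd.congr_deriv ?_
        have ho := hode r hr'
        have hr0 : r ≠ 0 := hr.1.ne'
        simp only [ig, hψe r hrI, hbe r hrI, hfe _ (hub0 r hrI), id, hφe r hrI, Pi.mul_apply]
        have : -lam' * (r * mu φ α r * D.psi r * D.f (ub r)) =
          - (r * mu φ α r) * (lam' * D.psi r * D.f (ub r)) := by ring
        rw [this, ← ho]
        field_simp
        ring
    rw [intervalIntegral.integral_const_mul] at key
    have hne : t * mu φ α t ≠ 0 := mul_ne_zero ht.1.ne' (mu_pos _ _ _).ne'
    unfold g G
    rw [← mul_div_assoc, eq_div_iff hne]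
    linarith
  have hba : Antitone b := by
    have : AntitoneOn ub (Icc 0 1) := by
      refine antitoneOn_of_deriv_nonpos (convex_Icc 0 1) hC1.continuousOn ?_ ?_
      · rw [interior_Icc]; exact fun r hr => (hpd r hr).differentiableAt.differentiableWithinAt
      · rw [interior_Icc]; intro r hr
        rw [(hpd r hr).deriv, hpg r hr]
        have := g_nonneg (φ := φ) (α := α) (v := b) hψ0 hf0 hr.1.le
        nlinarith
    rw [hbd]
    exact fun x y h => this (cl_mem x) (cl_mem y) (cl_mono h)
  have hTb : ∀ r, T φ ψ f α lam b r ≤ b r := by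
    intro r
    have hg := g_cont (α := α) hφ hψ hf hba hf0
    have hr := cl_mem r
    have key : ∫ s in (cl r)..1, (-lam' * g φ ψ f α b s) = ub 1 - ub (cl r) := by
      refine intervalIntegral.integral_eq_sub_of_hasDerivAt_of_le hr.2
        (hC1.continuousOn.mono (Icc_subset_Icc hr.1 le_rfl)) ?_
        ((hg.const_mul _).intervalIntegrable _ _)
      intro x hx
      have hx' : x ∈ Ioo (0:ℝ) 1 := ⟨hr.1.trans_lt hx.1, hx.2⟩
      rw [← hpg x hx']; exact hpd x hx'
    rw [intervalIntegral.integral_const_mul, h1] at key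
    have hnn : 0 ≤ ∫ s in (cl r)..1, g φ ψ f α b s :=
      intervalIntegral.integral_nonneg hr.2 fun t ht => g_nonneg hψ0 hf0 (hr.1.trans ht.1)
    have : b r = lam' * ∫ s in (cl r)..1, g φ ψ f α b s := by
      simp only [hbd] at key ⊢; linarith
    rw [this]
    exact mul_le_mul_of_nonneg_right hle hnn
  obtain ⟨u, hua, hu⟩ := exists_fix hφ hψ hf hf0 hψ0 hl hba hb0 hTb
  have hg := g_cont (α := α) hφ hψ hf hua hf0
  obtain ⟨U, hU⟩ : ∃ U : ℝ → ℝ, U = fun r => lam * ∫ t in r..1, g φ ψ f α u t := ⟨_, rfl⟩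
  have hUu : ∀ r ∈ Icc (0:ℝ) 1, u r = U r := fun r hr => by
    rw [hu r, hU, T, cl_eq hr]
  have hUd : ∀ r, HasDerivAt U (-lam * g φ ψ f α u r) r := fun r => by
    rw [hU]
    have := (intervalIntegral.integral_hasDerivAt_left (hg.intervalIntegrable r 1)
      (hg.stronglyMeasurableAtFilter _ _) hg.continuousAt).const_mul lam
    exact this.congr_deriv (by ring)
  have hUdw : ∀ r ∈ Icc (0:ℝ) 1, derivWithin U (Icc 0 1) r = -lam * g φ ψ f α u r := fun r hr =>
    (hUd r).hasDerivWithinAt.derivWithin (uniqueDiffOn_Icc zero_lt_one r hr)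
  have hUderiv : deriv U = fun r => -lam * g φ ψ f α u r := funext fun r => (hUd r).deriv
  have hUcont : Continuous U := continuous_iff_continuousAt.2 fun r => (hUd r).continuousAt
  have hucont : Continuous u := by
    have : u = fun r => U (cl r) := funext fun r => by rw [hu r, hU, T]
    rw [this]; exact hUcont.comp cl_cont
  have hiuc : Continuous (ig φ ψ f α u) := by
    have := mu_cont hφ α
    unfold ig; fun_prop
  have hGd : ∀ r, HasDerivAt (G φ ψ f α u) (ig φ ψ f α u r) r := fun r =>
    intervalIntegral.integral_hasDerivAt_right (hiuc.intervalIntegrable 0 r)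
      (hiuc.stronglyMeasurableAtFilter _ _) hiuc.continuousAt
  have hGC : ContDiff ℝ 1 (G φ ψ f α u) := contDiff_one_iff_deriv.2
    ⟨fun r => (hGd r).differentiableAt, by rwa [funext fun r => (hGd r).deriv]⟩
  have hμC : ContDiff ℝ 1 (mu φ α) := contDiff_one_iff_deriv.2
    ⟨fun r => (mu_deriv hφ α r).differentiableAt, by
      rw [funext fun r => (mu_deriv hφ α r).deriv]
      have := mu_cont hφ α
      fun_prop⟩
  have hgC : ContDiffOn ℝ 1 (g φ ψ f α u) (Ioo 0 1) :=
    hGC.contDiffOn.div (contDiff_id.mul hμC).contDiffOn fun x hx =>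
      mul_ne_zero hx.1.ne' (mu_pos _ _ _).ne'
  have hGpos : ∀ t, 0 < t → 0 < G φ ψ f α u t := by
    intro t ht
    have hψ1 : 0 < ψ 0 := by rw [hψe 0 (by simp), D.psi_zero]; exact one_pos
    obtain ⟨ε, hε, hball⟩ := Metric.eventually_nhds_iff.1 (hψ.continuousAt.eventually (lt_mem_nhds hψ1))
    have hig0 : ∀ s, 0 ≤ s → 0 ≤ ig φ ψ f α u s := fun s hs => ig_nonneg hψ0 hf0 hs
    refine intervalIntegral.integral_pos ht hiuc.continuousOn (fun x hx => hig0 x hx.1.le) ?_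
    have hm : 0 < min t (ε/2) := lt_min ht (by linarith)
    refine ⟨min t (ε/2), ⟨hm.le, min_le_left _ _⟩, ?_⟩
    have hψm : 0 < ψ (min t (ε/2)) := hball (by
      rw [Real.dist_eq, sub_zero, abs_of_pos hm]
      exact (min_le_right _ _).trans_lt (by linarith))
    have := mu_pos φ α (min t (ε/2))
    have := hf0 (u (min t (ε/2)))
    unfold ig; positivity
  have hgpos : ∀ t, 0 < t → 0 < g φ ψ f α u t := fun t ht =>
    div_pos (hGpos t ht) (mul_pos ht (mu_pos _ _ _))
  have hUpos : ∀ r ∈ Ico (0:ℝ) 1, 0 < U r := fun r hr => by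
    rw [hU]
    exact mul_pos hl (intervalIntegral.intervalIntegral_pos_of_pos_on (hg.intervalIntegrable _ _)
      (fun x hx => hgpos x (hr.1.trans_lt hx.1)) hr.2)
  refine ⟨U, ?_, ?_, hUpos, ?_, ?_, ?_⟩
  · exact (contDiff_one_iff_deriv.2 ⟨fun r => (hUd r).differentiableAt, by
      rw [hUderiv]; exact hg.const_mul _⟩).contDiffOn
  · have : (2 : WithTop ℕ∞) = 1 + 1 := by norm_num
    rw [this, contDiffOn_succ_iff_deriv_of_isOpen isOpen_Ioo]
    refine ⟨fun r _ => (hUd r).differentiableAt.differentiableWithinAt, by simp, ?_⟩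
    rw [hUderiv]
    exact contDiffOn_const.mul hgC
  · rw [hUdw 0 (by simp)]; simp [g]
  · simp [hU]
  · intro r hr
    have hrI := Ioo_subset_Icc_self hr
    have hr0 : r ≠ 0 := hr.1.ne'
    have hμ0 : mu φ α r ≠ 0 := (mu_pos _ _ _).ne'
    have hgd := ((hGd r).div ((hasDerivAt_id r).mul (mu_deriv hφ α r))
      (mul_ne_zero hr0 hμ0)).const_mul (-lam)
    have h2 : HasDerivWithinAt (derivWithin U (Icc 0 1)) _ (Ioo 0 1) r :=
      hgd.hasDerivWithinAt.congr (fun x hx => hUdw x (Ioo_subset_Icc_self hx)) (hUdw r hrI)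
    rw [h2.derivWithin (uniqueDiffOn_Ioo 0 1 r hr), hUdw r hrI]
    have hUr : 0 ≤ U r := (hUpos r ⟨hr.1.le, hr.2⟩).le
    simp only [ig, g, hψe r hrI, hφe r hrI, hUu r hrI, hfe _ hUr, id, Pi.mul_apply]
    field_simp
    ring
end

section
/- For every fixed α > 0, the set S_α := { λ > 0 : problem (P_{α,λ}) admits a solution } is nonempty and bounded above; consequently λ*(α) := sup S_α satisfies 0 < λ*(α) < ∞. -/
open Set MeasureTheory Filter

lemma aux_psi_half (D : GelfandData) : ∃ δ : ℝ, 0 < δ ∧ δ < 1 ∧ ∀ r ∈ Icc (0:ℝ) δ, 1/2 ≤ D.psi r := by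
  obtain ⟨L, hL⟩ := D.psi_lip
  refine ⟨1 / (2 * (L + 1)), by positivity, ?_, ?_⟩
  · rw [div_lt_one (by positivity)]
    have : (0:ℝ) ≤ L := L.2
    linarith
  · intro r hr
    have hL0 : (0:ℝ) ≤ L := L.2
    have h1 : 1 / (2 * ((L:ℝ) + 1)) ≤ 1 := by
      rw [div_le_one (by positivity)]; linarith
    have h2 := hL.dist_le_mul r ⟨hr.1, hr.2.trans h1⟩ 0 ⟨le_rfl, zero_le_one⟩
    rw [D.psi_zero, Real.dist_eq, Real.dist_eq, sub_zero, abs_of_nonneg hr.1] at h2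
    have h3 := (abs_le.1 h2).1
    have h4 : (L:ℝ) * r ≤ 1/2 := by
      have := hr.2
      rw [le_div_iff₀ (by positivity)] at this
      nlinarith [hr.1]
    linarith

lemma aux_ext_cont {g : ℝ → ℝ} (hg : ContinuousOn g (Icc 0 1)) :
    Continuous (fun t => g (projIcc (0:ℝ) 1 zero_le_one t)) :=
  hg.comp_continuous (continuous_subtype_val.comp continuous_projIcc) (fun t => (projIcc (0:ℝ) 1 zero_le_one t).2)

lemma aux_mu (D : GelfandData) (α : ℝ) (hα : 0 < α) : ∃ m : ℝ → ℝ, ContDiff ℝ 1 m ∧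
    (∀ r ∈ Icc (0:ℝ) 1, HasDerivAt m (m r * (α * r * D.phi r)) r) ∧ (∀ r, 0 < m r) ∧
    (∀ r ∈ Icc (0:ℝ) 1, 1 ≤ m r ∧ m r ≤ Real.exp α) := by
  set p : ℝ → ℝ := fun t => D.phi (projIcc (0:ℝ) 1 zero_le_one t) with hp
  have hpc : Continuous p := aux_ext_cont D.phi_lip.choose_spec.continuousOn
  have hp0 : ∀ t, 0 ≤ p t := fun t => D.phi_nonneg _ (projIcc (0:ℝ) 1 zero_le_one t).2
  have hp1 : ∀ t, p t ≤ 1 := fun t => by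
    rw [← D.phi_zero]
    exact D.phi_anti ⟨le_rfl, zero_le_one⟩ (projIcc (0:ℝ) 1 zero_le_one t).2
      (projIcc (0:ℝ) 1 zero_le_one t).2.1
  have hpe : ∀ t ∈ Icc (0:ℝ) 1, p t = D.phi t := fun t ht => by
    simp only [hp]; rw [projIcc_of_mem zero_le_one ht]
  set A : ℝ → ℝ := fun r => ∫ s in (0:ℝ)..r, s * p s with hA
  have hAd : ∀ r, HasDerivAt A (r * p r) r := fun r =>
    ((continuous_id.mul hpc).integral_hasStrictDerivAt 0 r).hasDerivAt
  have hmd : ∀ r, HasDerivAt (fun r => Real.exp (α * A r)) (Real.exp (α * A r) * (α * (r * p r))) r :=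
    fun r => ((hAd r).const_mul α).exp
  refine ⟨fun r => Real.exp (α * A r), ?_, ?_, fun r => Real.exp_pos _, ?_⟩
  · have hAc : ContDiff ℝ 1 A := by
      rw [contDiff_one_iff_deriv]
      refine ⟨fun r => (hAd r).differentiableAt, ?_⟩
      rw [show deriv A = fun r => r * p r from funext fun r => (hAd r).deriv]
      exact continuous_id.mul hpc
    exact (contDiff_const.mul hAc).exp
  · intro r hr
    have := hmd r
    rw [hpe r hr, ← mul_assoc α] at this
    exact this
  · intro r hr
    have h0 : 0 ≤ A r := intervalIntegral.integral_nonneg hr.1 fun x hx => mul_nonneg hx.1 (hp0 x)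
    have h1 : A r ≤ 1 := by
      have := intervalIntegral.norm_integral_le_of_norm_le_const (a := 0) (b := r) (C := 1)
        (f := fun s => s * p s) (fun x hx => by
          rw [uIoc_of_le hr.1] at hx
          rw [Real.norm_eq_abs, abs_of_nonneg (mul_nonneg hx.1.le (hp0 x))]
          nlinarith [hx.1, hx.2, hr.2, hp0 x, hp1 x])
      have h2 := le_trans (le_abs_self _) this
      rw [sub_zero, abs_of_nonneg hr.1] at h2
      have : A r ≤ 1 * r := h2
      linarith [hr.2]
    constructor
    · exact Real.one_le_exp (by positivity)
    · exact Real.exp_le_exp.2 (by nlinarith)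

lemma aux_bdd (D : GelfandData) (α : ℝ) (hα : 0 < α) : BddAbove (solvableSet D α) := by
  obtain ⟨δ, hδ0, hδ1, hδ⟩ := aux_psi_half D
  obtain ⟨m, hmC, hmd, hmpos, hmb⟩ := aux_mu D α hα
  set c : ℝ := 1 / (4 * Real.exp α) with hc
  have hc0 : 0 < c := by positivity
  refine ⟨D.K * 2 / (c * δ ^ 2), ?_⟩
  rintro lam ⟨hlam, u, hu1, hu2, hupos, hu0, hu1z, hode⟩
  set v : ℝ → ℝ := derivWithin u (Icc 0 1) with hv
  have hvc : ContinuousOn v (Icc 0 1) :=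
    ((contDiffOn_one_iff_derivWithin (uniqueDiffOn_Icc zero_lt_one)).1 hu1).2
  have hud : ∀ r ∈ Ioo (0:ℝ) 1, HasDerivAt u (v r) r := fun r hr =>
    ((hu1.differentiableOn (by norm_num)) r (Ioo_subset_Icc_self hr)).hasDerivWithinAt.hasDerivAt
      (Icc_mem_nhds hr.1 hr.2)
  have hvd : ∀ r ∈ Ioo (0:ℝ) 1, HasDerivAt v (derivWithin v (Ioo 0 1) r) r := by
    intro r hr
    have h2 : ContDiffOn ℝ (1 + 1) u (Ioo 0 1) := by norm_num; exact hu2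
    have h3 := ((contDiffOn_succ_iff_deriv_of_isOpen isOpen_Ioo).1 h2).2.2
    have h4 : DifferentiableOn ℝ v (Ioo 0 1) :=
      (h3.differentiableOn (by norm_num)).congr fun x hx => (hud x hx).deriv.symm
    exact (h4 r hr).hasDerivWithinAt.hasDerivAt (isOpen_Ioo.mem_nhds hr)
  have hunn : ∀ r ∈ Icc (0:ℝ) 1, 0 ≤ u r := by
    intro r hr
    rcases eq_or_lt_of_le hr.2 with h | h
    · rw [h, hu1z]
    · exact (hupos r ⟨hr.1, h⟩).le
  set P : ℝ → ℝ := fun r => r * m r * v r with hP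
  have hPc : ContinuousOn P (Icc 0 1) :=
    (continuous_id.mul hmC.continuous).continuousOn.mul hvc
  have hPd : ∀ r ∈ Ioo (0:ℝ) 1, HasDerivAt P (-(lam * r * m r * D.psi r * D.f (u r))) r := by
    intro r hr
    have h := (((hasDerivAt_id r).mul (hmd r (Ioo_subset_Icc_self hr))).mul (hvd r hr))
    have ho := hode r hr
    have hr0 : r ≠ 0 := hr.1.ne'
    have ho2 : derivWithin v (Ioo 0 1) r = -(1 / r + α * r * D.phi r) * v r
      - lam * D.psi r * D.f (u r) := by linarith
    refine h.congr_deriv ?_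
    simp only [id, Pi.mul_apply]
    rw [ho2]
    field_simp
    ring
  have hP0 : P 0 = 0 := by simp [hP]
  have hPnonpos : ∀ r ∈ Icc (0:ℝ) 1, P r ≤ 0 := by
    have : AntitoneOn P (Icc 0 1) := by
      refine antitoneOn_of_hasDerivWithinAt_nonpos (convex_Icc _ _) hPc
        (f' := fun r => -(lam * r * m r * D.psi r * D.f (u r))) ?_ ?_
      · intro x hx
        rw [interior_Icc] at hx ⊢
        exact (hPd x hx).hasDerivWithinAt
      · intro x hx
        rw [interior_Icc] at hx
        have hx' := Ioo_subset_Icc_self hx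
        have := D.psi_nonneg x hx'
        have := D.f_pos _ (hunn x hx')
        have := hmpos x
        have := hx.1
        simp only [Left.neg_nonpos_iff]
        positivity
    intro r hr
    rw [← hP0]
    exact this ⟨le_rfl, zero_le_one⟩ hr hr.1
  have hvnp : ∀ r ∈ Ioo (0:ℝ) 1, v r ≤ 0 := by
    intro r hr
    have h := hPnonpos r (Ioo_subset_Icc_self hr)
    by_contra hcon
    push Not at hcon
    have := mul_pos (mul_pos hr.1 (hmpos r)) hcon
    simp only [hP] at h
    linarith
  have hua : AntitoneOn u (Icc 0 1) := by
    refine antitoneOn_of_hasDerivWithinAt_nonpos (convex_Icc _ _) hu1.continuousOn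
      (f' := v) ?_ ?_
    · intro x hx
      rw [interior_Icc] at hx ⊢
      exact (hud x hx).hasDerivWithinAt
    · intro x hx
      rw [interior_Icc] at hx
      exact hvnp x hx
  have key : ∀ s ∈ Ioo (0:ℝ) δ, v s ≤ - (lam * c * s * D.f (u s)) := by
    intro s hs
    have hs1 : s < 1 := hs.2.trans hδ1
    have hfs := D.f_pos _ (hunn s ⟨hs.1.le, hs1.le⟩)
    have hA : AntitoneOn (fun t => P t + lam * D.f (u s) / 4 * t ^ 2) (Icc 0 s) := by
      refine antitoneOn_of_hasDerivWithinAt_nonpos (convex_Icc _ _)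
        ((hPc.mono (Icc_subset_Icc_right hs1.le)).add (by fun_prop))
        (f' := fun r => -(lam * r * m r * D.psi r * D.f (u r)) + lam * D.f (u s) / 4 * (2 * r)) ?_ ?_
      · intro x hx
        rw [interior_Icc] at hx ⊢
        have h2 : HasDerivAt (fun t : ℝ => lam * D.f (u s) / 4 * t ^ 2)
            (lam * D.f (u s) / 4 * (2 * x)) x := by
          simpa using (hasDerivAt_pow 2 x).const_mul (lam * D.f (u s) / 4)
        exact ((hPd x ⟨hx.1, hx.2.trans hs1⟩).add h2).hasDerivWithinAt
      · intro x hx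
        rw [interior_Icc] at hx
        have hx1 : x ∈ Icc (0:ℝ) 1 := ⟨hx.1.le, (hx.2.trans hs1).le⟩
        have hf : D.f (u s) ≤ D.f (u x) :=
          D.f_mono (hunn s ⟨hs.1.le, hs1.le⟩) (hunn x hx1) (hua hx1 ⟨hs.1.le, hs1.le⟩ hx.2.le)
        have h1 : 1 * (1/2) ≤ m x * D.psi x :=
          mul_le_mul (hmb x hx1).1 (hδ x ⟨hx.1.le, (hx.2.trans hs.2).le⟩) (by norm_num) (hmpos x).le
        have h2 : (1 * (1/2)) * D.f (u s) ≤ (m x * D.psi x) * D.f (u x) :=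
          mul_le_mul h1 hf hfs.le (by linarith)
        have h3 := mul_le_mul_of_nonneg_left h2 (mul_pos hlam hx.1).le
        show _ + _ ≤ 0
        linarith
    have h1 := hA ⟨le_rfl, hs.1.le⟩ ⟨hs.1.le, le_rfl⟩ hs.1.le
    simp only [hP0] at h1
    have h2 : s * m s * v s + lam * D.f (u s) / 4 * s ^ 2 ≤ 0 := by simpa [hP] using h1
    have h3 : m s * v s + lam * D.f (u s) / 4 * s ≤ 0 := by
      by_contra hcon
      push Not at hcon
      have := mul_pos hs.1 hcon
      nlinarith
    have h4 : m s * v s ≥ Real.exp α * v s := by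
      have := (hmb s ⟨hs.1.le, hs1.le⟩).2
      have := hvnp s ⟨hs.1, hs1⟩
      nlinarith
    have hE := Real.exp_pos α
    have h5 : v s ≤ - (lam * D.f (u s) / 4 * s) / Real.exp α := by
      rw [le_div_iff₀ hE]; linarith
    refine h5.trans (le_of_eq ?_)
    rw [hc]; field_simp
  -- the primitive of 1/f
  set g : ℝ → ℝ := fun s => 1 / D.f (max s 0) with hg
  have hgc : Continuous g := by
    refine continuous_const.div (D.f_smooth.continuousOn.comp_continuous (by fun_prop)
      fun x => le_max_right x 0) fun x => (D.f_pos _ (le_max_right x 0)).ne'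
  set F : ℝ → ℝ := fun x => ∫ s in (0:ℝ)..x, g s with hF
  have hFd : ∀ x, HasDerivAt F (g x) x := fun x => (hgc.integral_hasStrictDerivAt 0 x).hasDerivAt
  have hF0 : ∀ x, 0 ≤ x → 0 ≤ F x := fun x hx =>
    intervalIntegral.integral_nonneg hx fun s hs => (one_div_pos.2 (D.f_pos _ (le_max_right s 0))).le
  have hFK : ∀ x, 0 ≤ x → F x ≤ D.K := by
    intro x hx
    rw [D.K_def]
    simp only [hF]
    rw [intervalIntegral.integral_of_le hx]
    have : ∫ s in Ioc 0 x, g s = ∫ s in Ioc 0 x, 1 / D.f s :=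
      setIntegral_congr_fun measurableSet_Ioc fun s hs => by simp only [hg]; rw [max_eq_left hs.1.le]
    rw [this]
    refine setIntegral_mono_set D.f_int ?_ (Eventually.of_forall fun s hs => hs.1)
    refine (ae_restrict_iff' measurableSet_Ioi).2 (Eventually.of_forall fun s hs => ?_)
    exact (one_div_pos.2 (D.f_pos s (le_of_lt hs))).le
  have hfin : AntitoneOn (fun r => F (u r) + lam * c / 2 * r ^ 2) (Icc 0 δ) := by
    have hFc : Continuous F := continuous_iff_continuousAt.2 fun x => (hFd x).continuousAt
    refine antitoneOn_of_hasDerivWithinAt_nonpos (convex_Icc _ _)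
      ((hFc.comp_continuousOn (hu1.continuousOn.mono (Icc_subset_Icc_right hδ1.le))).add (by fun_prop))
      (f' := fun r => g (u r) * v r + lam * c / 2 * (2 * r)) ?_ ?_
    · intro x hx
      rw [interior_Icc] at hx ⊢
      have h2 : HasDerivAt (fun t : ℝ => lam * c / 2 * t ^ 2) (lam * c / 2 * (2 * x)) x := by
        simpa using (hasDerivAt_pow 2 x).const_mul (lam * c / 2)
      exact (((hFd (u x)).comp x (hud x ⟨hx.1, hx.2.trans hδ1⟩)).add h2).hasDerivWithinAt
    · intro x hx
      rw [interior_Icc] at hx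
      have hux := hunn x ⟨hx.1.le, (hx.2.trans hδ1).le⟩
      have hfx := D.f_pos _ hux
      have hk := key x hx
      have : g (u x) = 1 / D.f (u x) := by simp only [hg]; rw [max_eq_left hux]
      show _ + _ ≤ 0
      rw [this]
      have h5 := mul_le_mul_of_nonneg_left hk (one_div_pos.2 hfx).le
      have h6 : 1 / D.f (u x) * -(lam * c * x * D.f (u x)) = - (lam * c * x) := by field_simp
      linarith
  have hlast := hfin ⟨le_rfl, hδ0.le⟩ ⟨hδ0.le, le_rfl⟩ hδ0.le
  simp only at hlast
  have h1 := hF0 (u δ) (hunn δ ⟨hδ0.le, hδ1.le⟩)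
  have h2 := hFK (u 0) (hunn 0 ⟨le_rfl, zero_le_one⟩)
  rw [le_div_iff₀ (by positivity)]
  linarith

noncomputable def auxH (m w : ℝ → ℝ) (s : ℝ) : ℝ :=
  s * (∫ t in (0:ℝ)..1, t * m (t * s) * w (t * s)) / m s

lemma auxH_cont {m w : ℝ → ℝ} (hm : Continuous m) (hw : Continuous w) (hmpos : ∀ r, 0 < m r) :
    Continuous (auxH m w) := by
  unfold auxH
  refine (continuous_id.mul ?_).div hm fun x => (hmpos x).ne'
  refine intervalIntegral.continuous_parametric_intervalIntegral_of_continuous' ?_ 0 1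
  simp only [Function.uncurry_def]
  fun_prop

lemma auxH_eq {m w : ℝ → ℝ} (hmpos : ∀ r, 0 < m r) {s : ℝ} (hs : s ≠ 0) :
    auxH m w s = (∫ t in (0:ℝ)..s, t * m t * w t) / (s * m s) := by
  have h := intervalIntegral.mul_integral_comp_mul_right (a := 0) (b := 1)
    (f := fun t => t * m t * w t) s
  rw [zero_mul, one_mul] at h
  rw [← h]
  have h2 : ∫ t in (0:ℝ)..1, t * s * m (t * s) * w (t * s)
      = s * ∫ t in (0:ℝ)..1, t * m (t * s) * w (t * s) := by
    rw [← intervalIntegral.integral_const_mul]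
    congr 1; ext t; ring
  rw [h2, auxH]
  have := (hmpos s).ne'
  field_simp

lemma auxH_dist {m w w' : ℝ → ℝ} {E C : ℝ} (hm : Continuous m) (hw : Continuous w)
    (hw' : Continuous w') (hmb : ∀ r ∈ Icc (0:ℝ) 1, 1 ≤ m r ∧ m r ≤ E)
    (hC : ∀ r ∈ Icc (0:ℝ) 1, |w r - w' r| ≤ C) {s : ℝ} (hs : s ∈ Icc (0:ℝ) 1) :
    |auxH m w s - auxH m w' s| ≤ E * C := by
  have hE : 1 ≤ E := (hmb s hs).1.trans (hmb s hs).2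
  have hC0 : 0 ≤ C := (abs_nonneg _).trans (hC s hs)
  have h1 : auxH m w s - auxH m w' s =
      s * (∫ t in (0:ℝ)..1, t * m (t * s) * (w (t * s) - w' (t * s))) / m s := by
    unfold auxH
    rw [← sub_div, ← mul_sub, ← intervalIntegral.integral_sub]
    · congr 3; ext t; ring
    · exact Continuous.intervalIntegrable (by fun_prop) _ _
    · exact Continuous.intervalIntegrable (by fun_prop) _ _
  have h2 : |∫ t in (0:ℝ)..1, t * m (t * s) * (w (t * s) - w' (t * s))| ≤ E * C * |1 - 0| := by
    rw [← Real.norm_eq_abs]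
    refine intervalIntegral.norm_integral_le_of_norm_le_const fun t ht => ?_
    rw [uIoc_of_le zero_le_one] at ht
    have hts : t * s ∈ Icc (0:ℝ) 1 :=
      ⟨mul_nonneg ht.1.le hs.1, by nlinarith [ht.1, ht.2, hs.1, hs.2]⟩
    have hm1 := hmb _ hts
    rw [Real.norm_eq_abs, abs_mul, abs_mul, abs_of_pos ht.1, abs_of_pos (by linarith : 0 < m (t*s))]
    refine mul_le_mul ?_ (hC _ hts) (abs_nonneg _) (by linarith)
    nlinarith [ht.1, ht.2]
  rw [h1, abs_div, abs_mul, abs_of_nonneg hs.1]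
  have hms := (hmb s hs).1
  rw [abs_of_pos (by linarith : 0 < m s), div_le_iff₀ (by linarith)]
  rw [sub_zero, abs_one, mul_one] at h2
  have h3 := mul_le_mul hs.2 h2 (abs_nonneg _) zero_le_one
  have : 0 ≤ E * C := by positivity
  nlinarith

lemma aux_nonempty (D : GelfandData) (α : ℝ) (hα : 0 < α) : (solvableSet D α).Nonempty := by
  obtain ⟨δ, hδ0, hδ1, hδ⟩ := aux_psi_half D
  obtain ⟨m, hmC, hmd, hmpos, hmb⟩ := aux_mu D α hα
  have hmc := hmC.continuous
  have hf01 : ContDiffOn ℝ 1 D.f (Icc 0 1) := D.f_smooth.mono Icc_subset_Ici_self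
  obtain ⟨L, hL⟩ := hf01.exists_lipschitzOnWith (by norm_num) (convex_Icc _ _) isCompact_Icc
  have hL0 : (0:ℝ) ≤ L := L.2
  set pr : ℝ → Icc (0:ℝ) 1 := projIcc (0:ℝ) 1 zero_le_one with hpr
  set g : ℝ → ℝ := fun t => D.f (pr t) with hg
  have hgc : Continuous g := aux_ext_cont hf01.continuousOn
  have hgpos : ∀ t, 0 < g t := fun t => D.f_pos _ (pr t).2.1
  have hg1 : ∀ t, g t ≤ D.f 1 := fun t =>
    D.f_mono (pr t).2.1 (zero_le_one (α := ℝ)) (pr t).2.2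
  have hgL : ∀ x y, |g x - g y| ≤ L * |x - y| := by
    intro x y
    refine (hL.dist_le_mul _ (pr x).2 _ (pr y).2).trans ?_
    refine mul_le_mul_of_nonneg_left ?_ hL0
    have := (LipschitzWith.projIcc (zero_le_one (α := ℝ))).dist_le_mul x y
    simpa [Real.dist_eq, Subtype.dist_eq] using this
  set q : ℝ → ℝ := fun t => D.psi (pr t) with hq
  have hqc : Continuous q := aux_ext_cont D.psi_lip.choose_spec.continuousOn
  have hq0 : ∀ t, 0 ≤ q t := fun t => D.psi_nonneg _ (pr t).2
  have hq1 : ∀ t, q t ≤ 1 := fun t => by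
    rw [← D.psi_zero]
    exact D.psi_anti ⟨le_rfl, zero_le_one⟩ (pr t).2 (pr t).2.1
  have hpre : ∀ t, t ∈ Icc (0:ℝ) 1 → (pr t : ℝ) = t := fun t ht => by
    simp only [hpr]; rw [projIcc_of_mem zero_le_one ht]
  have hf1 := D.f_pos 1 zero_le_one
  set E := Real.exp α with hE
  have hEpos : 0 < E := Real.exp_pos α
  set lam : ℝ := 1 / (2 * E * (L + D.f 1)) with hlamdef
  have hlam : 0 < lam := by positivity
  have hlamE : lam * E * (L + D.f 1) = 1 / 2 := by rw [hlamdef]; field_simp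
  set W : C(Icc (0:ℝ) 1, ℝ) → ℝ → ℝ := fun v t => q t * g (v (pr t)) with hW
  have hWc : ∀ v, Continuous (W v) := fun v =>
    hqc.mul (hgc.comp (v.continuous.comp continuous_projIcc))
  have hHc : ∀ v, Continuous (auxH m (W v)) := fun v => auxH_cont hmc (hWc v) hmpos
  set U : C(Icc (0:ℝ) 1, ℝ) → ℝ → ℝ := fun v r => lam * ∫ s in r..1, auxH m (W v) s with hU
  have hUd : ∀ v r, HasDerivAt (U v) (-(lam * auxH m (W v) r)) r := by
    intro v r
    have h := ((hHc v).integral_hasStrictDerivAt 1 r).hasDerivAt.const_mul (-lam)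
    refine (h.congr_deriv (by ring)).congr_of_eventuallyEq (Eventually.of_forall fun x => ?_)
    simp only [hU]
    rw [intervalIntegral.integral_symm]; ring
  have hUc : ∀ v, Continuous (U v) := fun v =>
    continuous_iff_continuousAt.2 fun x => (hUd v x).continuousAt
  set T : C(Icc (0:ℝ) 1, ℝ) → C(Icc (0:ℝ) 1, ℝ) := fun v =>
    ⟨fun r => U v r, (hUc v).comp continuous_subtype_val⟩ with hT
  have hcontr : ContractingWith (1/2 : NNReal) T := by
    refine ⟨by rw [← NNReal.coe_lt_coe]; norm_num, LipschitzWith.of_dist_le_mul fun v v' => ?_⟩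
    rw [ContinuousMap.dist_le (by positivity)]
    intro r
    have hdiff : U v r - U v' r = lam * ∫ s in (r:ℝ)..1, (auxH m (W v) s - auxH m (W v') s) := by
      simp only [hU]
      rw [intervalIntegral.integral_sub ((hHc v).intervalIntegrable _ _)
        ((hHc v').intervalIntegrable _ _)]
      ring
    have hw : ∀ t ∈ Icc (0:ℝ) 1, |W v t - W v' t| ≤ L * dist v v' := by
      intro t _
      simp only [hW]
      rw [← mul_sub, abs_mul, abs_of_nonneg (hq0 t)]
      have h1 := hgL (v (pr t)) (v' (pr t))
      have h2 : |v (pr t) - v' (pr t)| ≤ dist v v' := by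
        rw [← Real.dist_eq]; exact ContinuousMap.dist_apply_le_dist (pr t)
      have h3 := h1.trans (mul_le_mul_of_nonneg_left h2 hL0)
      have := mul_le_mul (hq1 t) h3 (abs_nonneg _) zero_le_one
      linarith
    have hint : |∫ s in (r:ℝ)..1, (auxH m (W v) s - auxH m (W v') s)|
        ≤ E * (L * dist v v') * |1 - (r:ℝ)| := by
      rw [← Real.norm_eq_abs]
      refine intervalIntegral.norm_integral_le_of_norm_le_const fun t ht => ?_
      rw [uIoc_of_le r.2.2] at ht
      exact auxH_dist hmc (hWc v) (hWc v') hmb hw ⟨r.2.1.trans ht.1.le, ht.2⟩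
    show dist (U v r) (U v' r) ≤ _
    rw [Real.dist_eq, hdiff, abs_mul, abs_of_pos hlam]
    have hr1 : |1 - (r:ℝ)| ≤ 1 := by
      rw [abs_of_nonneg (by linarith [r.2.2])]; linarith [r.2.1]
    have hd : 0 ≤ dist v v' := dist_nonneg
    have h4 : |∫ s in (r:ℝ)..1, (auxH m (W v) s - auxH m (W v') s)| ≤ E * (L * dist v v') := by
      refine hint.trans ?_
      have : 0 ≤ E * (L * dist v v') := by positivity
      nlinarith
    have h5 := mul_le_mul_of_nonneg_left h4 hlam.le
    have h6 : lam * E * L ≤ 1 / 2 := by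
      rw [← hlamE]
      exact mul_le_mul_of_nonneg_left (by linarith) (by positivity)
    have h7 := mul_le_mul_of_nonneg_right h6 hd
    have : ((1/2 : NNReal) : ℝ) = 1/2 := by norm_num
    rw [this]
    linarith
  obtain ⟨v, hfix⟩ : ∃ v, T v = v := ⟨_, hcontr.fixedPoint_isFixedPt⟩
  have hv : ∀ r : Icc (0:ℝ) 1, v r = U v r := fun r => by
    conv_lhs => rw [← hfix]
    rfl
  set w := W v with hw
  set h := auxH m w with hh
  set u := U v with hu
  have hwc : Continuous w := hWc v
  have hw0 : ∀ t, 0 ≤ w t := fun t => mul_nonneg (hq0 t) (hgpos _).le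
  have hhpos : ∀ s ∈ Ioc (0:ℝ) 1, 0 < h s := by
    intro s hs
    simp only [hh, auxH]
    refine div_pos (mul_pos hs.1 ?_) (hmpos s)
    refine intervalIntegral.integral_pos zero_lt_one (Continuous.continuousOn (by fun_prop)) ?_ ?_
    · intro t ht
      exact mul_nonneg (mul_nonneg ht.1.le (hmpos _).le) (hw0 _)
    · refine ⟨δ, ⟨hδ0.le, hδ1.le⟩, mul_pos (mul_pos hδ0 (hmpos _)) (mul_pos ?_ (hgpos _))⟩
      have h1 : δ * s ≤ δ := by nlinarith [hs.2]
      have h0 : 0 ≤ δ * s := mul_nonneg hδ0.le hs.1.le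
      simp only [hq]
      rw [hpre _ ⟨h0, h1.trans hδ1.le⟩]
      linarith [hδ _ ⟨h0, h1⟩]
  have hupos : ∀ r ∈ Ico (0:ℝ) 1, 0 < u r := by
    intro r hr
    refine mul_pos hlam (intervalIntegral.intervalIntegral_pos_of_pos_on
      ((hHc v).intervalIntegrable _ _) (fun x hx => ?_) hr.2)
    exact hhpos x ⟨hr.1.trans_lt hx.1, hx.2.le⟩
  have hu1 : u 1 = 0 := by simp [hu, hU]
  have hule : ∀ r ∈ Icc (0:ℝ) 1, u r ≤ 1 := by
    intro r hr
    have hint : |∫ s in (r:ℝ)..1, h s| ≤ E * D.f 1 * |1 - (r:ℝ)| := by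
      rw [← Real.norm_eq_abs]
      refine intervalIntegral.norm_integral_le_of_norm_le_const fun t ht => ?_
      rw [uIoc_of_le hr.2] at ht
      have := auxH_dist (w' := fun _ => 0) (C := D.f 1) hmc hwc continuous_const hmb (fun x _ => by
        rw [sub_zero, abs_of_nonneg (hw0 x)]
        have := mul_le_mul (hq1 x) (hg1 (v (pr x))) (hgpos _).le zero_le_one
        rw [one_mul] at this
        exact this) (s := t) ⟨hr.1.trans ht.1.le, ht.2⟩
      have hz : auxH m (fun _ => 0) t = 0 := by simp [auxH]
      rw [hz, sub_zero] at this
      exact this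
    have hr1 : |1 - (r:ℝ)| ≤ 1 := by
      rw [abs_of_nonneg (by linarith [hr.2])]; linarith [hr.1]
    have h1 : (∫ s in (r:ℝ)..1, h s) ≤ E * D.f 1 := by
      refine (le_abs_self _).trans (hint.trans ?_)
      have : 0 ≤ E * D.f 1 := by positivity
      nlinarith
    have h2 := mul_le_mul_of_nonneg_left h1 hlam.le
    have h3 : lam * E * D.f 1 ≤ 1 / 2 := by
      rw [← hlamE]
      exact mul_le_mul_of_nonneg_left (by linarith) (by positivity)
    show lam * _ ≤ 1
    linarith
  have hunn : ∀ r ∈ Icc (0:ℝ) 1, 0 ≤ u r := by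
    intro r hr
    rcases eq_or_lt_of_le hr.2 with h | h
    · rw [h, hu1]
    · exact (hupos r ⟨hr.1, h⟩).le
  have hwe : ∀ r ∈ Icc (0:ℝ) 1, w r = D.psi r * D.f (u r) := by
    intro r hr
    simp only [hw, hW, hq, hg]
    rw [hv, hpre r hr, hpre _ ⟨hunn r hr, hule r hr⟩]
  have hud : ∀ r, HasDerivAt u (-(lam * h r)) r := hUd v
  have hdw : ∀ r ∈ Icc (0:ℝ) 1, derivWithin u (Icc 0 1) r = -(lam * h r) := fun r hr =>
    (hud r).hasDerivWithinAt.derivWithin (uniqueDiffOn_Icc zero_lt_one r hr)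
  have hderiv : deriv u = fun r => -(lam * h r) := funext fun r => (hud r).deriv
  have hhc : Continuous h := hHc v
  have hu_C1 : ContDiff ℝ 1 u := by
    rw [contDiff_one_iff_deriv]
    refine ⟨fun r => (hud r).differentiableAt, ?_⟩
    rw [hderiv]
    fun_prop
  set N : ℝ → ℝ := fun s => ∫ t in (0:ℝ)..s, t * m t * w t with hN
  have hNd : ∀ s, HasDerivAt N (s * m s * w s) s := fun s =>
    (Continuous.integral_hasStrictDerivAt (f := fun t => t * m t * w t) (by fun_prop) 0 s).hasDerivAt
  have hNC : ContDiff ℝ 1 N := by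
    rw [contDiff_one_iff_deriv]
    refine ⟨fun r => (hNd r).differentiableAt, ?_⟩
    rw [show deriv N = fun s => s * m s * w s from funext fun r => (hNd r).deriv]
    fun_prop
  have hhe : ∀ s ∈ Ioo (0:ℝ) 1, h s = N s / (s * m s) := fun s hs => auxH_eq hmpos hs.1.ne'
  have hhC : ContDiffOn ℝ 1 h (Ioo 0 1) := by
    refine ContDiffOn.congr (f := fun s => N s / (s * m s)) ?_ hhe
    exact hNC.contDiffOn.div (contDiff_id.mul hmC).contDiffOn fun s hs =>
      mul_ne_zero hs.1.ne' (hmpos s).ne'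
  refine ⟨lam, hlam, u, hu_C1.contDiffOn, ?_, hupos, ?_, hu1, ?_⟩
  · have : ContDiffOn ℝ (1 + 1) u (Ioo 0 1) := by
      rw [contDiffOn_succ_iff_deriv_of_isOpen isOpen_Ioo]
      refine ⟨hu_C1.contDiffOn.differentiableOn (by norm_num), fun h => by simp at h, ?_⟩
      rw [hderiv]
      exact (contDiffOn_const.mul hhC).neg
    norm_num at this
    exact this
  · rw [hdw 0 ⟨le_rfl, zero_le_one⟩]
    simp [hh, auxH]
  · intro r hr
    have hr' := Ioo_subset_Icc_self hr
    have hr0 : r ≠ 0 := hr.1.ne'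
    have hmr : m r ≠ 0 := (hmpos r).ne'
    have hd : HasDerivAt h ((r * m r * w r * (r * m r) - N r * (1 * m r + r * (m r * (α * r * D.phi r))))
        / (r * m r) ^ 2) r := by
      have h1 := (hNd r).div ((hasDerivAt_id r).mul (hmd r hr')) (mul_ne_zero hr0 hmr)
      refine h1.congr_of_eventuallyEq ?_
      filter_upwards [isOpen_Ioo.mem_nhds hr] with s hs
      exact hhe s hs
    have hd2 : HasDerivWithinAt (derivWithin u (Icc 0 1)) (-(lam * _)) (Ioo 0 1) r :=
      ((hd.const_mul lam).neg.hasDerivWithinAt (s := Ioo 0 1)).congr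
        (fun x hx => hdw x (Ioo_subset_Icc_self hx)) (hdw r hr')
    rw [hd2.derivWithin (isOpen_Ioo.uniqueDiffOn r hr), hdw r hr', hhe r hr, mul_assoc lam,
      ← hwe r hr']
    field_simp
    ring

/-- For every `α > 0`, the set `S_α` of `λ > 0` for which
`(P_{α,λ})` is solvable is nonempty and bounded above; consequently
`λ*(α) = sup S_α` satisfies `0 < λ*(α) < ∞`. -/
theorem lamStar_pos_finite (D : GelfandData) (α : ℝ) (hα : 0 < α) :
    (solvableSet D α).Nonempty ∧ BddAbove (solvableSet D α) ∧ 0 < lamStar D α := by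
  have hne := aux_nonempty D α hα
  have hb := aux_bdd D α hα
  refine ⟨hne, hb, ?_⟩
  obtain ⟨x, hx⟩ := hne
  exact hx.1.trans_le (le_csSup hb hx)
end
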